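/- arXiv:2412.06524 — 5 statements merged into one kernel-verified Lean document; each statement's English description precedes it below -/
import Mathlib

section
/- Fix integers 0 < k < n and a permutation σ ∈ S_n. Then for every integer m ≥ 0, the m-th equivariant H*-coefficient of the hypersimplex Δ_{k,n} at σ satisfies H*_m(σ) = Σ_{h=0}^{k−1} ( Σ_{I ∈ 𝓘_h} (−1)^{|I|} · C(λ_1,I_1)·C(λ_2,I_2)⋯C(λ_{k−1},I_{k−1}) ) · |Φ_{k−h}(σ, m(k−h) − h)|, where C(a,b) denotes the binomial coefficient. -/
open Finset

/-- The set of cycle sets (orbits, counting fixed points as 1-cycles) of a permutation. -/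
def cycleSets {n : ℕ} (σ : Equiv.Perm (Fin n)) : Finset (Finset (Fin n)) :=
  Finset.image (fun x => Finset.univ.filter fun y => σ.SameCycle x y) Finset.univ

/-- λ_i : the number of cycles of σ of length i (fixed points count as 1-cycles). -/
def cycleCount {n : ℕ} (σ : Equiv.Perm (Fin n)) (i : ℕ) : ℕ :=
  ((cycleSets σ).filter fun C => C.card = i).card

/-- N_d(σ): the number of lattice points x ∈ ℤ^n with 0 ≤ x_i ≤ d, Σ x_i = k·d,
    and x_{σ(i)} = x_i for all i. -/
def fixedPtCount {n : ℕ} (k : ℕ) (σ : Equiv.Perm (Fin n)) (d : ℕ) : ℕ :=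
  (Finset.univ.filter fun x : Fin n → Fin (d+1) =>
    (∑ i, (x i : ℕ)) = k * d ∧ ∀ i, x (σ i) = x i).card

/-- 𝓘_h : the (k−1)-tuples I of non-negative integers with Σ_{i=1}^{k-1} i·I_i = h. -/
def Iset (k h : ℕ) : Finset (Fin (k-1) → ℕ) :=
  ((Finset.univ : Finset (Fin (k-1) → Fin (h+1))).filter
    fun I => ∑ i : Fin (k-1), ((i : ℕ) + 1) * (I i : ℕ) = h).image fun I i => (I i : ℕ)

/-- |Φ_k(σ,m)|: the number of functions from the (set of) cycles of σ to {0,…,k−1}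
    with Σ_C f(C)·|C| = m.  (Empty for m < 0.) -/
noncomputable def PhiCard {n : ℕ} (σ : Equiv.Perm (Fin n)) (k : ℕ) (m : ℤ) : ℕ :=
  Set.ncard {f : {A // A ∈ cycleSets σ} → Fin k |
    ∑ C : {A // A ∈ cycleSets σ}, ((f C : ℕ) : ℤ) * ((C : Finset (Fin n)).card : ℤ) = m}


open PowerSeries in
theorem hs_coeff_mul_expand (q : ℕ) (hq : q ≠ 0) (A B : PowerSeries ℤ) (N M : ℕ)
    (h : N < q * M) :
    coeff N (A * PowerSeries.expand q hq B) =
      ∑ j ∈ Finset.range M, coeff j B * coeff N ((X : PowerSeries ℤ) ^ (q * j) * A) := by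
  rw [mul_comm, coeff_mul, Finset.Nat.sum_antidiagonal_eq_sum_range_succ_mk]
  have h1 : ∑ j ∈ Finset.range M, coeff j B * coeff N ((X : PowerSeries ℤ) ^ (q * j) * A)
      = ∑ j ∈ (Finset.range M).filter (fun j => q * j ≤ N), coeff j B * coeff (N - q * j) A := by
    rw [Finset.sum_filter]
    refine Finset.sum_congr rfl fun j _ => ?_
    rw [coeff_X_pow_mul']
    split_ifs <;> simp
  rw [h1]
  symm
  refine Finset.sum_of_injOn (fun j => q * j) ?_ ?_ ?_ ?_
  · intro a _ b _ hab
    exact Nat.eq_of_mul_eq_mul_left (Nat.pos_of_ne_zero hq) hab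
  · intro a ha
    simp at ha ⊢
    omega
  · intro i hi hni
    have : ¬ q ∣ i := by
      rintro ⟨j, rfl⟩
      apply hni
      refine ⟨j, ?_, rfl⟩
      simp at hi ⊢
      refine ⟨?_, by omega⟩
      have : q * j < q * M := by omega
      exact lt_of_mul_lt_mul_left this (Nat.zero_le _)
    simp only
    rw [coeff_expand_of_not_dvd _ _ _ this, zero_mul]
  · intro j _
    simp only
    rw [coeff_expand_mul]

open PowerSeries in
theorem hs_section (q : ℕ) (hq : q ≠ 0) (A B : PowerSeries ℤ) :
    (PowerSeries.mk fun d => coeff (q * d) (A * PowerSeries.expand q hq B)) =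
      (PowerSeries.mk fun d => coeff (q * d) A) * B := by
  ext d
  rw [coeff_mk, hs_coeff_mul_expand q hq A B (q * d) (d + 1)
    (by have := Nat.pos_of_ne_zero hq; nlinarith), mul_comm _ B, coeff_mul,
    Finset.Nat.sum_antidiagonal_eq_sum_range_succ_mk]
  refine Finset.sum_congr rfl fun j hj => ?_
  have hj' : j ≤ d := by simp at hj; omega
  simp only [coeff_mk]
  rw [coeff_X_pow_mul', if_pos (Nat.mul_le_mul_left q hj'), Nat.mul_sub]

/-- generating polynomial of `PhiCard` -/
noncomputable def hsG {n : ℕ} (σ : Equiv.Perm (Fin n)) (q : ℕ) : PowerSeries ℤ :=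
  ∏ C ∈ cycleSets σ, ∑ j ∈ Finset.range q, ((PowerSeries.X : PowerSeries ℤ) ^ C.card) ^ j

noncomputable def hsD {n : ℕ} (σ : Equiv.Perm (Fin n)) : PowerSeries ℤ :=
  ∏ C ∈ cycleSets σ, (1 - (PowerSeries.X : PowerSeries ℤ) ^ C.card)

theorem hs_G_mul_D {n : ℕ} (σ : Equiv.Perm (Fin n)) (q : ℕ) (hq : q ≠ 0) :
    hsG σ q * hsD σ = PowerSeries.expand q hq (hsD σ) := by
  unfold hsG hsD
  rw [← Finset.prod_mul_distrib, map_prod]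
  refine Finset.prod_congr rfl fun C _ => ?_
  rw [geom_sum_mul_neg, map_sub, map_one, map_pow, PowerSeries.expand_X, pow_right_comm]

theorem hs_card_pos {n : ℕ} (σ : Equiv.Perm (Fin n)) {C : Finset (Fin n)}
    (hC : C ∈ cycleSets σ) : 0 < C.card := by
  unfold cycleSets at hC
  simp only [Finset.mem_image, Finset.mem_univ, true_and] at hC
  obtain ⟨x, rfl⟩ := hC
  exact Finset.card_pos.2 ⟨x, by simpa using Equiv.Perm.SameCycle.refl σ x⟩

theorem hs_exists_P {n : ℕ} (σ : Equiv.Perm (Fin n)) :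
    ∃ P : PowerSeries ℤ, P * hsD σ = 1 := by
  have : IsUnit (hsD σ) := by
    rw [PowerSeries.isUnit_iff_constantCoeff]
    unfold hsD
    rw [map_prod, Finset.prod_eq_one]
    · exact isUnit_one
    · intro C hC
      simp [(hs_card_pos σ hC).ne']
  obtain ⟨u, hu⟩ := this
  exact ⟨↑u⁻¹, by rw [← hu]; simp⟩

theorem hs_coeff_G {n : ℕ} (σ : Equiv.Perm (Fin n)) (q a : ℕ) :
    PowerSeries.coeff a (hsG σ q) = (PhiCard σ q (a : ℤ) : ℤ) := by
  classical
  unfold hsG PhiCard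
  rw [← Finset.prod_coe_sort]
  simp_rw [← Fin.sum_univ_eq_sum_range (fun j => ((PowerSeries.X : PowerSeries ℤ) ^ _) ^ j) q]
  rw [Finset.prod_univ_sum]
  simp_rw [← pow_mul]
  rw [Set.ncard_eq_toFinset_card']
  simp only [Finset.prod_pow_eq_pow_sum, map_sum, PowerSeries.coeff_X_pow]
  rw [Fintype.piFinset_univ, Finset.sum_boole]
  congr 2
  ext f
  simp only [Finset.mem_filter, Finset.mem_univ, true_and, Set.mem_toFinset, Set.mem_ofPred_eq]
  rw [eq_comm]
  constructor
  · intro h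
    rw [← h]
    push_cast
    exact Finset.sum_congr rfl fun _ _ => mul_comm _ _
  · intro h
    zify
    rw [← h]
    exact Finset.sum_congr rfl fun _ _ => mul_comm _ _

theorem hs_Phi_neg {n : ℕ} (σ : Equiv.Perm (Fin n)) (q : ℕ) (a : ℤ) (ha : a < 0) :
    PhiCard σ q a = 0 := by
  unfold PhiCard
  rw [Set.ncard_eq_zero, Set.eq_empty_iff_forall_notMem]
  intro f
  simp only [Set.mem_ofPred_eq]
  intro h
  have : 0 ≤ a := by rw [← h]; positivity
  omega

/-- the cycle of a point -/
def hsCyc {n : ℕ} (σ : Equiv.Perm (Fin n)) (x : Fin n) : {A // A ∈ cycleSets σ} :=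
  ⟨Finset.univ.filter fun y => σ.SameCycle x y, Finset.mem_image_of_mem _ (Finset.mem_univ _)⟩

theorem hsCyc_eq {n : ℕ} (σ : Equiv.Perm (Fin n)) (x y : Fin n) :
    hsCyc σ x = hsCyc σ y ↔ σ.SameCycle x y := by
  constructor
  · intro h
    have h1 : y ∈ (hsCyc σ y).1 := by simpa [hsCyc] using Equiv.Perm.SameCycle.refl σ y
    rw [← h] at h1
    simpa [hsCyc] using h1
  · intro h
    apply Subtype.ext
    ext z
    simp only [hsCyc, Finset.mem_filter, Finset.mem_univ, true_and]
    exact ⟨fun h' => h.symm.trans h', fun h' => h.trans h'⟩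

theorem hsCyc_surj {n : ℕ} (σ : Equiv.Perm (Fin n)) : Function.Surjective (hsCyc σ) := by
  rintro ⟨A, hA⟩
  have hA' := hA
  unfold cycleSets at hA'
  simp only [Finset.mem_image, Finset.mem_univ, true_and] at hA'
  obtain ⟨x, rfl⟩ := hA'
  exact ⟨x, rfl⟩

theorem hs_sum_cyc {n : ℕ} (σ : Equiv.Perm (Fin n)) (g : {A // A ∈ cycleSets σ} → ℕ) :
    ∑ i, g (hsCyc σ i) = ∑ C, g C * C.1.card := by
  rw [← Finset.sum_fiberwise Finset.univ (hsCyc σ)]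
  refine Finset.sum_congr rfl fun C _ => ?_
  rw [Finset.sum_congr rfl (g := fun _ => g C)
    (by intro i hi; simp only [Finset.mem_filter] at hi; rw [hi.2])]
  rw [Finset.sum_const, smul_eq_mul, mul_comm]
  congr 2
  obtain ⟨x, rfl⟩ := hsCyc_surj σ C
  ext y
  simp only [Finset.mem_filter, Finset.mem_univ, true_and]
  rw [eq_comm, hsCyc_eq]
  simp [hsCyc]

theorem hs_fixed {n : ℕ} (k : ℕ) (σ : Equiv.Perm (Fin n)) (d : ℕ) :
    fixedPtCount k σ d = PhiCard σ (d + 1) ((k * d : ℕ) : ℤ) := by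
  classical
  unfold fixedPtCount PhiCard
  rw [Set.ncard_eq_toFinset_card']
  symm
  refine Finset.card_bij (fun f _ i => f (hsCyc σ i)) ?_ ?_ ?_
  · intro f hf
    simp only [Set.mem_toFinset, Set.mem_ofPred_eq] at hf
    simp only [Finset.mem_filter, Finset.mem_univ, true_and]
    constructor
    · rw [hs_sum_cyc σ (fun C => (f C : ℕ))]
      zify
      rw [hf]
      push_cast
      rfl
    · intro i
      congr 1
      rw [hsCyc_eq]
      simpa using Equiv.Perm.SameCycle.refl σ i
  · intro f _ g _ h
    funext C
    obtain ⟨x, rfl⟩ := hsCyc_surj σ C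
    exact congrFun h x
  · intro x hx
    simp only [Finset.mem_filter, Finset.mem_univ, true_and] at hx
    obtain ⟨hx1, hx2⟩ := hx
    have hc : ∀ a b, σ.SameCycle a b → x a = x b := by
      intro a b hab
      obtain ⟨i, _, rfl⟩ := hab.exists_pow_eq'
      have : ∀ j : ℕ, x ((σ ^ j) a) = x a := by
        intro j
        induction j with
        | zero => simp
        | succ j ih => rw [pow_succ', Equiv.Perm.mul_apply, hx2, ih]
      exact (this i).symm
    let f : {A // A ∈ cycleSets σ} → Fin (d + 1) :=
      fun C => x (Function.surjInv (hsCyc_surj σ) C)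
    have hf : (fun i => f (hsCyc σ i)) = x := by
      funext i
      apply hc
      rw [← hsCyc_eq]
      exact Function.surjInv_eq (hsCyc_surj σ) _
    refine ⟨f, ?_, hf⟩
    simp only [Set.mem_toFinset, Set.mem_ofPred_eq]
    have := hs_sum_cyc σ (fun C => (f C : ℕ))
    rw [← hx1, ← hf]
    push_cast
    zify at this
    rw [this]

theorem hs_mem_Iset {k h : ℕ} (I : Fin (k-1) → ℕ) :
    I ∈ Iset k h ↔ ∑ i : Fin (k-1), ((i : ℕ) + 1) * I i = h := by
  unfold Iset
  simp only [Finset.mem_image, Finset.mem_filter, Finset.mem_univ, true_and]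
  constructor
  · rintro ⟨J, hJ, rfl⟩
    exact hJ
  · intro hI
    have hb : ∀ i, I i < h + 1 := by
      intro i
      have := Finset.single_le_sum (f := fun i : Fin (k-1) => ((i : ℕ) + 1) * I i)
        (fun _ _ => Nat.zero_le _) (Finset.mem_univ i)
      rw [hI] at this
      nlinarith
    exact ⟨fun i => ⟨I i, hb i⟩, hI, rfl⟩

theorem hs_binom (Y : PowerSeries ℤ) (l M : ℕ) (h : l < M) :
    (1 - Y) ^ l = ∑ j ∈ Finset.range M, ((-1 : ℤ) ^ j * (l.choose j : ℤ)) • Y ^ j := by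
  rw [sub_eq_neg_add, add_pow]
  rw [← Finset.sum_subset (s₁ := Finset.range (l + 1)) (s₂ := Finset.range M)]
  · refine Finset.sum_congr rfl fun j _ => ?_
    rw [neg_pow, zsmul_eq_mul]
    push_cast
    ring
  · intro x hx
    simp at hx ⊢
    omega
  · intro x _ hx
    simp at hx
    rw [Nat.choose_eq_zero_of_lt (by omega)]
    simp

theorem hs_coeff_big {n : ℕ} (S : Finset (Finset (Fin n))) (h : ℕ)
    (hS : ∀ C ∈ S, h < C.card) (A : PowerSeries ℤ) :
    PowerSeries.coeff h (A * ∏ C ∈ S, (1 - (PowerSeries.X : PowerSeries ℤ) ^ C.card)) =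
      PowerSeries.coeff h A := by
  classical
  induction S using Finset.induction_on with
  | empty => simp
  | insert C S hC ih =>
    rw [Finset.prod_insert hC, mul_left_comm, sub_mul, one_mul, map_sub,
      PowerSeries.coeff_X_pow_mul', if_neg (by have := hS C (by simp); omega), sub_zero]
    exact ih fun C' h' => hS C' (by simp [h'])

theorem hs_coeff_D {n : ℕ} (σ : Equiv.Perm (Fin n)) (k h : ℕ) (hh : h < k) :
    PowerSeries.coeff h (hsD σ) = ∑ I ∈ Iset k h, (-1 : ℤ) ^ (∑ t, I t) *
        ∏ t : Fin (k-1), (Nat.choose (cycleCount σ ((t : ℕ) + 1)) (I t) : ℤ) := by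
  classical
  have h1 : hsD σ = (∏ t : Fin (k-1), (1 - (PowerSeries.X : PowerSeries ℤ) ^ ((t : ℕ) + 1)) ^
      cycleCount σ ((t : ℕ) + 1)) *
      ∏ C ∈ (cycleSets σ).filter (fun C => ¬ C.card < k),
        (1 - (PowerSeries.X : PowerSeries ℤ) ^ C.card) := by
    unfold hsD
    rw [← Finset.prod_filter_mul_prod_filter_not (cycleSets σ) (fun C => C.card < k)]
    congr 1
    rw [Fin.prod_univ_eq_prod_range (fun t => (1 - (PowerSeries.X : PowerSeries ℤ) ^ (t + 1)) ^
      cycleCount σ (t + 1)) (k - 1)]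
    rw [← Finset.prod_fiberwise_of_maps_to (g := fun C => C.card - 1)
      (t := Finset.range (k - 1))]
    · refine Finset.prod_congr rfl fun t ht => ?_
      simp only [Finset.mem_range] at ht
      rw [Finset.prod_congr rfl
        (g := fun _ => (1 - (PowerSeries.X : PowerSeries ℤ) ^ (t + 1)))]
      · rw [Finset.prod_const]
        congr 1
        unfold cycleCount
        congr 1
        ext C
        simp only [Finset.mem_filter]
        constructor
        · rintro ⟨⟨hC, _⟩, h2⟩
          have := hs_card_pos σ hC
          exact ⟨hC, by omega⟩
        · rintro ⟨hC, h2⟩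
          exact ⟨⟨hC, by omega⟩, by omega⟩
      · intro C hC
        simp only [Finset.mem_filter] at hC
        have := hs_card_pos σ hC.1.1
        rw [show C.card = t + 1 by omega]
    · intro C hC
      simp only [Finset.mem_filter] at hC
      have := hs_card_pos σ hC.1
      simp only [Finset.mem_range]
      omega
  rw [h1, hs_coeff_big _ h (by intro C hC; simp only [Finset.mem_filter] at hC; omega)]
  rw [Finset.prod_congr rfl (fun (t : Fin (k-1)) _ =>
    hs_binom ((PowerSeries.X : PowerSeries ℤ) ^ ((t : ℕ) + 1)) (cycleCount σ ((t : ℕ) + 1))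
      (cycleCount σ ((t : ℕ) + 1) + h + 1) (by omega))]
  rw [Finset.prod_univ_sum, map_sum]
  have h2 : Iset k h = (Fintype.piFinset fun t : Fin (k-1) =>
      Finset.range (cycleCount σ ((t : ℕ) + 1) + h + 1)).filter
      (fun I => h = ∑ i : Fin (k-1), ((i : ℕ) + 1) * I i) := by
    ext I
    rw [hs_mem_Iset, Finset.mem_filter, Fintype.mem_piFinset, eq_comm]
    refine ⟨fun hI => ⟨fun i => ?_, hI⟩, fun hI => hI.2⟩
    have := Finset.single_le_sum (f := fun i : Fin (k-1) => ((i : ℕ) + 1) * I i)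
        (fun _ _ => Nat.zero_le _) (Finset.mem_univ i)
    rw [← hI] at this
    simp only [Finset.mem_range]
    nlinarith
  rw [h2, Finset.sum_filter]
  refine Finset.sum_congr rfl fun I _ => ?_
  rw [Finset.prod_smul, Finset.prod_mul_distrib, Finset.prod_pow_eq_pow_sum]
  simp_rw [← pow_mul]
  rw [Finset.prod_pow_eq_pow_sum, map_zsmul, PowerSeries.coeff_X_pow]
  split_ifs <;> simp

/-- Theorem (coefficients of the equivariant H*-polynomial of the hypersimplex):
for 0 < k < n, σ ∈ S_n, and the integers H m = H*_m(σ) determined by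
(Σ_d N_d(σ) t^d)·∏_j (1 − t^{s_j}) = Σ_m H*_m(σ) t^m, we have
H*_m(σ) = Σ_{h=0}^{k−1} (Σ_{I ∈ 𝓘_h} (−1)^{|I|} ∏_i C(λ_i, I_i)) · |Φ_{k−h}(σ, m(k−h) − h)|. -/
theorem Hstar_coeff_hypersimplex {n k : ℕ} (hk : 0 < k) (hkn : k < n)
    (σ : Equiv.Perm (Fin n)) (H : ℕ → ℤ)
    (hH : (PowerSeries.mk fun d => (fixedPtCount k σ d : ℤ)) *
        ∏ C ∈ cycleSets σ, (1 - PowerSeries.X ^ C.card) = PowerSeries.mk fun m => H m)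
    (m : ℕ) :
    H m = ∑ h ∈ Finset.range k,
      (∑ I ∈ Iset k h, (-1 : ℤ) ^ (∑ t, I t) *
        ∏ t : Fin (k-1), (Nat.choose (cycleCount σ ((t : ℕ) + 1)) (I t) : ℤ)) *
      (PhiCard σ (k - h) ((m : ℤ) * ((k : ℤ) - (h : ℤ)) - (h : ℤ)) : ℤ) := by
  obtain ⟨P, hP⟩ := hs_exists_P σ
  have hN : (PowerSeries.mk fun d => (fixedPtCount k σ d : ℤ)) =
      ∑ h ∈ Finset.range k, PowerSeries.C (PowerSeries.coeff h (hsD σ)) *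
        ((PowerSeries.mk fun d => PowerSeries.coeff ((k - h) * d)
          ((PowerSeries.X : PowerSeries ℤ) ^ h * hsG σ (k - h))) * P) := by
    ext d
    rw [PowerSeries.coeff_mk, hs_fixed, ← hs_coeff_G]
    have e1 : hsG σ (d + 1) = P * PowerSeries.expand (d + 1) (by omega) (hsD σ) := by
      rw [← hs_G_mul_D, mul_left_comm, hP, mul_one]
    rw [e1, hs_coeff_mul_expand (d + 1) (by omega) P (hsD σ) (k * d) k (by nlinarith), map_sum]
    refine Finset.sum_congr rfl fun h hh => ?_
    simp only [Finset.mem_range] at hh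
    have hq : k - h ≠ 0 := by omega
    rw [PowerSeries.coeff_C_mul, ← hs_section (k - h) hq, PowerSeries.coeff_mk]
    congr 1
    have e2 : hsG σ (k - h) * PowerSeries.expand (k - h) hq P = P := by
      have : hsG σ (k - h) = P * PowerSeries.expand (k - h) hq (hsD σ) := by
        rw [← hs_G_mul_D, mul_left_comm, hP, mul_one]
      rw [this, mul_assoc, ← map_mul, mul_comm (hsD σ), hP, map_one, mul_one]
    rw [mul_assoc, e2, PowerSeries.coeff_X_pow_mul', PowerSeries.coeff_X_pow_mul']
    obtain ⟨q, rfl⟩ : ∃ q, k = q + h := ⟨k - h, by omega⟩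
    have e3 : (q + h) * d = q * d + h * d := by ring
    have e4 : (d + 1) * h = h * d + h := by ring
    rw [Nat.add_sub_cancel, e3, e4]
    by_cases hc : h ≤ q * d
    · rw [if_pos (by omega), if_pos hc]
      congr 2
      omega
    · rw [if_neg (by omega), if_neg hc]
  have hD : (∏ C ∈ cycleSets σ, (1 - (PowerSeries.X : PowerSeries ℤ) ^ C.card)) = hsD σ := rfl
  rw [hD, hN, Finset.sum_mul] at hH
  have hm := congrArg (PowerSeries.coeff m) hH
  rw [PowerSeries.coeff_mk, map_sum] at hm
  rw [← hm]
  refine Finset.sum_congr rfl fun h hh => ?_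
  simp only [Finset.mem_range] at hh
  rw [mul_assoc, mul_assoc, hP, mul_one, PowerSeries.coeff_C_mul, PowerSeries.coeff_mk,
    hs_coeff_D σ k h hh]
  congr 1
  rw [PowerSeries.coeff_X_pow_mul']
  have e5 : (m : ℤ) * ((k : ℤ) - (h : ℤ)) - (h : ℤ) = (((k - h) * m : ℕ) : ℤ) - (h : ℤ) := by
    push_cast [Nat.cast_sub hh.le]
    ring
  rw [e5]
  split_ifs with hc
  · rw [hs_coeff_G, Nat.cast_sub hc]
  · rw [hs_Phi_neg _ _ _ (by omega)]
    rfl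
end

section
/- Fix integers 0 < k < n and a permutation σ ∈ S_n with cycle lengths s_1,…,s_r. Then for every integer m ≥ 0, the m-th equivariant H*-coefficient of Δ_{k,n} at σ satisfies H*_m(σ) = Σ_{S ⊆ [r]} (−1)^{|S|} · Σ_{h=0}^{k−1} ( Σ_{I ∈ 𝓘_h} (−1)^{|I|} · C(λ_1,I_1)⋯C(λ_{k−1},I_{k−1}) ) · u^σ_{(m−ΣS)(k−h) − h}, where C(a,b) denotes the binomial coefficient. -/
open Finset

/-- u^σ_i: the number of r-tuples a of non-negative integers with Σ_j a_j·s_j = i;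
    zero for i < 0. -/
noncomputable def ucoeff (r : ℕ) (s : Fin r → ℕ) (i : ℤ) : ℕ :=
  Set.ncard {a : Fin r → ℕ | ∑ j, (a j : ℤ) * (s j : ℤ) = i}

theorem hs_aux_count {n r : ℕ} (σ : Equiv.Perm (Fin n)) (s : Fin r → ℕ)
    (hs : Multiset.map s Finset.univ.val = Multiset.map Finset.card (cycleSets σ).val) (i : ℕ) :
    (Finset.univ.filter fun j => s j = i).card = cycleCount σ i := by
  have h := congrArg (Multiset.countP (fun x => x = i)) hs
  rw [Multiset.countP_map, Multiset.countP_map] at h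
  exact h

theorem hs_aux_pos {n r : ℕ} (σ : Equiv.Perm (Fin n)) (s : Fin r → ℕ)
    (hs : Multiset.map s Finset.univ.val = Multiset.map Finset.card (cycleSets σ).val) (j : Fin r) :
    0 < s j := by
  have h : s j ∈ Multiset.map s Finset.univ.val :=
    Multiset.mem_map_of_mem _ (Finset.mem_univ j)
  rw [hs, Multiset.mem_map] at h
  obtain ⟨C, hC, hc⟩ := h
  have hC' : C ∈ cycleSets σ := hC
  unfold cycleSets at hC'
  rw [Finset.mem_image] at hC'
  obtain ⟨x, -, rfl⟩ := hC'
  rw [← hc, Finset.card_pos]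
  exact ⟨x, by simp [Equiv.Perm.SameCycle.refl]⟩

theorem hs_aux_equiv {n r : ℕ} (σ : Equiv.Perm (Fin n)) (s : Fin r → ℕ)
    (hs : Multiset.map s Finset.univ.val = Multiset.map Finset.card (cycleSets σ).val) :
    ∃ e : {C // C ∈ cycleSets σ} ≃ Fin r, ∀ C, s (e C) = C.1.card := by
  have h : ∀ i, Nonempty ({C : {C // C ∈ cycleSets σ} // C.1.card = i} ≃ {j // s j = i}) := by
    intro i
    apply Fintype.card_eq.1
    rw [Fintype.card_subtype (fun j => s j = i), hs_aux_count σ s hs, cycleCount,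
      Fintype.card_subtype, ← Finset.card_map (Function.Embedding.subtype _)]
    congr 1
    ext C
    simp [and_comm]
  let f := fun i => (h i).some
  refine ⟨Equiv.ofFiberEquiv f, fun C => ?_⟩
  exact Equiv.ofFiberEquiv_map f C

theorem hs_aux_cyc {n r : ℕ} (σ : Equiv.Perm (Fin n)) (s : Fin r → ℕ)
    (hs : Multiset.map s Finset.univ.val = Multiset.map Finset.card (cycleSets σ).val) :
    ∃ c : Fin n → Fin r, (∀ i j, c i = c j ↔ σ.SameCycle i j) ∧
      ∀ j, (Finset.univ.filter fun i => c i = j).card = s j := by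
  obtain ⟨e, he⟩ := hs_aux_equiv σ s hs
  have key : ∀ i j, (Finset.univ.filter fun y => σ.SameCycle i y) =
      (Finset.univ.filter fun y => σ.SameCycle j y) ↔ σ.SameCycle i j := by
    intro i j
    constructor
    · intro h
      have : j ∈ (Finset.univ.filter fun y => σ.SameCycle j y) := by
        simp [Equiv.Perm.SameCycle.refl]
      rw [← h] at this
      simpa using this
    · intro h
      ext y
      simp only [Finset.mem_filter, Finset.mem_univ, true_and]
      exact ⟨fun h' => h.symm.trans h', fun h' => h.trans h'⟩
  have hc : ∀ i j, e ⟨Finset.univ.filter fun y => σ.SameCycle i y,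
        Finset.mem_image_of_mem _ (Finset.mem_univ i)⟩ =
      e ⟨Finset.univ.filter fun y => σ.SameCycle j y,
        Finset.mem_image_of_mem _ (Finset.mem_univ j)⟩ ↔ σ.SameCycle i j := by
    intro i j
    rw [e.apply_eq_iff_eq]
    exact Subtype.mk_eq_mk.trans (key i j)
  refine ⟨fun i => e ⟨Finset.univ.filter fun y => σ.SameCycle i y,
    Finset.mem_image_of_mem _ (Finset.mem_univ i)⟩, hc, fun j => ?_⟩
  obtain ⟨⟨C, hC⟩, rfl⟩ := e.surjective j
  rw [he]
  have hC' := hC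
  unfold cycleSets at hC'
  rw [Finset.mem_image] at hC'
  obtain ⟨x, -, rfl⟩ := hC'
  congr 1
  ext y
  simp only [Finset.mem_filter, Finset.mem_univ, true_and]
  rw [hc]
  exact ⟨fun h => h.symm, fun h => h.symm⟩

/-- solutions of the weighted equation, as a finset -/
def solSet (r : ℕ) (s : Fin r → ℕ) (N : ℕ) : Finset (Fin r → ℕ) :=
  (Fintype.piFinset fun _ => Finset.range (N+1)).filter fun a => ∑ j, a j * s j = N

theorem mem_solSet {r : ℕ} {s : Fin r → ℕ} (hpos : ∀ j, 0 < s j) {N : ℕ} {a : Fin r → ℕ} :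
    a ∈ solSet r s N ↔ ∑ j, a j * s j = N := by
  simp only [solSet, Finset.mem_filter, Fintype.mem_piFinset, Finset.mem_range,
    and_iff_right_iff_imp]
  intro h j
  have h1 : a j * s j ≤ ∑ j, a j * s j :=
    Finset.single_le_sum (f := fun j => a j * s j) (fun _ _ => Nat.zero_le _) (Finset.mem_univ j)
  have h2 := Nat.le_mul_of_pos_right (a j) (hpos j)
  omega

theorem ucoeff_neg {r : ℕ} {s : Fin r → ℕ} {i : ℤ} (hi : i < 0) : ucoeff r s i = 0 := by
  unfold ucoeff
  have : {a : Fin r → ℕ | ∑ j, (a j : ℤ) * (s j : ℤ) = i} = ∅ := by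
    ext a
    simp only [Set.mem_ofPred_eq, Set.mem_empty_iff_false, iff_false]
    have : (0:ℤ) ≤ ∑ j, (a j : ℤ) * (s j : ℤ) := by positivity
    omega
  rw [this, Set.ncard_empty]

theorem fixed_count {n k r : ℕ} (σ : Equiv.Perm (Fin n)) (s : Fin r → ℕ)
    (hs : Multiset.map s Finset.univ.val = Multiset.map Finset.card (cycleSets σ).val) (d : ℕ) :
    fixedPtCount k σ d = ((solSet r s (k*d)).filter fun a => ∀ j, a j ≤ d).card := by
  have hpos := hs_aux_pos σ s hs
  obtain ⟨c, hc, hcard⟩ := hs_aux_cyc σ s hs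
  have hsurj : ∀ j, ∃ i, c i = j := by
    intro j
    have := hpos j
    rw [← hcard, Finset.card_pos] at this
    obtain ⟨i, hi⟩ := this
    exact ⟨i, by simpa using hi⟩
  choose g hg using hsurj
  have hsum : ∀ a : Fin r → ℕ, ∑ i, a (c i) = ∑ j, a j * s j := by
    intro a
    rw [← Finset.sum_fiberwise_of_maps_to (t := Finset.univ) (g := c) (fun _ _ => Finset.mem_univ _)]
    refine Finset.sum_congr rfl fun j _ => ?_
    rw [← hcard, mul_comm, ← smul_eq_mul, ← Finset.sum_const]
    refine Finset.sum_congr rfl fun i hi => ?_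
    rw [(Finset.mem_filter.1 hi).2]
  have hinv : ∀ x : Fin n → Fin (d+1), (∀ i, x (σ i) = x i) → ∀ i, x (g (c i)) = x i := by
    intro x hx i
    have h1 : σ.SameCycle (g (c i)) i := (hc _ _).1 (hg _)
    obtain ⟨m, hm⟩ := h1.exists_nat_pow_eq
    suffices h : x ((σ ^ m) (g (c i))) = x (g (c i)) by rw [← h, hm]
    clear hm
    induction m with
    | zero => simp
    | succ m ih => rw [pow_succ', Equiv.Perm.mul_apply, hx]; exact ih
  unfold fixedPtCount
  refine Finset.card_bij (fun x _ j => (x (g j) : ℕ)) ?_ ?_ ?_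
  · intro x hx
    obtain ⟨-, h1, h2⟩ := Finset.mem_filter.1 hx
    rw [Finset.mem_filter, mem_solSet hpos]
    refine ⟨?_, fun j => Nat.le_of_lt_succ (x (g j)).2⟩
    rw [← hsum, ← h1]
    refine Finset.sum_congr rfl fun i _ => ?_
    rw [hinv x h2]
  · intro x hx y hy hxy
    obtain ⟨-, h1, h2⟩ := Finset.mem_filter.1 hx
    obtain ⟨-, h3, h4⟩ := Finset.mem_filter.1 hy
    ext i
    have := congrFun hxy (c i)
    have h5 : (x (g (c i)) : ℕ) = y (g (c i)) := this
    rwa [hinv x h2, hinv y h4] at h5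
  · intro a ha
    rw [Finset.mem_filter, mem_solSet hpos] at ha
    refine ⟨fun i => ⟨a (c i), by have := ha.2 (c i); omega⟩, ?_, ?_⟩
    · simp only [Finset.mem_filter, Finset.mem_univ, true_and]
      refine ⟨by rw [hsum, ha.1], fun i => ?_⟩
      have : c (σ i) = c i := (hc _ _).2 (by simp [Equiv.Perm.SameCycle.refl])
      simp [this]
    · ext j
      simp [hg]

theorem shift_count {r : ℕ} {s : Fin r → ℕ} (hpos : ∀ j, 0 < s j) (N d : ℕ) (T : Finset (Fin r)) :
    ((solSet r s N).filter fun a => ∀ j ∈ T, d < a j).card =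
      ucoeff r s ((N : ℤ) - (d + 1) * ∑ j ∈ T, (s j : ℤ)) := by
  have hind : ∀ a : Fin r → ℕ, ∑ j, ((a j + if j ∈ T then d + 1 else 0 : ℕ) : ℤ) * (s j : ℤ)
      = ∑ j, (a j : ℤ) * s j + (d+1) * ∑ j ∈ T, (s j : ℤ) := by
    intro a
    rw [Finset.mul_sum, ← Finset.sum_filter_add_sum_filter_not Finset.univ (fun j => j ∈ T)
      (fun j => ((a j + if j ∈ T then d + 1 else 0 : ℕ) : ℤ) * (s j : ℤ)),
      ← Finset.sum_filter_add_sum_filter_not Finset.univ (fun j => j ∈ T)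
      (fun j => (a j : ℤ) * (s j : ℤ))]
    have h1 : ∑ j ∈ T, ((d:ℤ) + 1) * (s j : ℤ) = ∑ j with j ∈ T, ((d:ℤ) + 1) * (s j : ℤ) := by
      simp
    rw [h1, add_right_comm, ← Finset.sum_add_distrib]
    congr 1
    · refine Finset.sum_congr rfl fun j hj => ?_
      simp only [Finset.mem_filter, Finset.mem_univ, true_and] at hj
      simp only [hj, if_true]
      push_cast
      ring
    · refine Finset.sum_congr rfl fun j hj => ?_
      simp only [Finset.mem_filter, Finset.mem_univ, true_and] at hj
      simp [hj]
  rw [ucoeff, ← Set.ncard_coe_finset]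
  symm
  refine Set.ncard_congr (fun a _ j => a j + if j ∈ T then d + 1 else 0) ?_ ?_ ?_
  · intro a ha
    simp only [Set.mem_ofPred_eq] at ha
    rw [Finset.mem_coe, Finset.mem_filter, mem_solSet hpos]
    refine ⟨?_, fun j hj => by simp only [hj, if_true]; omega⟩
    zify
    have := hind a
    push_cast at this
    rw [this, ha]
    ring
  · intro a b _ _ hab
    ext j
    have := congrFun hab j
    simpa using this
  · intro b hb
    rw [Finset.mem_coe, Finset.mem_filter, mem_solSet hpos] at hb
    have hb' : (fun j => (b j - if j ∈ T then d + 1 else 0) + if j ∈ T then d + 1 else 0) = b := by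
      ext j
      by_cases hj : j ∈ T
      · have := hb.2 j hj
        simp only [hj, if_true]
        omega
      · simp [hj]
    refine ⟨fun j => b j - if j ∈ T then d + 1 else 0, ?_, hb'⟩
    have := hind (fun j => b j - if j ∈ T then d + 1 else 0)
    have h2 : ∑ j, (b j : ℤ) * (s j : ℤ) = N := by exact_mod_cast hb.1
    rw [Set.mem_ofPred_eq, ← h2]
    rw [eq_sub_iff_add_eq, ← this]
    refine Finset.sum_congr rfl fun j _ => ?_
    have h3 : (b j - if j ∈ T then d + 1 else 0) + (if j ∈ T then d + 1 else 0) = b j :=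
      congrFun hb' j
    rw [h3]

theorem incl_excl {r : ℕ} {s : Fin r → ℕ} (hpos : ∀ j, 0 < s j) (N d : ℕ) :
    ((((solSet r s N).filter fun a => ∀ j, a j ≤ d).card : ℕ) : ℤ) =
      ∑ T : Finset (Fin r), (-1 : ℤ) ^ T.card *
        (ucoeff r s ((N : ℤ) - (d + 1) * ∑ j ∈ T, (s j : ℤ)) : ℤ) := by
  have h1 : ∀ a : Fin r → ℕ, (if ∀ j, a j ≤ d then (1:ℤ) else 0) =
      ∑ T : Finset (Fin r), (-1 : ℤ) ^ T.card * (if ∀ j ∈ T, d < a j then 1 else 0) := by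
    intro a
    have h2 := Finset.prod_sub (fun _ : Fin r => (1:ℤ)) (fun j => if d < a j then 1 else 0)
      Finset.univ
    simp only [Finset.prod_const_one, mul_one, Finset.powerset_univ] at h2
    have h3 : ∀ j, (1:ℤ) - (if d < a j then 1 else 0) = if a j ≤ d then 1 else 0 := by
      intro j
      split_ifs <;> omega
    simp only [h3, Finset.prod_boole] at h2
    simpa using h2
  rw [Finset.card_filter, Nat.cast_sum]
  push_cast
  rw [Finset.sum_congr rfl (fun a _ => h1 a), Finset.sum_comm]
  refine Finset.sum_congr rfl fun T _ => ?_
  rw [← Finset.mul_sum, ← shift_count hpos, Finset.card_filter]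
  push_cast
  rfl

theorem Iset_eq (k h M : ℕ) (hM : h < M) :
    Iset k h = (Fintype.piFinset fun _ : Fin (k-1) => Finset.range M).filter
      fun I => h = ∑ i : Fin (k-1), ((i : ℕ) + 1) * I i := by
  ext I
  simp only [Iset, Finset.mem_image, Finset.mem_filter, Finset.mem_univ, true_and,
    Fintype.mem_piFinset, Finset.mem_range]
  constructor
  · rintro ⟨J, hJ, rfl⟩
    exact ⟨fun i => lt_of_lt_of_le (J i).2 hM, hJ.symm⟩
  · rintro ⟨-, hI⟩
    have hle : ∀ i, I i < h + 1 := by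
      intro i
      have h1 : ((i:ℕ)+1) * I i ≤ ∑ i : Fin (k-1), ((i : ℕ) + 1) * I i :=
        Finset.single_le_sum (f := fun i : Fin (k-1) => ((i : ℕ) + 1) * I i)
          (fun _ _ => Nat.zero_le _) (Finset.mem_univ i)
      have h2 := Nat.le_mul_of_pos_left (I i) (Nat.succ_pos (i:ℕ))
      simp only [Nat.succ_eq_add_one] at h2
      omega
    exact ⟨fun i => ⟨I i, hle i⟩, hI.symm, rfl⟩

theorem one_sub_pow_expand (i l M : ℕ) (hM : l < M) :
    (1 - (PowerSeries.X : PowerSeries ℤ) ^ i) ^ l =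
      ∑ j ∈ Finset.range M, PowerSeries.C ((-1) ^ j * (l.choose j : ℤ)) * PowerSeries.X ^ (i * j) := by
  rw [sub_eq_neg_add, add_pow]
  rw [← Finset.sum_subset (Finset.range_subset_range.2 (Nat.succ_le_of_lt hM))]
  · refine Finset.sum_congr rfl fun j _ => ?_
    rw [neg_pow, pow_mul]
    simp
    ring
  · intro j _ hj
    simp only [Finset.mem_range, not_lt, Nat.succ_eq_add_one] at hj
    rw [Nat.choose_eq_zero_of_lt (by omega)]
    simp

theorem prod_one_sub_X {r : ℕ} (s : Fin r → ℕ) (J : Finset (Fin r)) :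
    ∏ j ∈ J, (1 - (PowerSeries.X : PowerSeries ℤ) ^ s j) =
      ∑ T ∈ J.powerset, PowerSeries.C ((-1) ^ T.card) * PowerSeries.X ^ (∑ j ∈ T, s j) := by
  rw [Finset.prod_sub]
  refine Finset.sum_congr rfl fun T _ => ?_
  rw [Finset.prod_pow_eq_pow_sum]
  simp

theorem coef_eq {k r : ℕ} (s : Fin r → ℕ) (hpos : ∀ j, 0 < s j) (lam : ℕ → ℕ)
    (hlam : ∀ i, (Finset.univ.filter fun j => s j = i).card = lam i) (h : ℕ) (hh : h < k) :
    ∑ I ∈ Iset k h, (-1 : ℤ) ^ (∑ t, I t) * ∏ t : Fin (k-1), (Nat.choose (lam ((t : ℕ) + 1)) (I t) : ℤ)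
      = ∑ T : Finset (Fin r) with ∑ j ∈ T, s j = h, (-1 : ℤ) ^ T.card := by
  set M := h + 1 + ∑ t : Fin (k-1), lam ((t:ℕ)+1) with hMdef
  have hM1 : h < M := by omega
  have hM2 : ∀ t : Fin (k-1), lam ((t:ℕ)+1) < M := by
    intro t
    have := Finset.single_le_sum (f := fun t : Fin (k-1) => lam ((t:ℕ)+1))
          (fun _ _ => Nat.zero_le _) (Finset.mem_univ t)
    have h1 : lam ((t:ℕ)+1) ≤ ∑ t : Fin (k-1), lam ((t:ℕ)+1) := this
    omega
  set J : Finset (Fin r) := Finset.univ.filter fun j => s j < k with hJ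
  have hprod : ∏ j ∈ J, (1 - (PowerSeries.X : PowerSeries ℤ) ^ s j) =
      ∏ t : Fin (k-1), (1 - (PowerSeries.X : PowerSeries ℤ) ^ ((t:ℕ)+1)) ^ lam ((t:ℕ)+1) := by
    rw [Fin.prod_univ_eq_prod_range
      (fun t => (1 - (PowerSeries.X : PowerSeries ℤ) ^ (t+1)) ^ lam (t+1)) (k-1)]
    rw [← Finset.prod_fiberwise_of_maps_to (t := Finset.range (k-1)) (g := fun j => s j - 1)]
    · refine Finset.prod_congr rfl fun t ht => ?_
      rw [Finset.mem_range] at ht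
      rw [← hlam, ← Finset.prod_const]
      have : J.filter (fun j => s j - 1 = t) = Finset.univ.filter fun j => s j = t + 1 := by
        ext j
        have := hpos j
        simp only [hJ, Finset.mem_filter, Finset.mem_univ, true_and]
        omega
      rw [this]
      refine Finset.prod_congr rfl fun j hj => ?_
      rw [(Finset.mem_filter.1 hj).2]
    · intro j hj
      have := hpos j
      simp only [hJ, Finset.mem_filter, Finset.mem_univ, true_and] at hj
      rw [Finset.mem_range]
      omega
  have hL := congrArg (PowerSeries.coeff h) hprod
  rw [prod_one_sub_X, Finset.prod_congr rfl (fun (t : Fin (k-1)) _ => one_sub_pow_expand ((t:ℕ)+1) _ M (hM2 t)),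
    Finset.prod_univ_sum, map_sum, map_sum] at hL
  simp only [Finset.prod_mul_distrib, ← map_prod, Finset.prod_pow_eq_pow_sum,
    PowerSeries.coeff_C_mul, PowerSeries.coeff_X_pow, mul_ite, mul_one, mul_zero] at hL
  rw [← Finset.sum_filter, ← Finset.sum_filter, ← Iset_eq k h M hM1] at hL
  rw [← hL]
  refine Finset.sum_congr ?_ fun _ _ => rfl
  ext T
  simp only [Finset.mem_filter, Finset.mem_powerset, Finset.mem_univ, true_and]
  constructor
  · rintro ⟨-, h1⟩
    exact h1.symm
  · intro h1
    refine ⟨fun j hj => ?_, h1.symm⟩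
    simp only [hJ, Finset.mem_filter, Finset.mem_univ, true_and]
    have := Finset.single_le_sum (f := s) (fun _ _ => Nat.zero_le _) hj
    omega

theorem fixed_formula {n k r : ℕ} (σ : Equiv.Perm (Fin n)) (s : Fin r → ℕ)
    (hs : Multiset.map s Finset.univ.val = Multiset.map Finset.card (cycleSets σ).val) (d : ℕ) 
    (hk : 0 < k) :
    (fixedPtCount k σ d : ℤ) = ∑ h ∈ Finset.range k,
        (∑ I ∈ Iset k h, (-1 : ℤ) ^ (∑ t, I t) *
          ∏ t : Fin (k-1), (Nat.choose (cycleCount σ ((t : ℕ) + 1)) (I t) : ℤ)) *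
        (ucoeff r s ((d : ℤ) * ((k : ℤ) - (h : ℤ)) - (h : ℤ)) : ℤ) := by
  have hpos := hs_aux_pos σ s hs
  rw [fixed_count σ s hs, incl_excl hpos]
  rw [← Finset.sum_subset (Finset.filter_subset (fun T => ∑ j ∈ T, s j ∈ Finset.range k) _)]
  · rw [← Finset.sum_fiberwise_of_maps_to (t := Finset.range k)
      (g := fun T : Finset (Fin r) => ∑ j ∈ T, s j) (fun T hT => (Finset.mem_filter.1 hT).2)]
    refine Finset.sum_congr rfl fun h hh => ?_
    rw [coef_eq s hpos (cycleCount σ) (hs_aux_count σ s hs) h (Finset.mem_range.1 hh),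
      Finset.sum_mul, Finset.filter_filter]
    refine Finset.sum_congr ?_ ?_
    · ext T
      simp only [Finset.mem_filter, Finset.mem_univ, true_and]
      exact ⟨fun h => h.2, fun h1 => ⟨h1 ▸ hh, h1⟩⟩
    · intro T hT
      have h1 : ∑ j ∈ T, (s j : ℤ) = h := by exact_mod_cast (Finset.mem_filter.1 hT).2
      rw [h1]
      congr 3
      push_cast
      ring
  · intro T _ hT
    simp only [Finset.mem_filter, Finset.mem_univ, true_and, Finset.mem_range, not_lt] at hT
    rw [ucoeff_neg]
    · simp
    · have h1 : (k:ℤ) ≤ ∑ j ∈ T, (s j : ℤ) := by exact_mod_cast hT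
      push_cast
      have h2 : (0:ℤ) ≤ d := by positivity
      have h3 : (0:ℤ) < k := by exact_mod_cast hk
      nlinarith

theorem Hstar_coeff_inclusion_exclusion {n k r : ℕ} (hk : 0 < k) (hkn : k < n)
    (σ : Equiv.Perm (Fin n)) (s : Fin r → ℕ)
    (hs : Multiset.map s Finset.univ.val = Multiset.map Finset.card (cycleSets σ).val)
    (H : ℕ → ℤ)
    (hH : (PowerSeries.mk fun d => (fixedPtCount k σ d : ℤ)) *
        ∏ j : Fin r, (1 - PowerSeries.X ^ (s j)) = PowerSeries.mk fun m => H m)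
    (m : ℕ) :
    H m = ∑ S : Finset (Fin r), (-1 : ℤ) ^ S.card *
      ∑ h ∈ Finset.range k,
        (∑ I ∈ Iset k h, (-1 : ℤ) ^ (∑ t, I t) *
          ∏ t : Fin (k-1), (Nat.choose (cycleCount σ ((t : ℕ) + 1)) (I t) : ℤ)) *
        (ucoeff r s (((m : ℤ) - ∑ i ∈ S, (s i : ℤ)) * ((k : ℤ) - (h : ℤ)) - (h : ℤ)) : ℤ) := by
  have h1 := congrArg (PowerSeries.coeff m) hH
  rw [PowerSeries.coeff_mk, prod_one_sub_X, Finset.mul_sum, map_sum] at h1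
  rw [← h1, Finset.powerset_univ]
  refine Finset.sum_congr rfl fun S _ => ?_
  rw [mul_left_comm, PowerSeries.coeff_C_mul, PowerSeries.coeff_mul_X_pow', PowerSeries.coeff_mk]
  congr 1
  split_ifs with hS
  · rw [fixed_formula σ s hs _ hk]
    push_cast [Nat.cast_sub hS]
    rfl
  · symm
    refine Finset.sum_eq_zero fun h hh => ?_
    rw [Finset.mem_range] at hh
    rw [ucoeff_neg]
    · simp
    · have h2 : (m:ℤ) < ∑ i ∈ S, (s i : ℤ) := by
        push Not at hS
        exact_mod_cast hS
      have h3 : (h:ℤ) < k := by exact_mod_cast hh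
      have h4 : (0:ℤ) ≤ h := by positivity
      nlinarith
end

section
/- Fix integers 2 ≤ k < n and a permutation σ ∈ S_n with r disjoint cycles, λ_i cycles of length i, and set g = gcd({k} ∪ {i ∈ [n] : λ_i ≥ 1}). Then the number of σ-fixed hypersimplicial (k,n)-DOSPs equals g · Σ_{h=0}^{k−1} ( Σ_{I ∈ 𝓘_h} (−1)^{|I|} · C(λ_1,I_1)⋯C(λ_{k−1},I_{k−1}) ) · (k−h)^{r−1}, where C(a,b) denotes the binomial coefficient. -/
open Finset

/-- Functions [n] → ℤ/kℤ up to additive constants: (k,n)-DOSPs. -/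
def dospSetoid (n k : ℕ) : Setoid (Fin n → ZMod k) where
  r f g := ∃ c : ZMod k, ∀ i, f i = g i + c
  iseqv := by
    refine ⟨fun f => ⟨0, fun i => by simp⟩, ?_, ?_⟩
    · rintro f g ⟨c, hc⟩
      exact ⟨-c, fun i => by rw [hc i]; ring⟩
    · rintro f g h ⟨c, hc⟩ ⟨d, hd⟩
      exact ⟨d + c, fun i => by rw [hc i, hd i]; ring⟩

/-- ℓ(c): the least ℓ with 1 ≤ ℓ ≤ k such that c + ℓ is occupied for f. -/
noncomputable def gapLen {n k : ℕ} (f : Fin n → ZMod k) (c : ZMod k) : ℕ :=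
  sInf {ℓ : ℕ | 1 ≤ ℓ ∧ ℓ ≤ k ∧ ∃ i, f i = c + (ℓ : ZMod k)}

/-- A function represents a hypersimplicial DOSP if every occupied value c has more
    than ℓ(c) preimages. -/
def Hypersimplicial {n k : ℕ} (f : Fin n → ZMod k) : Prop :=
  ∀ c : ZMod k, (∃ i, f i = c) →
    gapLen f c < (Finset.univ.filter fun i => f i = c).card

/-- The number of σ-fixed hypersimplicial (k,n)-DOSPs. -/
noncomputable def hypDospCount (n k : ℕ) (σ : Equiv.Perm (Fin n)) : ℕ :=
  Set.ncard {D : Quotient (dospSetoid n k) |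
    ∃ f : Fin n → ZMod k, Quotient.mk (dospSetoid n k) f = D ∧
      (∃ τ : ZMod k, ∀ i, f (σ⁻¹ i) = f i + τ) ∧ Hypersimplicial f}

/-- Linear weighted hypersimplicial condition, `0` being the terminator. -/
def LHyp {ι : Type*} [Fintype ι] (w : ι → ℕ) (f : ι → ℕ) : Prop :=
  ∀ i, f i ≠ 0 → ∃ v, v < f i ∧ f i < v + (∑ j with f j = f i, w j) ∧ (v = 0 ∨ ∃ j, f j = v)

open Classical in
/-- Linear weighted hypersimplicial functions supported on `S` with values at most `m`. -/
noncomputable def DS {ι : Type*} [Fintype ι] (w : ι → ℕ) (S : Finset ι) (m : ℕ) :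
    Finset (ι → ℕ) :=
  (Fintype.piFinset fun i => if i ∈ S then Finset.Icc 1 m else {0}).filter (LHyp w)

lemma mem_DS {ι : Type*} [Fintype ι] (w : ι → ℕ) (S : Finset ι) (m : ℕ) (f : ι → ℕ) :
    f ∈ DS w S m ↔ (∀ i ∈ S, 1 ≤ f i ∧ f i ≤ m) ∧ (∀ i ∉ S, f i = 0) ∧ LHyp w f := by
  classical
  unfold DS
  rw [Finset.mem_filter, Fintype.mem_piFinset]
  constructor
  · rintro ⟨h, h'⟩
    refine ⟨fun i hi => ?_, fun i hi => ?_, h'⟩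
    · have := h i; rw [if_pos hi] at this; simpa using this
    · have := h i; rw [if_neg hi] at this; simpa using this
  · rintro ⟨h1, h2, h3⟩
    refine ⟨fun i => ?_, h3⟩
    by_cases hi : i ∈ S
    · rw [if_pos hi]; simpa using h1 i hi
    · rw [if_neg hi]; simpa using h2 i hi

open Classical in
lemma top_count {ι : Type*} [Fintype ι] (w : ι → ℕ) (hw : ∀ i, 0 < w i)
    (S A : Finset ι) (hA : A ⊆ S) (hne : A.Nonempty) (m : ℕ) :
    ((DS w S (m+1)).filter fun g => ∀ i, g i = m+1 ↔ i ∈ A).card +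
      (if ∑ i ∈ A, w i ≤ m+1 then (DS w (S \ A) (m + 1 - ∑ i ∈ A, w i)).card else 0) =
      (DS w (S \ A) m).card := by
  set W := ∑ i ∈ A, w i with hW
  have hWpos : 0 < W := Finset.sum_pos (fun i _ => hw i) hne
  let G : (ι → ℕ) → Prop := fun f => ∃ v, v < m+1 ∧ m+1 < v + W ∧ (v = 0 ∨ ∃ j, f j = v)
  rw [← Finset.card_filter_add_card_filter_not (s := DS w (S \ A) m) G]
  congr 1
  · symm
    have key : ∀ f g : ι → ℕ, (∀ i ∈ A, g i = m+1) → (∀ i ∉ A, g i = f i) → (∀ i ∈ A, f i = 0) →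
        (∀ i, f i ≤ m) → (LHyp w g ↔ LHyp w f ∧ G f) := by
      intro f g h1 h2 h3 h4
      have hgm : ∀ i, g i = m+1 ↔ i ∈ A := by
        intro i
        refine ⟨fun h => ?_, h1 i⟩
        by_contra hi
        have := h2 i hi
        have := h4 i
        omega
      have hblock : ∀ i, i ∉ A → f i ≠ 0 → (Finset.univ.filter fun j => g j = g i) =
          (Finset.univ.filter fun j => f j = f i) := by
        intro i hi hfi
        ext j
        simp only [Finset.mem_filter, Finset.mem_univ, true_and]
        rw [h2 i hi]
        by_cases hj : j ∈ A
        · rw [h1 j hj, h3 j hj]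
          have := h4 i
          constructor <;> intro _ <;> omega
        · rw [h2 j hj]
      have hrange : ∀ v, v < m+1 → ((v = 0 ∨ ∃ j, g j = v) ↔ (v = 0 ∨ ∃ j, f j = v)) := by
        intro v hv
        constructor
        · rintro (h | ⟨j, hj⟩)
          · exact Or.inl h
          · by_cases hjA : j ∈ A
            · have := h1 j hjA; omega
            · exact Or.inr ⟨j, by rw [← hj, h2 j hjA]⟩
        · rintro (h | ⟨j, hj⟩)
          · exact Or.inl h
          · by_cases hjA : j ∈ A
            · left; rw [← hj, h3 j hjA]
            · exact Or.inr ⟨j, by rw [← hj, h2 j hjA]⟩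
      have hA' : (Finset.univ.filter fun j => g j = m + 1) = A := by
        ext j; simp [hgm]
      constructor
      · intro hg
        constructor
        · intro i hi
          have hiA : i ∉ A := fun h => hi (h3 i h)
          obtain ⟨v, hv1, hv2, hv3⟩ := hg i (by rw [h2 i hiA]; exact hi)
          rw [hblock i hiA hi, h2 i hiA] at hv2
          rw [h2 i hiA] at hv1
          have := h4 i
          exact ⟨v, hv1, hv2, (hrange v (by omega)).1 hv3⟩
        · obtain ⟨i, hi⟩ := hne
          obtain ⟨v, hv1, hv2, hv3⟩ := hg i (by rw [h1 i hi]; omega)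
          rw [h1 i hi] at hv1 hv2
          rw [hA'] at hv2
          exact ⟨v, hv1, hv2, (hrange v hv1).1 hv3⟩
      · rintro ⟨hf, v, hv1, hv2, hv3⟩ i hi
        by_cases hiA : i ∈ A
        · rw [h1 i hiA, hA']
          exact ⟨v, hv1, hv2, (hrange v hv1).2 hv3⟩
        · have hi' : f i ≠ 0 := by rwa [← h2 i hiA]
          obtain ⟨v, hv1, hv2, hv3⟩ := hf i hi'
          rw [hblock i hiA hi', h2 i hiA]
          have := h4 i
          exact ⟨v, hv1, hv2, (hrange v (by omega)).2 hv3⟩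
    refine Finset.card_bij' (fun f _ i => if i ∈ A then m+1 else f i)
      (fun g _ i => if i ∈ A then 0 else g i) ?_ ?_ ?_ ?_
    · intro f hf
      rw [Finset.mem_filter, mem_DS] at hf
      obtain ⟨⟨h1, h2, h3⟩, h4⟩ := hf
      have h5 : ∀ i, f i ≤ m := by
        intro i
        by_cases hi : i ∈ S \ A
        · exact (h1 i hi).2
        · rw [h2 i hi]; omega
      rw [Finset.mem_filter, mem_DS]
      refine ⟨⟨?_, ?_, ?_⟩, ?_⟩
      · intro i hi
        split_ifs with h
        · omega
        · have := h1 i (by simp [hi, h]); omega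
      · intro i hi
        have : i ∉ A := fun h => hi (hA h)
        simp only [this, if_false]
        exact h2 i (by simp [hi])
      · refine (key f _ (fun i hi => by simp [hi]) (fun i hi => by simp [hi])
          (fun i hi => h2 i (by simp [hi])) h5).2 ⟨h3, h4⟩
      · intro i
        dsimp only
        split_ifs with h
        · simp [h]
        · simp only [h, iff_false]; have := h5 i; omega
    · intro g hg
      rw [Finset.mem_filter, mem_DS] at hg
      obtain ⟨⟨h1, h2, h3⟩, h4⟩ := hg
      have hb : ∀ i, (if i ∈ A then 0 else g i) ≤ m := by
        intro i
        split_ifs with h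
        · omega
        · by_cases hi : i ∈ S
          · have := (h1 i hi).2
            have := (h4 i).not.2 h
            omega
          · rw [h2 i hi]; omega
      have hk := (key (fun i => if i ∈ A then 0 else g i) g (fun i hi => (h4 i).2 hi)
        (fun i hi => by simp [hi]) (fun i hi => by simp [hi]) hb).1 h3
      rw [Finset.mem_filter, mem_DS]
      refine ⟨⟨?_, ?_, hk.1⟩, hk.2⟩
      · intro i hi
        rw [Finset.mem_sdiff] at hi
        refine ⟨?_, hb i⟩
        simp only [hi.2, if_false]
        exact (h1 i hi.1).1
      · intro i hi
        split_ifs with h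
        · rfl
        · exact h2 i (fun h' => hi (by simp [h, h']))
    · intro f hf
      rw [Finset.mem_filter, mem_DS] at hf
      funext i
      dsimp only
      split_ifs with h
      · exact (hf.1.2.1 i (by simp [h])).symm
      · rfl
    · intro g hg
      rw [Finset.mem_filter, mem_DS] at hg
      funext i
      dsimp only
      split_ifs with h
      · exact ((hg.2 i).2 h).symm
      · rfl
  · split_ifs with hWm
    · congr 1
      ext f
      rw [Finset.mem_filter, mem_DS, mem_DS]
      constructor
      · rintro ⟨h1, h2, h3⟩
        refine ⟨⟨fun i hi => ⟨(h1 i hi).1, ?_⟩, h2, h3⟩, ?_⟩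
        · have := (h1 i hi).2; omega
        · rintro ⟨v, hv1, hv2, (hv3 | ⟨j, hj⟩)⟩
          · omega
          · by_cases hjS : j ∈ S \ A
            · have := (h1 j hjS).2; omega
            · have := h2 j hjS; omega
      · rintro ⟨⟨h1, h2, h3⟩, h4⟩
        refine ⟨fun i hi => ⟨(h1 i hi).1, ?_⟩, h2, h3⟩
        by_contra hc
        have := (h1 i hi).2
        exact h4 ⟨f i, by omega, by omega, Or.inr ⟨i, rfl⟩⟩
    · symm
      rw [Finset.card_eq_zero, Finset.filter_eq_empty_iff]
      intro f _ h
      exact h ⟨0, by omega, by omega, Or.inl rfl⟩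

open Classical in
lemma top_empty {ι : Type*} [Fintype ι] (w : ι → ℕ) (S : Finset ι) (m : ℕ) :
    ((DS w S (m+1)).filter fun g => ∀ i, g i = m+1 ↔ i ∈ (∅ : Finset ι)) = DS w S m := by
  ext f
  rw [Finset.mem_filter, mem_DS, mem_DS]
  constructor
  · rintro ⟨⟨h1, h2, h3⟩, h4⟩
    refine ⟨fun i hi => ⟨(h1 i hi).1, ?_⟩, h2, h3⟩
    have := (h1 i hi).2
    have := h4 i
    simp at this
    omega
  · rintro ⟨h1, h2, h3⟩
    refine ⟨⟨fun i hi => ⟨(h1 i hi).1, (h1 i hi).2.trans (by omega)⟩, h2, h3⟩, fun i => ?_⟩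
    simp only [Finset.notMem_empty, iff_false]
    by_cases hi : i ∈ S
    · have := (h1 i hi).2; omega
    · have := h2 i hi; omega

open Classical in
/-- The top-block count as an integer, for arbitrary nonempty `A ⊆ S`. -/
lemma DS_rec {ι : Type*} [Fintype ι] (w : ι → ℕ) (hw : ∀ i, 0 < w i) (S : Finset ι) (m : ℕ) :
    (∑ A ∈ S.powerset, if ∑ i ∈ A, w i ≤ m+1 then
      ((DS w (S \ A) (m + 1 - ∑ i ∈ A, w i)).card : ℤ) else 0) =
    ∑ A ∈ S.powerset, ((DS w (S \ A) m).card : ℤ) := by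
  have h0 : ((DS w S (m+1)).card : ℤ) = ∑ A ∈ S.powerset,
      (((DS w S (m+1)).filter fun g => ∀ i, g i = m+1 ↔ i ∈ A).card : ℤ) := by
    rw [← Nat.cast_sum]
    congr 1
    rw [Finset.card_eq_sum_card_fiberwise (f := fun g => Finset.univ.filter fun i => g i = m+1)
      (t := S.powerset)]
    · refine Finset.sum_congr rfl fun A _ => ?_
      congr 1
      refine Finset.filter_congr fun g _ => ?_
      simp [Finset.ext_iff]
    · intro g hg
      have hg := (mem_DS _ _ _ _).1 (Finset.mem_coe.1 hg)
      simp only [Finset.coe_powerset, Set.mem_preimage, Set.mem_powerset_iff, Finset.coe_subset]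
      intro i hi
      by_contra h
      have := hg.2.1 i h
      simp at hi
      omega
  have hmem : ∅ ∈ S.powerset := Finset.empty_mem_powerset S
  rw [← Finset.add_sum_erase _ _ hmem] at h0 ⊢
  rw [← Finset.add_sum_erase (a := ∅) _ _ hmem, top_empty] at *
  simp only [Finset.sum_empty, Nat.zero_le, if_true, Finset.sdiff_empty, Nat.sub_zero]
  rw [h0, add_assoc, ← Finset.sum_add_distrib]
  congr 1
  refine Finset.sum_congr rfl fun A hA => ?_
  rw [Finset.mem_erase, Finset.mem_powerset] at hA
  rw [← top_count w hw S A hA.2 (Finset.nonempty_iff_ne_empty.2 hA.1) m]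
  push_cast
  rfl

open Polynomial in
/-- Coefficient of `X ^ M` in the formal sum of `X ^ m * F m`. -/
noncomputable def Sg (F : ℕ → ℤ[X]) (M : ℕ) : ℤ := ∑ m ∈ Finset.range (M+1), (F m).coeff (M - m)

open Polynomial in
lemma Sg_shift (F : ℕ → ℤ[X]) (a M : ℕ) :
    Sg (fun m => X ^ a * F m) M = if a ≤ M then Sg F (M - a) else 0 := by
  unfold Sg
  simp only [coeff_X_pow_mul']
  split_ifs with h
  · rw [← Finset.sum_filter]
    have : (Finset.range (M+1)).filter (fun m => a ≤ M - m) = Finset.range (M - a + 1) := by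
      ext m; simp; omega
    rw [this]
    refine Finset.sum_congr rfl fun m _ => ?_
    congr 1; omega
  · refine Finset.sum_eq_zero fun m _ => ?_
    rw [if_neg]; omega

open Polynomial in
lemma Sg_succ (F : ℕ → ℤ[X]) (M : ℕ) :
    Sg F (M+1) = Sg (fun m => F (m+1)) M + (F 0).coeff (M+1) := by
  unfold Sg
  rw [Finset.sum_range_succ']
  simp

open Polynomial in
lemma Sg_sum {α : Type*} (s : Finset α) (F : α → ℕ → ℤ[X]) (M : ℕ) :
    ∑ a ∈ s, Sg (F a) M = Sg (fun m => ∑ a ∈ s, F a m) M := by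
  unfold Sg
  rw [Finset.sum_comm]
  simp [finsetSum_coeff]

open Polynomial in
/-- Product describing linear functions. -/
noncomputable def PP {ι : Type*} (w : ι → ℕ) (S : Finset ι) (j : ℕ) : ℤ[X] :=
  ∏ i ∈ S, (C (j : ℤ) - C ((j : ℤ)+1) * X ^ w i)

open Polynomial in
/-- Product describing the convolved count. -/
noncomputable def QQ {ι : Type*} (w : ι → ℕ) (S : Finset ι) (j : ℕ) : ℤ[X] :=
  ∏ i ∈ S, (C (j : ℤ) * (1 - X ^ w i))

open Classical Polynomial in
lemma PP_E {ι : Type*} (w : ι → ℕ) (S : Finset ι) (j : ℕ) :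
    ∑ A ∈ S.powerset, PP w (S \ A) j = QQ w S (j+1) := by
  have := Finset.prod_add (fun _ => (1 : ℤ[X])) (fun i => C (j : ℤ) - C ((j : ℤ)+1) * X ^ w i) S
  simp only [Finset.prod_const_one, one_mul] at this
  unfold PP QQ
  rw [← this]
  refine Finset.prod_congr rfl fun i _ => ?_
  push_cast
  simp only [map_add, map_one]
  ring

open Classical Polynomial in
lemma PP_Y {ι : Type*} (w : ι → ℕ) (S : Finset ι) (j : ℕ) :
    ∑ A ∈ S.powerset, X ^ (∑ i ∈ A, w i) * PP w (S \ A) j = QQ w S j := by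
  have := Finset.prod_add (fun i => (X : ℤ[X]) ^ w i)
    (fun i => C (j : ℤ) - C ((j : ℤ)+1) * X ^ w i) S
  simp only [Finset.prod_pow_eq_pow_sum] at this
  unfold PP QQ
  rw [← this]
  refine Finset.prod_congr rfl fun i _ => ?_
  simp only [map_add, map_one]
  ring

open Polynomial in
lemma QQ_zero_coeff {ι : Type*} (w : ι → ℕ) (S : Finset ι) (m : ℕ) :
    (QQ w S 0).coeff (m+1) = 0 := by
  unfold QQ
  rcases S.eq_empty_or_nonempty with rfl | ⟨i, hi⟩
  · simp [coeff_one]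
  · rw [Finset.prod_eq_zero hi (by simp)]; simp

open Classical Polynomial in
lemma Sg_E {ι : Type*} (w : ι → ℕ) (S : Finset ι) (m : ℕ) :
    ∑ A ∈ S.powerset, Sg (PP w (S \ A)) m = Sg (QQ w S) (m+1) := by
  rw [Sg_succ, QQ_zero_coeff, add_zero, Sg_sum]
  simp only [PP_E]

open Classical Polynomial in
lemma Sg_Y {ι : Type*} (w : ι → ℕ) (S : Finset ι) (a m : ℕ) :
    (∑ A ∈ S.powerset, if a + ∑ i ∈ A, w i ≤ m then
      Sg (PP w (S \ A)) (m - (a + ∑ i ∈ A, w i)) else 0) =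
      Sg (fun j => X ^ a * QQ w S j) m := by
  simp only [← Sg_shift]
  rw [Sg_sum]
  congr 1
  funext j
  simp only [pow_add, mul_assoc]
  rw [← Finset.mul_sum, PP_Y]

open Classical Polynomial in
lemma DS_card {ι : Type*} [Fintype ι] (w : ι → ℕ) (hw : ∀ i, 0 < w i) (m : ℕ) :
    ∀ S : Finset ι, ((DS w S m).card : ℤ) = Sg (PP w S) m := by
  induction m using Nat.strong_induction_on with
  | _ m ih =>
    intro S
    rcases m with _ | m
    · rcases S.eq_empty_or_nonempty with rfl | ⟨i, hi⟩
      · have : DS w ∅ 0 = {fun _ => 0} := by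
          ext f
          rw [mem_DS]
          simp only [Finset.mem_singleton]
          constructor
          · rintro ⟨_, h, _⟩
            funext i; exact h i (by simp)
          · rintro rfl
            exact ⟨by simp, by simp, fun i hi => absurd rfl hi⟩
        rw [this]
        simp [Sg, PP]
      · have : DS w S 0 = ∅ := by
          rw [Finset.eq_empty_iff_forall_notMem]
          intro f hf
          have := ((mem_DS _ _ _ _).1 hf).1 i hi
          omega
        rw [this]
        simp only [Sg, PP, Finset.card_empty, Nat.cast_zero, zero_add, Finset.sum_range_one,
          Nat.sub_zero, coeff_zero_eq_eval_zero, eval_prod]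
        rw [Finset.prod_eq_zero hi]
        simp [(hw i).ne']
    · have h1 := DS_rec w hw S m
      have h2 : ∑ A ∈ S.powerset, ((DS w (S \ A) m).card : ℤ) = Sg (QQ w S) (m+1) := by
        rw [← Sg_E]
        exact Finset.sum_congr rfl fun A _ => ih m (by omega) _
      have h3 := Sg_Y w S 0 (m+1)
      simp only [pow_zero, one_mul, zero_add] at h3
      rw [h2] at h1
      have h4 := h1.trans h3.symm
      have hmem : ∅ ∈ S.powerset := Finset.empty_mem_powerset S
      rw [← Finset.add_sum_erase _ _ hmem, ← Finset.add_sum_erase _ _ hmem] at h4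
      simp only [Finset.sum_empty, Nat.zero_le, if_true, Finset.sdiff_empty, Nat.sub_zero] at h4
      have h5 : ∀ A ∈ S.powerset.erase ∅, (if ∑ i ∈ A, w i ≤ m+1 then
          ((DS w (S \ A) (m + 1 - ∑ i ∈ A, w i)).card : ℤ) else 0) =
          (if ∑ i ∈ A, w i ≤ m+1 then Sg (PP w (S \ A)) (m + 1 - ∑ i ∈ A, w i) else 0) := by
        intro A hA
        split_ifs with h
        · rw [Finset.mem_erase, Finset.mem_powerset] at hA
          have : 0 < ∑ i ∈ A, w i :=
            Finset.sum_pos (fun i _ => hw i) (Finset.nonempty_iff_ne_empty.2 hA.1)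
          exact ih _ (by omega) _
        · rfl
      rw [Finset.sum_congr rfl h5] at h4
      linarith

open Classical Polynomial in
lemma DS_top_card {ι : Type*} [Fintype ι] (w : ι → ℕ) (hw : ∀ i, 0 < w i) (z : ι) (m : ℕ) :
    (((DS w Finset.univ (m+1)).filter fun g => g z = m+1).card : ℤ) =
      ∑ T : Finset ι, if ∑ i ∈ T, w i ≤ m+1 then
        (-1 : ℤ) ^ T.card * ((m + 1 - ∑ i ∈ T, w i : ℕ) : ℤ) ^ (Fintype.card ι - 1) else 0 := by
  set S : Finset ι := Finset.univ.erase z with hS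
  have hz : z ∉ S := by simp [hS]
  have h0 : (((DS w Finset.univ (m+1)).filter fun g => g z = m+1).card : ℤ) =
      ∑ A ∈ S.powerset, (((DS w Finset.univ (m+1)).filter fun g =>
        ∀ i, g i = m+1 ↔ i ∈ insert z A).card : ℤ) := by
    rw [← Nat.cast_sum]
    congr 1
    rw [Finset.card_eq_sum_card_fiberwise
      (f := fun g => (Finset.univ.filter fun i => g i = m+1).erase z) (t := S.powerset)]
    · refine Finset.sum_congr rfl fun A hA => ?_
      have hzA : z ∉ A := fun h => hz (Finset.mem_powerset.1 hA h)
      congr 1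
      rw [Finset.filter_filter]
      refine Finset.filter_congr fun g _ => ?_
      simp only [Finset.ext_iff, Finset.mem_erase, Finset.mem_filter, Finset.mem_univ, true_and,
        Finset.mem_insert]
      constructor
      · rintro ⟨h1, h2⟩ i
        by_cases hi : i = z
        · subst hi; simp [h1]
        · rw [← h2 i]; simp [hi]
      · intro h
        refine ⟨(h z).2 (Or.inl rfl), fun i => ?_⟩
        rw [h i]
        by_cases hi : i = z
        · subst hi; simp [hzA]
        · simp [hi]
    · intro g _
      simp only [Finset.coe_powerset, Set.mem_preimage, Set.mem_powerset_iff, Finset.coe_subset]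
      exact Finset.erase_subset_erase _ (Finset.subset_univ _)
  have hsd : ∀ A ∈ S.powerset, Finset.univ \ insert z A = S \ A := by
    intro A _
    ext i; simp [hS]
  have hsum : ∀ A ∈ S.powerset, ∑ i ∈ insert z A, w i = w z + ∑ i ∈ A, w i := by
    intro A hA
    exact Finset.sum_insert fun h => hz (Finset.mem_powerset.1 hA h)
  have h1 : (((DS w Finset.univ (m+1)).filter fun g => g z = m+1).card : ℤ) =
      Sg (QQ w S) (m+1) - Sg (fun j => X ^ w z * QQ w S j) (m+1) := by
    rw [← Sg_E, ← Sg_Y, h0, ← Finset.sum_sub_distrib]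
    refine Finset.sum_congr rfl fun A hA => ?_
    have := top_count w hw Finset.univ (insert z A) (Finset.subset_univ _)
      (Finset.insert_nonempty _ _) m
    rw [hsd A hA, hsum A hA] at this
    rw [← DS_card w hw, ← DS_card w hw, ← this]
    push_cast
    split_ifs <;> simp
  have hcard : S.card = Fintype.card ι - 1 := by
    rw [hS, Finset.card_erase_of_mem (Finset.mem_univ z), Finset.card_univ]
  have h2 : ∀ j : ℕ, QQ w S j - X ^ w z * QQ w S j =
      ∑ T : Finset ι, X ^ (∑ i ∈ T, w i) * C ((-1 : ℤ) ^ T.card * (j : ℤ) ^ (Fintype.card ι - 1)) := by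
    intro j
    have e1 : QQ w S j - X ^ w z * QQ w S j =
        C ((j : ℤ) ^ (Fintype.card ι - 1)) * ∏ i : ι, (1 - X ^ w i) := by
      rw [← Finset.mul_prod_erase _ _ (Finset.mem_univ z), ← hS]
      unfold QQ
      rw [Finset.prod_mul_distrib, Finset.prod_const, hcard, C_pow]
      ring
    have e2 : ∏ i : ι, (1 - (X : ℤ[X]) ^ w i) =
        ∑ T : Finset ι, (-1) ^ T.card * X ^ (∑ i ∈ T, w i) := by
      have := Finset.prod_add (fun i => -(X : ℤ[X]) ^ w i) (fun _ => 1) Finset.univ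
      simp only [Finset.prod_const_one, mul_one, Finset.powerset_univ] at this
      rw [show ∏ i : ι, (1 - (X : ℤ[X]) ^ w i) = ∏ i : ι, (-(X : ℤ[X]) ^ w i + 1) from
        Finset.prod_congr rfl fun i _ => by ring, this]
      refine Finset.sum_congr rfl fun T _ => ?_
      rw [Finset.prod_neg, Finset.prod_pow_eq_pow_sum]
    rw [e1, e2, Finset.mul_sum]
    refine Finset.sum_congr rfl fun T _ => ?_
    simp only [C_mul, C_pow, C_neg, C_1]
    ring
  have h3 : Sg (QQ w S) (m+1) - Sg (fun j => X ^ w z * QQ w S j) (m+1) =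
      Sg (fun j => QQ w S j - X ^ w z * QQ w S j) (m+1) := by
    unfold Sg
    rw [← Finset.sum_sub_distrib]
    simp
  rw [h1, h3]
  simp only [h2]
  rw [← Sg_sum Finset.univ (fun (T : Finset ι) (j : ℕ) => (X : ℤ[X]) ^ (∑ i ∈ T, w i) * C ((-1 : ℤ) ^ T.card * (j : ℤ) ^ (Fintype.card ι - 1)))]
  refine Finset.sum_congr rfl fun T _ => ?_
  rw [Sg_shift (fun j : ℕ => C ((-1 : ℤ) ^ T.card * (j : ℤ) ^ (Fintype.card ι - 1)))]
  split_ifs with h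
  · unfold Sg
    rw [Finset.sum_range_succ, Finset.sum_eq_zero, zero_add]
    · simp only [Nat.sub_self, coeff_C_zero]
    · intro x hx
      rw [Finset.mem_range] at hx
      rw [coeff_C, if_neg (by omega)]
  · rfl

/-- Weighted circular hypersimplicial condition. -/
def WHyp {ι : Type*} [Fintype ι] {K : ℕ} (w : ι → ℕ) (f : ι → ZMod K) : Prop :=
  ∀ a, ∃ l : ℕ, 1 ≤ l ∧ l < (∑ j with f j = f a, w j) ∧ ∃ b, f b = f a + (l : ZMod K)

lemma cast_inj_Icc {K a b : ℕ} (ha : 1 ≤ a) (ha' : a ≤ K) (hb : 1 ≤ b) (hb' : b ≤ K)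
    (h : (a : ZMod K) = b) : a = b := by
  rw [ZMod.natCast_eq_natCast_iff] at h
  wlog hab : a ≤ b generalizing a b
  · exact (this hb hb' ha ha' h.symm (by omega)).symm
  have h1 : K ∣ b - a := (Nat.modEq_iff_dvd' hab).1 h
  by_contra hne
  have := Nat.le_of_dvd (by omega) h1
  omega

open Classical in
lemma circ_card {ι : Type*} [Fintype ι] [DecidableEq ι] {K : ℕ} [NeZero K] (w : ι → ℕ) (z : ι) :
    ((DS w Finset.univ K).filter fun g => g z = K).card =
      (Finset.univ.filter fun f : ι → ZMod K => f z = 0 ∧ WHyp w f).card := by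
  have key : ∀ g : ι → ℕ, (∀ i, 1 ≤ g i ∧ g i ≤ K) → g z = K →
      (WHyp w (fun i => -(g i : ZMod K)) ↔ LHyp w g) := by
    intro g hg hz
    have hinj : ∀ i j, -(g i : ZMod K) = -(g j : ZMod K) ↔ g i = g j := by
      intro i j
      rw [neg_inj]
      exact ⟨cast_inj_Icc (hg i).1 (hg i).2 (hg j).1 (hg j).2, fun h => by rw [h]⟩
    unfold WHyp LHyp
    simp only [hinj]
    constructor
    · intro h a _
      obtain ⟨l, hl1, hl2, b, hb⟩ := h a
      by_cases hla : g a ≤ l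
      · exact ⟨0, (hg a).1, by omega, Or.inl rfl⟩
      · refine ⟨g a - l, by omega, by omega, Or.inr ⟨b, ?_⟩⟩
        refine cast_inj_Icc (hg b).1 (hg b).2 (by omega) ((Nat.sub_le _ _).trans (hg a).2) ?_
        rw [Nat.cast_sub (by omega)]
        linear_combination -hb
    · intro h a
      obtain ⟨v, hv1, hv2, hv3⟩ := h a (by have := (hg a).1; omega)
      refine ⟨g a - v, by omega, by omega, ?_⟩
      rw [Nat.cast_sub hv1.le]
      rcases hv3 with rfl | ⟨j, hj⟩
      · exact ⟨z, by simp [hz]⟩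
      · exact ⟨j, by rw [hj]; ring⟩
  refine Finset.card_bij (fun g _ i => -(g i : ZMod K)) ?_ ?_ ?_
  · intro g hg
    rw [Finset.mem_filter, mem_DS] at hg
    obtain ⟨⟨h1, h2, h3⟩, h4⟩ := hg
    rw [Finset.mem_filter]
    exact ⟨Finset.mem_univ _, by simp [h4], (key g (fun i => h1 i (Finset.mem_univ i)) h4).2 h3⟩
  · intro g hg g' hg' h
    rw [Finset.mem_filter, mem_DS] at hg hg'
    funext i
    have h5 := congrFun h i
    have h6 := hg.1.1 i (Finset.mem_univ i)
    have h7 := hg'.1.1 i (Finset.mem_univ i)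
    exact cast_inj_Icc h6.1 h6.2 h7.1 h7.2 (neg_inj.1 h5)
  · intro f hf
    rw [Finset.mem_filter] at hf
    obtain ⟨_, h1, h2⟩ := hf
    have hK : 0 < K := Nat.pos_of_ne_zero (NeZero.ne K)
    let g : ι → ℕ := fun i => if f i = 0 then K else (-f i).val
    have hg : ∀ i, 1 ≤ g i ∧ g i ≤ K := by
      intro i
      dsimp only [g]
      split_ifs with h
      · omega
      · refine ⟨Nat.one_le_iff_ne_zero.2 fun h' => h ?_, (ZMod.val_lt _).le⟩
        rw [ZMod.val_eq_zero] at h'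
        exact neg_eq_zero.1 h'
    have hgf : (fun i => -(g i : ZMod K)) = f := by
      funext i
      dsimp only [g]
      split_ifs with h
      · simp [h]
      · simp
    have hgz : g z = K := by simp [g, h1]
    refine ⟨g, ?_, hgf⟩
    rw [Finset.mem_filter, mem_DS]
    refine ⟨⟨fun i _ => hg i, fun i hi => absurd (Finset.mem_univ i) hi, ?_⟩, hgz⟩
    rw [← key g hg hgz, hgf]
    exact h2

lemma Hyp_iff {n k : ℕ} (hk : 0 < k) (f : Fin n → ZMod k) :
    Hypersimplicial f ↔ ∀ i, ∃ l : ℕ, 1 ≤ l ∧ l < (Finset.univ.filter fun j => f j = f i).card ∧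
      ∃ j, f j = f i + (l : ZMod k) := by
  unfold Hypersimplicial
  constructor
  · intro h i
    have h1 := h (f i) ⟨i, rfl⟩
    have hne : {l : ℕ | 1 ≤ l ∧ l ≤ k ∧ ∃ j, f j = f i + (l : ZMod k)}.Nonempty :=
      ⟨k, hk, le_rfl, i, by simp⟩
    have h2 := Nat.sInf_mem hne
    exact ⟨_, h2.1, h1, h2.2.2⟩
  · rintro h c ⟨i, rfl⟩
    obtain ⟨l, h1, h2, h3⟩ := h i
    unfold gapLen
    by_cases hl : l ≤ k
    · exact (Nat.sInf_le (show l ∈ {l : ℕ | 1 ≤ l ∧ l ≤ k ∧ ∃ j, f j = f i + (l : ZMod k)} from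
        ⟨h1, hl, h3⟩)).trans_lt h2
    · refine (Nat.sInf_le (show k ∈ {l : ℕ | 1 ≤ l ∧ l ≤ k ∧ ∃ j, f j = f i + (l : ZMod k)} from
        ⟨hk, le_rfl, i, by simp⟩)).trans_lt ?_
      omega

/-- Facts on reduction modulo `k / d`, `d` the order of `τ`. -/
lemma ker_facts {k K : ℕ} [NeZero k] (τ : ZMod k) (hK : addOrderOf τ * K = k) (hKk : K ∣ k) :
    (ZMod.castHom hKk (ZMod K)) τ = 0 ∧
    ∀ a b : ZMod k, ZMod.castHom hKk (ZMod K) a = ZMod.castHom hKk (ZMod K) b →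
      ∃ j : ℤ, b = a + j • τ := by
  set π := ZMod.castHom hKk (ZMod K) with hπ
  have hk0 : 0 < k := Nat.pos_of_ne_zero (NeZero.ne k)
  have hK0 : NeZero K := ⟨fun h => by rw [h] at hK; omega⟩
  have h1 : π τ = 0 := by
    have h := addOrderOf_nsmul_eq_zero τ
    have hd : 0 < addOrderOf τ := Nat.pos_of_ne_zero fun h => by rw [h] at hK; omega
    rw [← ZMod.natCast_zmod_val τ, nsmul_eq_mul, ← Nat.cast_mul, ZMod.natCast_eq_zero_iff] at h
    simp only [ZMod.natCast_zmod_val] at h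
    have h' : addOrderOf τ * K ∣ addOrderOf τ * τ.val := by rw [hK]; exact h
    have h2 := Nat.dvd_of_mul_dvd_mul_left hd h'
    rw [← ZMod.natCast_zmod_val τ, map_natCast, ZMod.natCast_eq_zero_iff]
    exact h2
  refine ⟨h1, ?_⟩
  have hsurj : Function.Surjective π := ZMod.castHom_surjective hKk
  have hker : AddSubgroup.zmultiples τ = π.toAddMonoidHom.ker := by
    apply AddSubgroup.eq_of_le_of_card_ge
    · rw [AddSubgroup.zmultiples_le]
      exact h1
    · have hc := π.toAddMonoidHom.ker.card_mul_index
      rw [AddSubgroup.index_ker, AddMonoidHom.range_eq_top.2 hsurj] at hc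
      rw [Nat.card_zmultiples]
      have e : Nat.card (⊤ : AddSubgroup (ZMod K)) = K := by
        rw [AddSubgroup.card_top, Nat.card_zmod]
      rw [e, Nat.card_zmod] at hc
      exact (Nat.eq_of_mul_eq_mul_right (Nat.pos_of_ne_zero hK0.ne) (hc.trans hK.symm)).le
  intro a b hab
  have : b - a ∈ AddSubgroup.zmultiples τ := by
    rw [hker]
    change π (b - a) = 0
    rw [map_sub, hab, sub_self]
  obtain ⟨j, hj⟩ := AddSubgroup.mem_zmultiples_iff.1 this
  exact ⟨j, by rw [hj]; ring⟩

lemma fiber_card {k K : ℕ} [NeZero k] [NeZero K] (τ : ZMod k) (hK : addOrderOf τ * K = k)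
    (hKk : K ∣ k) (c : ZMod K) :
    (Finset.univ.filter fun a : ZMod k => ZMod.castHom hKk (ZMod K) a = c).card = addOrderOf τ := by
  obtain ⟨a0, ha0⟩ := ZMod.castHom_surjective hKk c
  obtain ⟨h1, h2⟩ := ker_facts τ hK hKk
  rw [← Nat.card_zmultiples, Nat.card_eq_fintype_card, ← Finset.card_univ]
  symm
  refine Finset.card_bij (fun t _ => a0 + (t : ZMod k)) ?_ ?_ ?_
  · rintro ⟨t, ht⟩ _
    obtain ⟨j, rfl⟩ := AddSubgroup.mem_zmultiples_iff.1 ht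
    simp only [Finset.mem_filter, Finset.mem_univ, true_and, map_add, map_zsmul, h1, smul_zero,
      add_zero, ha0]
  · intro s _ t _ h
    exact Subtype.ext (add_left_cancel h)
  · intro b hb
    obtain ⟨j, hj⟩ := h2 a0 b (by rw [ha0]; exact (Finset.mem_filter.1 hb).2.symm)
    exact ⟨⟨j • τ, AddSubgroup.mem_zmultiples_iff.2 ⟨j, rfl⟩⟩, Finset.mem_univ _, hj.symm⟩

open Classical in
lemma lift_card {ι : Type*} [Fintype ι] [DecidableEq ι] {k K : ℕ} [NeZero k] [NeZero K] (τ : ZMod k)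
    (hK : addOrderOf τ * K = k) (hKk : K ∣ k) (z : ι) (P : (ι → ZMod K) → Prop) :
    (Finset.univ.filter fun ψ : ι → ZMod k => ψ z = 0 ∧
      P (fun i => ZMod.castHom hKk (ZMod K) (ψ i))).card =
    addOrderOf τ ^ (Fintype.card ι - 1) *
      (Finset.univ.filter fun ψ : ι → ZMod K => ψ z = 0 ∧ P ψ).card := by
  set π := ZMod.castHom hKk (ZMod K) with hπ
  rw [Finset.card_eq_sum_card_fiberwise (f := fun ψ : ι → ZMod k => fun i => π (ψ i))
    (t := Finset.univ.filter fun ψ : ι → ZMod K => ψ z = 0 ∧ P ψ)]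
  · rw [mul_comm, ← smul_eq_mul, ← Finset.sum_const]
    refine Finset.sum_congr rfl fun φ hφ => ?_
    rw [Finset.mem_filter] at hφ
    have : (Finset.univ.filter fun ψ : ι → ZMod k => ψ z = 0 ∧ P (fun i => π (ψ i))).filter
        (fun ψ => (fun i => π (ψ i)) = φ) =
        Fintype.piFinset fun i => if i = z then {0} else
          Finset.univ.filter fun a : ZMod k => π a = φ i := by
      ext ψ
      rw [Finset.mem_filter, Finset.mem_filter, Fintype.mem_piFinset]
      constructor
      · rintro ⟨⟨_, h1, h2⟩, h3⟩ i
        split_ifs with h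
        · simp [h, h1]
        · simp [← h3]
      · intro h
        have hz : ψ z = 0 := by simpa using h z
        have h3 : (fun i => π (ψ i)) = φ := by
          funext i
          by_cases hi : i = z
          · rw [hi, hz, hφ.2.1, map_zero]
          · have := h i
            rw [if_neg hi] at this
            simpa using this
        exact ⟨⟨Finset.mem_univ _, hz, by rw [h3]; exact hφ.2.2⟩, h3⟩
    rw [this, Fintype.card_piFinset, ← Finset.mul_prod_erase _ _ (Finset.mem_univ z)]
    rw [if_pos rfl, Finset.card_singleton, one_mul, Finset.prod_congr rfl
      (g := fun _ => addOrderOf τ)]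
    · rw [Finset.prod_const, Finset.card_erase_of_mem (Finset.mem_univ z), Finset.card_univ]
    · intro i hi
      rw [if_neg (Finset.ne_of_mem_erase hi)]
      exact fiber_card τ hK hKk (φ i)
  · intro ψ hψ
    have hψ := Finset.mem_filter.1 (Finset.mem_coe.1 hψ)
    rw [Finset.mem_coe, Finset.mem_filter]
    exact ⟨Finset.mem_univ _, by simp only [hψ.2.1, map_zero], hψ.2.2⟩

/-- The type of cycles. -/
abbrev Cyc {n : ℕ} (σ : Equiv.Perm (Fin n)) := {C : Finset (Fin n) // C ∈ cycleSets σ}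

/-- The cycle of a point. -/
def cyc {n : ℕ} (σ : Equiv.Perm (Fin n)) (x : Fin n) : Cyc σ :=
  ⟨Finset.univ.filter fun y => σ.SameCycle x y, Finset.mem_image_of_mem _ (Finset.mem_univ x)⟩

lemma mem_cyc {n : ℕ} (σ : Equiv.Perm (Fin n)) (x y : Fin n) :
    y ∈ (cyc σ x).1 ↔ σ.SameCycle x y := by simp [cyc]

lemma cyc_eq_iff {n : ℕ} (σ : Equiv.Perm (Fin n)) (x y : Fin n) :
    cyc σ x = cyc σ y ↔ σ.SameCycle x y := by
  constructor
  · intro h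
    rw [← mem_cyc, h, mem_cyc]
  · intro h
    apply Subtype.ext
    ext t
    rw [mem_cyc, mem_cyc]
    exact ⟨fun h' => h.symm.trans h', fun h' => h.trans h'⟩

lemma exists_cyc {n : ℕ} (σ : Equiv.Perm (Fin n)) (C : Cyc σ) : ∃ x, cyc σ x = C := by
  obtain ⟨C, hC⟩ := C
  obtain ⟨x, _, hx⟩ := Finset.mem_image.1 hC
  exact ⟨x, Subtype.ext hx⟩

lemma mem_Cyc_iff {n : ℕ} (σ : Equiv.Perm (Fin n)) (C : Cyc σ) (y : Fin n) :
    y ∈ C.1 ↔ cyc σ y = C := by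
  obtain ⟨x, rfl⟩ := exists_cyc σ C
  rw [mem_cyc, cyc_eq_iff]
  exact ⟨fun h => h.symm, fun h => h.symm⟩

lemma cyc_isCycleOn {n : ℕ} (σ : Equiv.Perm (Fin n)) (C : Cyc σ) :
    σ.IsCycleOn (C.1 : Set (Fin n)) := by
  constructor
  · apply σ.bijOn
    intro x
    rw [Finset.mem_coe, Finset.mem_coe, mem_Cyc_iff, mem_Cyc_iff]
    rw [show cyc σ (σ x) = cyc σ x from (cyc_eq_iff _ _ _).2 (by simp [Equiv.Perm.SameCycle.refl])]
  · intro x hx y hy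
    rw [Finset.mem_coe, mem_Cyc_iff] at hx hy
    rw [← cyc_eq_iff, hx, hy]

lemma cyc_zpow {n : ℕ} (σ : Equiv.Perm (Fin n)) (x : Fin n) (j : ℤ) :
    cyc σ ((σ ^ j) x) = cyc σ x := (cyc_eq_iff _ _ _).2 (by simp [Equiv.Perm.SameCycle.refl])

lemma zpow_fix {n k : ℕ} (σ : Equiv.Perm (Fin n)) (τ : ZMod k)
    (hd : ∀ C : Cyc σ, addOrderOf τ ∣ C.1.card) (x : Fin n) (i j : ℤ)
    (h : (σ ^ i) x = (σ ^ j) x) : i • τ = j • τ := by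
  have h1 : (σ ^ (i - j)) x = x := by
    rw [sub_eq_neg_add, zpow_add, Equiv.Perm.mul_apply, h, ← Equiv.Perm.mul_apply, ← zpow_add]
    simp
  rw [(cyc_isCycleOn σ (cyc σ x)).zpow_apply_eq ((mem_cyc σ x x).2 (Equiv.Perm.SameCycle.refl _ _))]
    at h1
  have h2 : ((addOrderOf τ : ℕ) : ℤ) ∣ i - j :=
    (Int.natCast_dvd_natCast.2 (hd (cyc σ x))).trans h1
  rw [← sub_eq_zero, ← sub_smul]
  exact addOrderOf_dvd_iff_zsmul_eq_zero.1 h2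

/-- A twisted function that is zero modulo `K`. -/
lemma exists_twist {n k : ℕ} (σ : Equiv.Perm (Fin n)) (τ : ZMod k)
    (hd : ∀ C : Cyc σ, addOrderOf τ ∣ C.1.card) (x0 : Fin n) :
    ∃ u : Fin n → ZMod k, (∀ x, u (σ⁻¹ x) = u x + τ) ∧ u x0 = 0 ∧ ∀ x, ∃ j : ℤ, u x = j • τ := by
  classical
  let rep : Cyc σ → Fin n := fun C => if C = cyc σ x0 then x0 else (exists_cyc σ C).choose
  have hrep : ∀ C, cyc σ (rep C) = C := by
    intro C
    dsimp only [rep]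
    split_ifs with h
    · exact h.symm
    · exact (exists_cyc σ C).choose_spec
  have hex : ∀ x, ∃ j : ℤ, (σ ^ j) (rep (cyc σ x)) = x := by
    intro x
    exact (cyc_eq_iff _ _ _).1 (hrep (cyc σ x))
  choose e he using hex
  refine ⟨fun x => (-e x) • τ, ?_, ?_, fun x => ⟨_, rfl⟩⟩
  · intro x
    have h1 : cyc σ (σ⁻¹ x) = cyc σ x := (cyc_eq_iff _ _ _).2 (by simp [Equiv.Perm.SameCycle.refl])
    have h2 := he (σ⁻¹ x)
    rw [h1] at h2
    have h3 : (σ ^ (e x - 1)) (rep (cyc σ x)) = σ⁻¹ x := by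
      rw [sub_eq_neg_add, zpow_add, Equiv.Perm.mul_apply, he x]; simp
    have h4 := zpow_fix σ τ hd _ _ _ (h2.trans h3.symm)
    simp only [neg_smul, h4, sub_smul, one_smul]
    ring
  · have h1 := he x0
    have h2 : rep (cyc σ x0) = x0 := by simp [rep]
    rw [h2] at h1
    have := zpow_fix σ τ hd x0 (e x0) 0 (by simpa using h1)
    simp only [neg_smul, this, zero_smul, neg_zero]

lemma twist_zpow {n k : ℕ} (σ : Equiv.Perm (Fin n)) (τ : ZMod k) (f : Fin n → ZMod k)
    (hf : ∀ x, f (σ⁻¹ x) = f x + τ) (j : ℤ) (x : Fin n) : f ((σ ^ (-j)) x) = f x + j • τ := by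
  have hf' : ∀ x, f (σ x) = f x - τ := by
    intro x
    have := hf (σ x)
    simp at this
    rw [this]; ring
  induction j with
  | zero => simp
  | succ i ih =>
    rw [show (-((i:ℤ)+1)) = (-1) + -(i:ℤ) by ring, zpow_add, Equiv.Perm.mul_apply, zpow_neg_one, hf,
      ih, add_smul, one_smul]
    ring
  | pred i ih =>
    rw [show (-(-(i:ℤ)-1)) = 1 + -(-(i:ℤ)) by ring, zpow_add, Equiv.Perm.mul_apply, zpow_one, hf',
      ih, sub_smul, one_smul]
    ring

section
variable {n k K : ℕ} [NeZero k] [NeZero K] (σ : Equiv.Perm (Fin n)) (τ : ZMod k)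
  (hK : addOrderOf τ * K = k) (hKk : K ∣ k)
  (f : Fin n → ZMod k) (hf : ∀ x, f (σ⁻¹ x) = f x + τ) (φ : Cyc σ → ZMod K)
  (hφ : ∀ x, φ (cyc σ x) = ZMod.castHom hKk (ZMod K) (f x))

lemma block_cyc (hK : addOrderOf τ * K = k) (hKk : K ∣ k) (hf : ∀ x, f (σ⁻¹ x) = f x + τ)
    (hφ : ∀ x, φ (cyc σ x) = ZMod.castHom hKk (ZMod K) (f x)) (c : ZMod k) (C : Cyc σ) :
    (C.1.filter fun y => f y = c).card =
      if φ C = ZMod.castHom hKk (ZMod K) c then C.1.card / addOrderOf τ else 0 := by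
  obtain ⟨k1, k2⟩ := ker_facts τ hK hKk
  have hφ' : ∀ y ∈ C.1, φ C = ZMod.castHom hKk (ZMod K) (f y) := by
    intro y hy
    rw [← hφ, (mem_Cyc_iff σ C y).1 hy]
  split_ifs with h
  · have hd : 0 < addOrderOf τ := by
      rw [addOrderOf_pos_iff]; exact isOfFinAddOrder_of_finite τ
    symm
    apply Nat.div_eq_of_eq_mul_right hd
    rw [Finset.card_eq_sum_card_fiberwise (f := f)
      (t := Finset.univ.filter fun a : ZMod k =>
        ZMod.castHom hKk (ZMod K) a = ZMod.castHom hKk (ZMod K) c)]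
    · rw [Finset.sum_congr rfl (g := fun _ => (C.1.filter fun y => f y = c).card)]
      · rw [Finset.sum_const, fiber_card τ hK hKk, smul_eq_mul]
      · intro a ha
        rw [Finset.mem_filter] at ha
        obtain ⟨j, hj⟩ := k2 _ _ ha.2
        -- the power of σ carries one to the other
        refine Finset.card_bij (fun y _ => (σ ^ (-j)) y) ?_ ?_ ?_
        · intro y hy
          rw [Finset.mem_filter, mem_Cyc_iff] at hy ⊢
          rw [cyc_zpow, twist_zpow σ τ f hf, hy.2, hj]
          exact ⟨hy.1, rfl⟩
        · intro y _ y' _ h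
          exact (σ ^ (-j)).injective h
        · intro y hy
          rw [Finset.mem_filter, mem_Cyc_iff] at hy
          refine ⟨(σ ^ j) y, ?_, ?_⟩
          · rw [Finset.mem_filter, mem_Cyc_iff, cyc_zpow]
            refine ⟨hy.1, ?_⟩
            have := twist_zpow σ τ f hf (-j) y
            rw [neg_neg] at this
            rw [this, hy.2, hj, neg_smul]
            ring
          · simp
    · intro y hy
      simp only [Finset.coe_filter, Finset.mem_univ, true_and, Set.mem_ofPred_eq]
      rw [← hφ' y hy, h]
  · rw [Finset.card_eq_zero, Finset.filter_eq_empty_iff]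
    rintro y hy rfl
    exact h (hφ' y hy)

lemma block_card (hK : addOrderOf τ * K = k) (hKk : K ∣ k) (hf : ∀ x, f (σ⁻¹ x) = f x + τ)
    (hφ : ∀ x, φ (cyc σ x) = ZMod.castHom hKk (ZMod K) (f x)) (x : Fin n) :
    (Finset.univ.filter fun y => f y = f x).card =
      ∑ C : Cyc σ with φ C = φ (cyc σ x), C.1.card / addOrderOf τ := by
  rw [Finset.sum_filter, Finset.card_eq_sum_card_fiberwise (f := cyc σ) (t := Finset.univ)]
  · refine Finset.sum_congr rfl fun C _ => ?_
    rw [hφ, ← block_cyc σ τ f φ hK hKk hf hφ]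
    congr 1
    ext y
    simp only [Finset.mem_filter, Finset.mem_univ, true_and, mem_Cyc_iff]
    tauto
  · intro _ _; simp

lemma hyp_transfer (hK : addOrderOf τ * K = k) (hKk : K ∣ k) (hf : ∀ x, f (σ⁻¹ x) = f x + τ)
    (hφ : ∀ x, φ (cyc σ x) = ZMod.castHom hKk (ZMod K) (f x)) :
    Hypersimplicial f ↔ WHyp (fun C : Cyc σ => C.1.card / addOrderOf τ) φ := by
  rw [Hyp_iff (Nat.pos_of_ne_zero (NeZero.ne k))]
  obtain ⟨k1, k2⟩ := ker_facts τ hK hKk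
  constructor
  · intro h C
    obtain ⟨x, rfl⟩ := exists_cyc σ C
    obtain ⟨l, h1, h2, y, hy⟩ := h x
    rw [block_card σ τ f φ hK hKk hf hφ] at h2
    refine ⟨l, h1, h2, cyc σ y, ?_⟩
    rw [hφ, hφ, hy, map_add, map_natCast]
  · intro h x
    obtain ⟨l, h1, h2, C, hC⟩ := h (cyc σ x)
    rw [← block_card σ τ f φ hK hKk hf hφ] at h2
    obtain ⟨y, rfl⟩ := exists_cyc σ C
    rw [hφ, hφ, ← map_natCast (ZMod.castHom hKk (ZMod K)), ← map_add] at hC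
    obtain ⟨j, hj⟩ := k2 _ _ hC
    exact ⟨l, h1, h2, (σ ^ (-j)) y, by rw [twist_zpow σ τ f hf, hj]⟩

open Classical in
lemma twist_card (hK : addOrderOf τ * K = k) (hKk : K ∣ k)
    (hd : ∀ C : Cyc σ, addOrderOf τ ∣ C.1.card) (x0 : Fin n) :
    (Finset.univ.filter fun f : Fin n → ZMod k => f x0 = 0 ∧ (∀ x, f (σ⁻¹ x) = f x + τ) ∧
      Hypersimplicial f).card =
    addOrderOf τ ^ ((cycleSets σ).card - 1) *
      (Finset.univ.filter fun φ : Cyc σ → ZMod K => φ (cyc σ x0) = 0 ∧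
        WHyp (fun C : Cyc σ => C.1.card / addOrderOf τ) φ).card := by
  have hc : (cycleSets σ).card = Fintype.card (Cyc σ) := by simp
  rw [hc, ← lift_card τ hK hKk]
  symm
  obtain ⟨u, hu1, hu2, hu3⟩ := exists_twist σ τ hd x0
  obtain ⟨k1, k2⟩ := ker_facts τ hK hKk
  have hu4 : ∀ x, ZMod.castHom hKk (ZMod K) (u x) = 0 := by
    intro x
    obtain ⟨j, hj⟩ := hu3 x
    rw [hj, map_zsmul, k1, smul_zero]
  have htw : ∀ ψ : Cyc σ → ZMod k, ∀ x, u (σ⁻¹ x) + ψ (cyc σ (σ⁻¹ x)) = u x + ψ (cyc σ x) + τ := by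
    intro ψ x
    rw [show cyc σ (σ⁻¹ x) = cyc σ x from (cyc_eq_iff _ _ _).2 (by simp [Equiv.Perm.SameCycle.refl]), hu1]
    ring
  have htr : ∀ ψ : Cyc σ → ZMod k, Hypersimplicial (fun x => u x + ψ (cyc σ x)) ↔
      WHyp (fun C : Cyc σ => C.1.card / addOrderOf τ)
        (fun C => ZMod.castHom hKk (ZMod K) (ψ C)) := by
    intro ψ
    refine hyp_transfer σ τ _ _ hK hKk (htw ψ) ?_
    intro x
    rw [map_add, hu4, zero_add]
  refine Finset.card_bij (fun ψ _ x => u x + ψ (cyc σ x)) ?_ ?_ ?_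
  · intro ψ hψ
    rw [Finset.mem_filter] at hψ ⊢
    exact ⟨Finset.mem_univ _, by simp [hu2, hψ.2.1], htw ψ, (htr ψ).2 hψ.2.2⟩
  · intro ψ _ ψ' _ h
    funext C
    obtain ⟨x, rfl⟩ := exists_cyc σ C
    exact add_left_cancel (congrFun h x)
  · intro f hf
    rw [Finset.mem_filter] at hf
    obtain ⟨_, h1, h2, h3⟩ := hf
    have hinv : ∀ x y, cyc σ x = cyc σ y → f x - u x = f y - u y := by
      intro x y hxy
      obtain ⟨j, rfl⟩ := (cyc_eq_iff _ _ _).1 hxy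
      have e1 := twist_zpow σ τ f h2 (-j) x
      have e2 := twist_zpow σ τ u hu1 (-j) x
      rw [neg_neg] at e1 e2
      rw [e1, e2]; ring
    let ψ : Cyc σ → ZMod k := fun C => f (exists_cyc σ C).choose - u (exists_cyc σ C).choose
    have hψ : ∀ x, ψ (cyc σ x) = f x - u x := fun x =>
      hinv _ _ (exists_cyc σ (cyc σ x)).choose_spec
    have hfe : (fun x => u x + ψ (cyc σ x)) = f := by
      funext x; rw [hψ]; ring
    refine ⟨ψ, ?_, hfe⟩
    rw [Finset.mem_filter]
    refine ⟨Finset.mem_univ _, by rw [hψ, h1, hu2, sub_zero], (htr ψ).1 ?_⟩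
    rw [hfe]; exact h3
end

lemma mem_Iset (k h : ℕ) (I : Fin (k-1) → ℕ) :
    I ∈ Iset k h ↔ ∑ t : Fin (k-1), ((t : ℕ) + 1) * I t = h := by
  unfold Iset
  rw [Finset.mem_image]
  constructor
  · rintro ⟨J, hJ, rfl⟩
    exact (Finset.mem_filter.1 hJ).2
  · intro hI
    have hle : ∀ t, I t < h + 1 := by
      intro t
      have h1 : ((t : ℕ) + 1) * I t ≤ h := by
        rw [← hI]
        exact Finset.single_le_sum (f := fun t : Fin (k-1) => ((t : ℕ) + 1) * I t)
          (fun _ _ => Nat.zero_le _) (Finset.mem_univ t)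
      nlinarith
    exact ⟨fun t => ⟨I t, hle t⟩, by simpa using hI, rfl⟩

lemma prof_sum {ι : Type*} (s : ι → ℕ) (k : ℕ) (T : Finset ι)
    (hT : ∀ i ∈ T, 1 ≤ s i ∧ s i < k) (F : ℕ → ℕ) :
    ∑ i ∈ T, F (s i) = ∑ t : Fin (k-1), F (t+1) * (T.filter fun i => s i = t+1).card := by
  have h1 : ∀ t : Fin (k-1), F (t+1) * (T.filter fun i => s i = t+1).card =
      ∑ i ∈ T, if s i = t+1 then F (t+1) else 0 := by
    intro t
    rw [← Finset.sum_filter, Finset.sum_const, smul_eq_mul, mul_comm]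
  simp only [h1]
  rw [Finset.sum_comm]
  refine Finset.sum_congr rfl fun i hi => ?_
  have := hT i hi
  rw [Finset.sum_eq_single (⟨s i - 1, by omega⟩ : Fin (k-1))]
  · simp only
    rw [if_pos (by omega)]
    congr 1; omega
  · intro t _ ht
    rw [if_neg]
    intro h
    apply ht
    apply Fin.ext
    simp only
    omega
  · intro h; exact absurd (Finset.mem_univ _) h

lemma profile_sum {ι : Type*} [Fintype ι] [DecidableEq ι] (s : ι → ℕ) (hs : ∀ i, 1 ≤ s i)
    (k h : ℕ) (hh : h < k) :
    ∑ T : Finset ι with ∑ i ∈ T, s i = h, (-1 : ℤ) ^ T.card =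
      ∑ I ∈ Iset k h, (-1 : ℤ) ^ (∑ t, I t) *
        ∏ t : Fin (k-1), (Nat.choose (Finset.univ.filter fun i => s i = t + 1).card (I t) : ℤ) := by
  have hb : ∀ T : Finset ι, ∑ i ∈ T, s i = h → ∀ i ∈ T, 1 ≤ s i ∧ s i < k := by
    intro T hT i hi
    refine ⟨hs i, lt_of_le_of_lt ?_ hh⟩
    rw [← hT]
    exact Finset.single_le_sum (f := s) (fun _ _ => Nat.zero_le _) hi
  rw [← Finset.sum_fiberwise_of_maps_to (t := Iset k h)
    (g := fun (T : Finset ι) (t : Fin (k-1)) => (T.filter fun i => s i = t+1).card)]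
  · refine Finset.sum_congr rfl fun I hI => ?_
    rw [mem_Iset] at hI
    rw [Finset.sum_congr rfl (g := fun _ => (-1 : ℤ) ^ (∑ t, I t))]
    · rw [Finset.sum_const, nsmul_eq_mul, mul_comm]
      congr 1
      rw [← Nat.cast_prod]
      congr 1
      have : ∏ t : Fin (k-1), Nat.choose (Finset.univ.filter fun i => s i = t + 1).card (I t) =
          (Fintype.piFinset fun t : Fin (k-1) =>
            Finset.powersetCard (I t) (Finset.univ.filter fun i => s i = t + 1)).card := by
        rw [Fintype.card_piFinset]
        exact Finset.prod_congr rfl fun t _ => (Finset.card_powersetCard _ _).symm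
      rw [this]
      have hG : ∀ G : Fin (k-1) → Finset ι, (∀ t, ∀ i ∈ G t, s i = t + 1) →
          ∀ t : Fin (k-1), (Finset.univ.biUnion G).filter (fun i => s i = t + 1) = G t := by
        intro G hG t
        ext i
        simp only [Finset.mem_filter, Finset.mem_biUnion, Finset.mem_univ, true_and]
        constructor
        · rintro ⟨⟨t', ht'⟩, hi⟩
          have := hG t' i ht'
          have : t' = t := Fin.ext (by omega)
          rwa [← this]
        · intro hi
          exact ⟨⟨t, hi⟩, hG t i hi⟩
      refine Finset.card_bij' (fun T _ t => T.filter fun i => s i = t + 1)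
        (fun G _ => Finset.univ.biUnion G) ?_ ?_ ?_ ?_
      · intro T hT
        rw [Finset.mem_filter] at hT
        rw [Fintype.mem_piFinset]
        intro t
        rw [Finset.mem_powersetCard]
        exact ⟨Finset.filter_subset_filter _ (Finset.subset_univ _), congrFun hT.2 t⟩
      · intro G hG'
        rw [Fintype.mem_piFinset] at hG'
        have hG1 : ∀ t, ∀ i ∈ G t, s i = t + 1 := by
          intro t i hi
          have := (Finset.mem_powersetCard.1 (hG' t)).1 hi
          simpa using this
        have hp : ∀ t : Fin (k-1),
            ((Finset.univ.biUnion G).filter (fun i => s i = t + 1)).card = I t := by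
          intro t
          rw [hG G hG1]
          exact (Finset.mem_powersetCard.1 (hG' t)).2
        rw [Finset.mem_filter, Finset.mem_filter]
        refine ⟨⟨Finset.mem_univ _, ?_⟩, funext hp⟩
        have := prof_sum s k (Finset.univ.biUnion G) ?_ (fun x => x)
        · rw [this, ← hI]
          exact Finset.sum_congr rfl fun t _ => by rw [hp]
        · intro i hi
          obtain ⟨t, _, ht⟩ := Finset.mem_biUnion.1 hi
          have := hG1 t i ht
          have := t.2
          omega
      · intro T hT
        rw [Finset.mem_filter, Finset.mem_filter] at hT
        ext i
        simp only [Finset.mem_biUnion, Finset.mem_univ, true_and, Finset.mem_filter]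
        constructor
        · rintro ⟨t, h1, _⟩; exact h1
        · intro hi
          have := hb T hT.1.2 i hi
          exact ⟨⟨s i - 1, by omega⟩, hi, by simp only; omega⟩
      · intro G hG'
        rw [Fintype.mem_piFinset] at hG'
        have hG1 : ∀ t, ∀ i ∈ G t, s i = t + 1 := by
          intro t i hi
          have := (Finset.mem_powersetCard.1 (hG' t)).1 hi
          simpa using this
        funext t
        exact hG G hG1 t
    · intro T hT
      rw [Finset.mem_filter, Finset.mem_filter] at hT
      congr 1
      have := prof_sum s k T (hb T hT.1.2) (fun _ => 1)
      simp only [Finset.sum_const, smul_eq_mul, mul_one, one_mul] at this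
      rw [this, ← hT.2]
  · intro T hT
    rw [Finset.mem_filter] at hT
    rw [mem_Iset]
    have := prof_sum s k T (hb T hT.2) (fun x => x)
    rw [← this, hT.2]

open Classical in
lemma hypDospCount_eq {n k : ℕ} [NeZero k] (σ : Equiv.Perm (Fin n)) (x0 : Fin n) :
    hypDospCount n k σ = (Finset.univ.filter fun f : Fin n → ZMod k => f x0 = 0 ∧
      (∃ τ : ZMod k, ∀ i, f (σ⁻¹ i) = f i + τ) ∧ Hypersimplicial f).card := by
  have hk : 0 < k := Nat.pos_of_ne_zero (NeZero.ne k)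
  unfold hypDospCount
  rw [← Set.ncard_coe_finset]
  rw [← Set.ncard_image_of_injOn (f := fun f => Quotient.mk (dospSetoid n k) f)]
  · congr 1
    ext D
    constructor
    · rintro ⟨f, rfl, ⟨τ, hτ⟩, hf⟩
      refine ⟨fun i => f i - f x0, ?_, ?_⟩
      · rw [Finset.mem_coe, Finset.mem_filter]
        refine ⟨Finset.mem_univ _, by simp, ⟨τ, fun i => by simp only [hτ]; ring⟩, ?_⟩
        rw [Hyp_iff hk] at hf ⊢
        intro i
        obtain ⟨l, h1, h2, j, hj⟩ := hf i
        exact ⟨l, h1, by simpa using h2, j, by rw [hj]; ring⟩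
      · exact Quotient.sound ⟨-f x0, fun i => by ring⟩
    · rintro ⟨f, hf, rfl⟩
      rw [Finset.mem_coe, Finset.mem_filter] at hf
      exact ⟨f, rfl, hf.2.2.1, hf.2.2.2⟩
  · intro f hf g hg h
    rw [Finset.mem_coe, Finset.mem_filter] at hf hg
    obtain ⟨c, hc⟩ := Quotient.exact h
    have h0 := hc x0
    rw [hf.2.1, hg.2.1, zero_add] at h0
    funext i
    rw [hc i, ← h0, add_zero]

open Classical in
lemma hypDospCount_sum {n k : ℕ} [NeZero k] (σ : Equiv.Perm (Fin n)) (x0 : Fin n) :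
    hypDospCount n k σ = ∑ τ : ZMod k, (Finset.univ.filter fun f : Fin n → ZMod k => f x0 = 0 ∧
      (∀ i, f (σ⁻¹ i) = f i + τ) ∧ Hypersimplicial f).card := by
  rw [hypDospCount_eq σ x0, Finset.card_eq_sum_card_fiberwise (f := fun f => f (σ⁻¹ x0) - f x0)
    (t := Finset.univ) (fun _ _ => by simp)]
  refine Finset.sum_congr rfl fun τ _ => ?_
  congr 1
  ext f
  simp only [Finset.mem_filter, Finset.mem_univ, true_and]
  constructor
  · rintro ⟨⟨h1, ⟨τ', h2⟩, h3⟩, h4⟩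
    have : τ' = τ := by rw [← h4, h2]; ring
    exact ⟨h1, this ▸ h2, h3⟩
  · rintro ⟨h1, h2, h3⟩
    exact ⟨⟨h1, ⟨τ, h2⟩, h3⟩, by rw [h2]; ring⟩

lemma twist_dvd {n k : ℕ} (σ : Equiv.Perm (Fin n)) (τ : ZMod k) (f : Fin n → ZMod k)
    (hf : ∀ x, f (σ⁻¹ x) = f x + τ) (C : Cyc σ) : addOrderOf τ ∣ C.1.card := by
  obtain ⟨x, rfl⟩ := exists_cyc σ C
  have h1 : (σ ^ (-((cyc σ x).1.card : ℤ))) x = x := by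
    rw [(cyc_isCycleOn σ (cyc σ x)).zpow_apply_eq
      ((mem_cyc σ x x).2 (Equiv.Perm.SameCycle.refl _ _))]
    simp
  have h2 := twist_zpow σ τ f hf ((cyc σ x).1.card : ℤ) x
  rw [h1] at h2
  have h3 : ((cyc σ x).1.card : ℤ) • τ = 0 := by
    have := h2.symm
    rwa [add_eq_left] at this
  rw [natCast_zsmul] at h3
  exact addOrderOf_dvd_of_nsmul_eq_zero h3

open Classical in
lemma twist_total {n k : ℕ} [NeZero k] (σ : Equiv.Perm (Fin n)) (τ : ZMod k)
    (hd : ∀ C : Cyc σ, addOrderOf τ ∣ C.1.card) (x0 : Fin n) :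
    ((Finset.univ.filter fun f : Fin n → ZMod k => f x0 = 0 ∧ (∀ x, f (σ⁻¹ x) = f x + τ) ∧
      Hypersimplicial f).card : ℤ) =
    ∑ T : Finset (Cyc σ), if ∑ C ∈ T, C.1.card ≤ k then
        (-1 : ℤ) ^ T.card * ((k - ∑ C ∈ T, C.1.card : ℕ) : ℤ) ^ ((cycleSets σ).card - 1) else 0 := by
  have hk : 0 < k := Nat.pos_of_ne_zero (NeZero.ne k)
  have hdk : addOrderOf τ ∣ k := by
    have := addOrderOf_dvd_natCard τ
    rwa [Nat.card_zmod] at this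
  obtain ⟨K, hK⟩ := hdk
  have hd0 : 0 < addOrderOf τ := Nat.pos_of_ne_zero fun h => by rw [h] at hK; omega
  have hK0 : K ≠ 0 := fun h => by rw [h] at hK; omega
  have : NeZero K := ⟨hK0⟩
  have hKk : K ∣ k := ⟨addOrderOf τ, by rw [mul_comm]; exact hK⟩
  rw [twist_card σ τ hK.symm hKk hd x0, ← circ_card]
  obtain ⟨m, rfl⟩ := Nat.exists_eq_succ_of_ne_zero hK0
  have hpos : ∀ C : Cyc σ, 0 < C.1.card := by
    intro C
    obtain ⟨x, rfl⟩ := exists_cyc σ C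
    exact Finset.card_pos.2 ⟨x, (mem_cyc σ x x).2 (Equiv.Perm.SameCycle.refl _ _)⟩
  push_cast
  rw [DS_top_card (fun C : Cyc σ => C.1.card / addOrderOf τ)
    (fun C => Nat.div_pos (Nat.le_of_dvd (hpos C) (hd C)) hd0), Finset.mul_sum]
  refine Finset.sum_congr rfl fun T _ => ?_
  have hsum : ∑ C ∈ T, C.1.card = addOrderOf τ * ∑ C ∈ T, C.1.card / addOrderOf τ := by
    rw [Finset.mul_sum]
    exact Finset.sum_congr rfl fun C _ => (Nat.mul_div_cancel' (hd C)).symm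
  have hiff : ∑ C ∈ T, C.1.card ≤ k ↔ ∑ C ∈ T, C.1.card / addOrderOf τ ≤ m + 1 := by
    rw [hsum]
    conv_lhs => rhs; rw [hK]
    exact Nat.mul_le_mul_left_iff hd0
  have hsub : k - ∑ C ∈ T, C.1.card =
      addOrderOf τ * (m + 1 - ∑ C ∈ T, C.1.card / addOrderOf τ) := by
    rw [hsum, Nat.mul_sub]
    congr 1
  have hc : (cycleSets σ).card = Fintype.card (Cyc σ) := by simp
  simp only [hiff]
  split_ifs with h
  · rw [hsub, hc]
    push_cast
    rw [mul_pow]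
    ring
  · simp

lemma good_iff {n k : ℕ} (σ : Equiv.Perm (Fin n)) (τ : ZMod k) :
    (∀ C : Cyc σ, addOrderOf τ ∣ C.1.card) ↔
      (Finset.gcd ((Finset.Icc 1 n).filter fun i => 1 ≤ cycleCount σ i) id) • τ = 0 := by
  rw [← addOrderOf_dvd_iff_nsmul_eq_zero, Finset.dvd_gcd_iff]
  constructor
  · intro h i hi
    rw [Finset.mem_filter] at hi
    obtain ⟨C, hC⟩ := Finset.card_pos.1 hi.2
    rw [Finset.mem_filter] at hC
    have := h ⟨C, hC.1⟩
    rw [id, ← hC.2]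
    exact this
  · intro h C
    apply h C.1.card
    rw [Finset.mem_filter, Finset.mem_Icc]
    refine ⟨⟨?_, ?_⟩, ?_⟩
    · obtain ⟨x, rfl⟩ := exists_cyc σ C
      exact Finset.card_pos.2 ⟨x, (mem_cyc σ x x).2 (Equiv.Perm.SameCycle.refl _ _)⟩
    · simpa using Finset.card_le_univ C.1
    · exact Finset.card_pos.2 ⟨C.1, Finset.mem_filter.2 ⟨C.2, rfl⟩⟩

lemma nsmul_count (k g : ℕ) [NeZero k] :
    (Finset.univ.filter fun τ : ZMod k => g • τ = 0).card = Nat.gcd k g := by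
  have h := IsAddCyclic.card_nsmulAddMonoidHom_ker (ZMod k) g
  rw [Nat.card_zmod] at h
  rw [← h, Nat.card_eq_fintype_card, ← Finset.card_univ]
  symm
  refine Finset.card_bij (fun τ _ => τ.1) ?_ ?_ ?_
  · rintro ⟨τ, hτ⟩ _
    simpa using hτ
  · intro a _ b _ h; exact Subtype.ext h
  · intro τ hτ
    refine ⟨⟨τ, ?_⟩, Finset.mem_univ _, rfl⟩
    simpa using hτ

/-- Theorem: for 2 ≤ k < n and σ ∈ S_n with r disjoint cycles, λ_i cycles of
length i, and g = gcd({k} ∪ {i ∈ [n] : λ_i ≥ 1}), the number of σ-fixed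
hypersimplicial (k,n)-DOSPs equals
g · Σ_{h=0}^{k−1} (Σ_{I ∈ 𝓘_h} (−1)^{|I|} ∏_i C(λ_i, I_i)) · (k−h)^{r−1}. -/
theorem card_fixed_hypersimplicial_dosps {n k : ℕ} (hk : 2 ≤ k) (hkn : k < n)
    (σ : Equiv.Perm (Fin n)) :
    (hypDospCount n k σ : ℤ) =
      (Nat.gcd k (Finset.gcd ((Finset.Icc 1 n).filter fun i => 1 ≤ cycleCount σ i) id) : ℤ) *
      ∑ h ∈ Finset.range k,
        (∑ I ∈ Iset k h, (-1 : ℤ) ^ (∑ t, I t) *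
          ∏ t : Fin (k-1), (Nat.choose (cycleCount σ ((t : ℕ) + 1)) (I t) : ℤ)) *
        ((k - h : ℕ) : ℤ) ^ ((cycleSets σ).card - 1) := by
  classical
  have : NeZero k := ⟨by omega⟩
  let x0 : Fin n := ⟨0, by omega⟩
  set g := Finset.gcd ((Finset.Icc 1 n).filter fun i => 1 ≤ cycleCount σ i) id with hg
  set r := (cycleSets σ).card with hr
  have hpos : ∀ C : Cyc σ, 1 ≤ C.1.card := by
    intro C
    obtain ⟨x, rfl⟩ := exists_cyc σ C
    exact Finset.card_pos.2 ⟨x, (mem_cyc σ x x).2 (Equiv.Perm.SameCycle.refl _ _)⟩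
  have h1 : (hypDospCount n k σ : ℤ) = (Nat.gcd k g : ℤ) *
      ∑ T : Finset (Cyc σ), if ∑ C ∈ T, C.1.card ≤ k then
        (-1 : ℤ) ^ T.card * ((k - ∑ C ∈ T, C.1.card : ℕ) : ℤ) ^ (r - 1) else 0 := by
    rw [hypDospCount_sum σ x0, ← nsmul_count k g]
    push_cast
    rw [← nsmul_eq_mul, ← Finset.sum_const, Finset.sum_filter]
    refine Finset.sum_congr rfl fun τ _ => ?_
    split_ifs with h
    · exact twist_total σ τ ((good_iff σ τ).2 h) x0
    · rw [Nat.cast_eq_zero, Finset.card_eq_zero, Finset.filter_eq_empty_iff]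
      rintro f _ ⟨_, hf, _⟩
      exact h ((good_iff σ τ).1 fun C => twist_dvd σ τ f hf C)
  rw [h1]
  congr 1
  have hcc : ∀ i, cycleCount σ i = (Finset.univ.filter fun C : Cyc σ => C.1.card = i).card := by
    intro i
    unfold cycleCount
    symm
    refine Finset.card_bij (fun C _ => C.1) ?_ ?_ ?_
    · intro C hC
      rw [Finset.mem_filter] at hC ⊢
      exact ⟨C.2, hC.2⟩
    · intro a _ b _ h; exact Subtype.ext h
    · intro C hC
      rw [Finset.mem_filter] at hC
      exact ⟨⟨C, hC.1⟩, by simp [hC.2], rfl⟩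
  -- drop the terms of total size `k`
  have hdrop : ∀ T : Finset (Cyc σ), (if ∑ C ∈ T, C.1.card ≤ k then
      (-1 : ℤ) ^ T.card * ((k - ∑ C ∈ T, C.1.card : ℕ) : ℤ) ^ (r - 1) else 0) =
      if ∑ C ∈ T, C.1.card ∈ Finset.range k then
      (-1 : ℤ) ^ T.card * ((k - ∑ C ∈ T, C.1.card : ℕ) : ℤ) ^ (r - 1) else 0 := by
    intro T
    simp only [Finset.mem_range]
    by_cases hlt : ∑ C ∈ T, C.1.card < k
    · rw [if_pos hlt, if_pos hlt.le]
    · rw [if_neg hlt]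
      split_ifs with hle
      · have heq : ∑ C ∈ T, C.1.card = k := by omega
        have htot : ∑ C : Cyc σ, C.1.card = n := by
          have := Finset.card_eq_sum_card_fiberwise (f := cyc σ)
            (s := (Finset.univ : Finset (Fin n))) (t := Finset.univ) (fun _ _ => by simp)
          rw [Finset.card_univ, Fintype.card_fin] at this
          refine Eq.trans ?_ this.symm
          refine Finset.sum_congr rfl fun C _ => ?_
          congr 1
          ext y
          simp [mem_Cyc_iff]
        have hT0 : T.Nonempty := by
          rw [Finset.nonempty_iff_ne_empty]
          rintro rfl
          simp at heq; omega
        have hT1 : T ≠ Finset.univ := by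
          rintro rfl
          omega
        have hcard : T.card < r := by
          have := Finset.card_lt_card (Finset.ssubset_univ_iff.2 hT1)
          simpa using this
        have := Finset.card_pos.2 hT0
        rw [heq, Nat.sub_self, Nat.cast_zero, zero_pow (by omega), mul_zero]
      · rfl
  rw [Finset.sum_congr rfl fun T _ => hdrop T, ← Finset.sum_filter]
  rw [← Finset.sum_fiberwise_of_maps_to (t := Finset.range k)
    (g := fun T : Finset (Cyc σ) => ∑ C ∈ T, C.1.card) (fun T hT => (Finset.mem_filter.1 hT).2)]
  refine Finset.sum_congr rfl fun h hh => ?_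
  rw [Finset.mem_range] at hh
  simp only [hcc]
  rw [← profile_sum (fun C : Cyc σ => C.1.card) hpos k h hh, Finset.sum_mul]
  have hset : (Finset.univ.filter fun T : Finset (Cyc σ) => ∑ C ∈ T, C.1.card ∈ Finset.range k).filter
      (fun T => ∑ C ∈ T, C.1.card = h) =
      Finset.univ.filter fun T : Finset (Cyc σ) => ∑ C ∈ T, C.1.card = h := by
    ext T
    simp only [Finset.mem_filter, Finset.mem_univ, true_and, Finset.mem_range]
    omega
  rw [hset]
  refine Finset.sum_congr rfl fun T hT => ?_
  rw [(Finset.mem_filter.1 hT).2]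
end

section
/- Fix integers 2 ≤ k < n and a permutation σ ∈ S_n. Then the sum Σ_{m≥0} H*_m(σ) of the equivariant H*-coefficients of Δ_{k,n} at σ (a finite sum, since H*_m(σ) = 0 for all m sufficiently large) equals the number of σ-fixed hypersimplicial (k,n)-DOSPs. In other words, the evaluation H*(Δ_{k,n}; S_n)[1] is the permutation character of the natural S_n-action on the set of hypersimplicial (k,n)-DOSPs. -/
open Finset

namespace HypS

/-- block of `i` -/
noncomputable def blk {ι α : Type*} [Fintype ι] (F : ι → α) (i : ι) : Finset ι := by
  classical exact univ.filter (fun i' => F i' = F i)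

lemma mem_blk {ι α : Type*} [Fintype ι] (F : ι → α) (i i' : ι) : i' ∈ blk F i ↔ F i' = F i := by
  simp [blk]

/-- cyclic badness -/
def CBad {ι : Type*} [Fintype ι] (w : ι → ℕ) (J : Finset ι) {k : ℕ} (f : ι → ZMod k) (i : ι) : Prop :=
  blk f i ⊆ J ∧ ∀ x : ℕ, 1 ≤ x → x < ∑ a ∈ blk f i, w a → ∀ i', f i' ≠ f i + (x : ZMod k)

/-- linear badness -/
def LBad {ι : Type*} [Fintype ι] (w : ι → ℕ) (J : Finset ι) (k : ℕ) (F : ι → ℕ) (i : ι) : Prop :=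
  blk F i ⊆ J ∧ (∑ a ∈ blk F i, w a) + F i ≤ k ∧
    ∀ ii, F i < F ii → (∑ a ∈ blk F i, w a) + F i ≤ F ii

/-- linear good functions based at j -/
noncomputable def LSet {ι : Type*} [Fintype ι] (w : ι → ℕ) (J : Finset ι) (j : ι) (k : ℕ) :
    Finset (ι → ℕ) := by
  classical
  exact (Fintype.piFinset (fun _ : ι => range k)).filter
    (fun F => F j = 0 ∧ ∀ i, ¬ LBad w J k F i)

lemma mem_LSet {ι : Type*} [Fintype ι] (w : ι → ℕ) (J : Finset ι) (j : ι) (k : ℕ) (F : ι → ℕ) :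
    F ∈ LSet w J j k ↔ (∀ i, F i < k) ∧ F j = 0 ∧ ∀ i, ¬ LBad w J k F i := by
  simp [LSet]

/-- The block at zero, other than `j`, is good so that `j` is split off. -/
def Split {ι : Type*} [Fintype ι] [DecidableEq ι] (w : ι → ℕ) (J : Finset ι) (j : ι) (k : ℕ)
    (G : ι → ℕ) : Prop :=
  ((blk G j).erase j).Nonempty ∧ ¬ ((blk G j).erase j ⊆ J ∧ ∑ a ∈ (blk G j).erase j, w a ≤ k ∧
    ∀ i', 0 < G i' → ∑ a ∈ (blk G j).erase j, w a ≤ G i')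

open Classical in
/-- The inverse map. -/
noncomputable def Psi {ι : Type*} [Fintype ι] [DecidableEq ι] (w : ι → ℕ) (J : Finset ι) (j : ι) (k : ℕ)
    (G : ι → ℕ) (i : ι) : ℕ :=
  if Split w J j k G then (if i = j then 0 else G i + w j)
  else (if G i = 0 then 0 else G i + w j)

section
variable {ι : Type*} [Fintype ι] [DecidableEq ι] (w : ι → ℕ) (hw : ∀ i, 0 < w i)
  (J : Finset ι) (j : ι) (hj : j ∉ J) (k : ℕ)

lemma wj_le (F : ι → ℕ) : w j ≤ ∑ a ∈ blk F j, w a :=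
  Finset.single_le_sum (f := w) (fun _ _ => Nat.zero_le _) ((mem_blk F j j).2 rfl)

lemma sum_blk_erase (F : ι → ℕ) : w j + ∑ a ∈ (blk F j).erase j, w a = ∑ a ∈ blk F j, w a :=
  Finset.add_sum_erase _ _ ((mem_blk F j j).2 rfl)

include hj in
lemma not_LBad_zero (F : ι → ℕ) (hF : F j = 0) (k : ℕ) (i : ι) (hi : F i = 0) :
    ¬ LBad w J k F i := by
  rintro ⟨h, -⟩
  exact hj (h ((mem_blk _ _ _).2 (by rw [hF, hi])))

include hw hj in
lemma Phi_mem (hcard : ∃ i, i ≠ j) (F : ι → ℕ) (hF : F ∈ LSet w J j k)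
    (hb : LBad w (insert j J) k F j) :
    (fun i => F i - w j) ∈ LSet w J j (k - w j) := by
  rw [mem_LSet] at hF ⊢
  obtain ⟨hlt, h0, hg⟩ := hF
  obtain ⟨hb1, hb2, hb3⟩ := hb
  rw [h0] at hb2 hb3
  have hwj := wj_le w j F
  have hwk : w j < k := by
    by_cases h : ∃ i, i ≠ j ∧ F i = 0
    · obtain ⟨i, hij, hi⟩ := h
      have h1 := sum_blk_erase w j F
      have h2 : w i ≤ ∑ a ∈ (blk F j).erase j, w a :=
        Finset.single_le_sum (f := w) (fun _ _ => Nat.zero_le _)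
          (Finset.mem_erase.2 ⟨hij, (mem_blk _ _ _).2 (by rw [hi, h0])⟩)
      have := hw i
      omega
    · push Not at h
      obtain ⟨i, hij⟩ := hcard
      have h1 := h i hij
      have h2 := hb3 i (by omega)
      have := hlt i
      omega
  refine ⟨fun i => ?_, by simp [h0], fun i => ?_⟩
  · have := hlt i
    show F i - w j < k - w j
    omega
  · by_cases hi : F i - w j = 0
    · exact not_LBad_zero w J j hj _ (by simp [h0]) _ i hi
    · intro hbad
      apply hg i
      have hge : ∀ i', F i' = 0 ∨ w j ≤ F i' := fun i' => by
        by_cases h : F i' = 0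
        · exact Or.inl h
        · have := hb3 i' (by omega)
          omega
      have hblk : blk (fun i => F i - w j) i = blk F i := by
        ext a
        simp only [mem_blk]
        have := hge a
        omega
      obtain ⟨h1, h2, h3⟩ := hbad
      rw [hblk] at h1 h2 h3
      refine ⟨h1, ?_, ?_⟩
      · simp only at h2; omega
      · intro i' hi'
        have := h3 i' (by simp only; omega)
        simp only at this
        omega

include hw hj in
lemma Psi_mem (G : ι → ℕ) (hG : G ∈ LSet w J j (k - w j)) :
    Psi w J j (k - w j) G ∈ LSet w J j k ∧ LBad w (insert j J) k (Psi w J j (k - w j) G) j := by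
  rw [mem_LSet] at hG ⊢
  obtain ⟨hlt, h0, hg⟩ := hG
  have hwk := hlt j
  have hwj := hw j
  by_cases hs : Split w J j (k - w j) G
  · have hP : Psi w J j (k - w j) G = fun i => if i = j then 0 else G i + w j := by
      funext i; simp [Psi, hs]
    rw [hP]
    have hne : ∀ i, i ≠ j → blk (fun i => if i = j then 0 else G i + w j) i = (blk G i).erase j := by
      intro i hi
      ext a
      simp only [mem_blk, Finset.mem_erase, hi, if_false]
      by_cases ha : a = j
      · simp [ha]; omega
      · simp [ha]
    refine ⟨⟨?_, by simp, ?_⟩, ?_⟩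
    · intro i
      have := hlt i
      simp only
      split_ifs <;> omega
    · intro i
      by_cases hi : i = j
      · subst hi
        exact not_LBad_zero w J i hj _ (by simp) _ i (by simp)
      · rintro ⟨h1, h2, h3⟩
        rw [hne i hi] at h1 h2 h3
        simp only [hi, if_false] at h2 h3
        by_cases hi0 : G i = 0
        · apply hs.2
          have hb : blk G i = blk G j := by ext a; simp [mem_blk, hi0, h0]
          rw [hb] at h1 h2 h3
          refine ⟨h1, by omega, fun i' hi' => ?_⟩
          have hij : i' ≠ j := by rintro rfl; omega
          have := h3 i' (by simp only [hij, if_false]; omega)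
          simp only [hij, if_false] at this
          omega
        · apply hg i
          have hb : (blk G i).erase j = blk G i := by
            apply Finset.erase_eq_of_notMem
            rw [mem_blk]; omega
          rw [hb] at h1 h2 h3
          refine ⟨h1, by omega, fun i' hi' => ?_⟩
          have hij : i' ≠ j := by rintro rfl; omega
          have := h3 i' (by simp only [hij, if_false]; omega)
          simp only [hij, if_false] at this
          omega
    · have hbj : blk (fun i => if i = j then 0 else G i + w j) j = {j} := by
        ext a
        simp only [mem_blk, Finset.mem_singleton]
        by_cases ha : a = j
        · simp [ha]
        · simp [ha]; omega
      refine ⟨?_, ?_, ?_⟩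
      · rw [hbj]; simp
      · rw [hbj]; simp; omega
      · rw [hbj]
        intro i' hi'
        simp only [Finset.sum_singleton, if_true] at hi' ⊢
        split_ifs at hi' ⊢ <;> omega
  · have hP : Psi w J j (k - w j) G = fun i => if G i = 0 then 0 else G i + w j := by
      funext i; simp [Psi, hs]
    rw [hP]
    have hblk : ∀ i, blk (fun i => if G i = 0 then 0 else G i + w j) i = blk G i := by
      intro i
      ext a
      simp only [mem_blk]
      split_ifs <;> omega
    have hs' : (blk G j).erase j ⊆ J ∧ ∑ a ∈ (blk G j).erase j, w a ≤ (k - w j) ∧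
        ∀ i', 0 < G i' → ∑ a ∈ (blk G j).erase j, w a ≤ G i' := by
      by_cases he : ((blk G j).erase j).Nonempty
      · by_contra hc
        exact hs ⟨he, hc⟩
      · rw [Finset.not_nonempty_iff_eq_empty] at he
        rw [he]; simp
    obtain ⟨hs1, hs2, hs3⟩ := hs'
    refine ⟨⟨?_, by simp [h0], ?_⟩, ?_⟩
    · intro i
      have := hlt i
      simp only
      split_ifs <;> omega
    · intro i
      by_cases hi : G i = 0
      · exact not_LBad_zero w J j hj _ (by simp [h0]) _ i (by simp [hi])
      · rintro ⟨h1, h2, h3⟩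
        rw [hblk] at h1 h2 h3
        simp only [hi, if_false] at h2 h3
        apply hg i
        refine ⟨h1, by omega, fun i' hi' => ?_⟩
        have hij : G i' ≠ 0 := by omega
        have := h3 i' (by simp only [hij, if_false]; omega)
        simp only [hij, if_false] at this
        omega
    · have hsum := sum_blk_erase w j G
      refine ⟨?_, ?_, ?_⟩
      · rw [hblk]
        intro a ha
        by_cases haj : a = j
        · simp [haj]
        · exact Finset.mem_insert_of_mem (hs1 (Finset.mem_erase.2 ⟨haj, ha⟩))
      · rw [hblk]; simp only [h0, if_true]; omega
      · rw [hblk]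
        intro i' hi'
        simp only [h0, if_true] at hi' ⊢
        split_ifs at hi' ⊢ with hh
        · omega
        · have := hs3 i' (by omega)
          omega

include hw in
lemma Phi_Psi (G : ι → ℕ) (hG : G ∈ LSet w J j (k - w j)) :
    (fun i => Psi w J j (k - w j) G i - w j) = G := by
  rw [mem_LSet] at hG
  funext i
  have := hG.2.1
  simp only [Psi]
  split_ifs with h1 h2 h3
  · subst h2; omega
  · omega
  · omega
  · omega

include hw in
lemma Psi_Phi (F : ι → ℕ) (hF : F ∈ LSet w J j k)
    (hb : LBad w (insert j J) k F j) :
    Psi w J j (k - w j) (fun i => F i - w j) = F := by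
  rw [mem_LSet] at hF
  obtain ⟨hlt, h0, hg⟩ := hF
  obtain ⟨hb1, hb2, hb3⟩ := hb
  rw [h0] at hb2 hb3
  have hwj := wj_le w j F
  have hwj0 := hw j
  set G : ι → ℕ := fun i => F i - w j with hGdef
  have hGi : ∀ i, G i = F i - w j := fun _ => rfl
  by_cases h : ∃ i, i ≠ j ∧ F i = 0
  · obtain ⟨i, hij, hi⟩ := h
    have h1 := sum_blk_erase w j F
    have h2 : w i ≤ ∑ a ∈ (blk F j).erase j, w a :=
      Finset.single_le_sum (f := w) (fun _ _ => Nat.zero_le _)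
        (Finset.mem_erase.2 ⟨hij, (mem_blk _ _ _).2 (by rw [hi, h0])⟩)
    have hwi := hw i
    have hblk : blk G j = blk F j := by
      ext a
      simp only [mem_blk, hGi, h0]
      by_cases ha : F a = 0
      · simp [ha]
      · have := hb3 a (by omega)
        omega
    have hns : ¬ Split w J j (k - w j) G := by
      rintro ⟨-, hs⟩
      apply hs
      rw [hblk]
      refine ⟨?_, by omega, fun i' hi' => ?_⟩
      · intro a ha
        rw [Finset.mem_erase] at ha
        exact Finset.mem_of_mem_insert_of_ne (hb1 ha.2) ha.1
      · rw [hGi] at hi' ⊢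
        have := hb3 i' (by omega)
        omega
    funext a
    simp only [Psi, hns, if_false, hGi]
    by_cases ha : F a = 0
    · simp [ha]
    · have := hb3 a (by omega)
      split_ifs <;> omega
  · push Not at h
    have hge : ∀ a, a ≠ j → w j ≤ F a := fun a ha => by
      have := h a ha
      have := hb3 a (by omega)
      omega
    by_cases hs : Split w J j (k - w j) G
    · funext a
      simp only [Psi, hs, if_true, hGi]
      split_ifs with ha
      · rw [ha, h0]
      · have := hge a ha; omega
    · have he : ¬ ((blk G j).erase j).Nonempty := by
        intro he
        apply hs
        refine ⟨he, ?_⟩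
        obtain ⟨i, hi⟩ := he
        rw [Finset.mem_erase, mem_blk, hGi, hGi, h0] at hi
        have hi2 := hge i hi.1
        have hb : blk F i = (blk G j).erase j := by
          ext a
          rw [Finset.mem_erase, mem_blk, mem_blk, hGi, hGi, h0]
          by_cases ha : a = j
          · rw [ha]; simp; omega
          · have := hge a ha
            simp only [ne_eq, ha, not_false_eq_true, true_and]; omega
        rintro ⟨h1, h2, h3⟩
        apply hg i
        rw [← hb] at h1 h2 h3
        have := hlt i
        refine ⟨h1, by omega, fun i' hi' => ?_⟩
        have := h3 i' (by rw [hGi]; omega)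
        rw [hGi] at this
        omega
      funext a
      simp only [Psi, hs, if_false]
      by_cases ha : a = j
      · subst ha; simp [hGi, h0]
      · have h1 : G a ≠ 0 := by
          intro h1
          apply he
          refine ⟨a, Finset.mem_erase.2 ⟨ha, ?_⟩⟩
          rw [mem_blk, h1, hGi, h0]; simp
        rw [if_neg h1, hGi]
        have := hge a ha
        omega

include hw hj in
lemma LSet_rec (hcard : ∃ i, i ≠ j) :
    (LSet w J j k).card = (LSet w (insert j J) j k).card + (LSet w J j (k - w j)).card := by
  classical
  have h1 : LSet w (insert j J) j k =
      (LSet w J j k).filter (fun F => ¬ LBad w (insert j J) k F j) := by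
    ext F
    rw [Finset.mem_filter, mem_LSet, mem_LSet]
    constructor
    · rintro ⟨h1, h2, h3⟩
      refine ⟨⟨h1, h2, fun i hi => h3 i ?_⟩, h3 j⟩
      exact ⟨hi.1.trans (Finset.subset_insert _ _), hi.2⟩
    · rintro ⟨⟨h1, h2, h3⟩, h4⟩
      refine ⟨h1, h2, fun i hi => ?_⟩
      by_cases hji : j ∈ blk F i
      · rw [mem_blk] at hji
        apply h4
        have hb : blk F i = blk F j := by ext a; simp [mem_blk, hji]
        obtain ⟨a, b, c⟩ := hi
        rw [hb] at a b c
        refine ⟨a, by rw [hji]; exact b, by rw [hji]; exact c⟩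
      · apply h3 i
        refine ⟨fun a ha => ?_, hi.2⟩
        exact Finset.mem_of_mem_insert_of_ne (hi.1 ha) (by rintro rfl; exact hji ha)
  have h2 : ((LSet w J j k).filter (fun F => LBad w (insert j J) k F j)).card =
      (LSet w J j (k - w j)).card := by
    apply Finset.card_nbij' (fun F i => F i - w j) (Psi w J j (k - w j))
    · intro F hF
      rw [Finset.mem_coe, Finset.mem_filter] at hF
      exact Phi_mem w hw J j hj k hcard F hF.1 hF.2
    · intro G hG
      rw [Finset.mem_coe, Finset.mem_filter]
      exact Psi_mem w hw J j hj k G hG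
    · intro F hF
      rw [Finset.mem_coe, Finset.mem_filter] at hF
      exact Psi_Phi w hw J j k F hF.1 hF.2
    · intro G hG
      exact Phi_Psi w hw J j k G hG
  rw [h1, ← h2, add_comm, Finset.card_filter_add_card_filter_not]

end

/-- cyclic good functions -/
noncomputable def CSet {ι : Type*} [Fintype ι] (w : ι → ℕ) (J : Finset ι) (k : ℕ) [NeZero k] :
    Finset (ι → ZMod k) := by
  classical exact univ.filter (fun f => ∀ i, ¬ CBad w J f i)

section
variable {ι : Type*} [Fintype ι] [DecidableEq ι] (w : ι → ℕ)
  (J : Finset ι) (j : ι) (k : ℕ) [NeZero k]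

lemma CBad_iff_LBad (f : ι → ZMod k) (hf : f j = 0) (i : ι) :
    CBad w J f i ↔ LBad w J k (fun a => (f a).val) i := by
  have hblk : blk (fun a => (f a).val) i = blk f i := by
    ext a; simp [mem_blk, (ZMod.val_injective k).eq_iff]
  unfold CBad LBad
  rw [hblk]
  apply and_congr Iff.rfl
  constructor
  · intro h
    constructor
    · by_contra hc
      have h1 := ZMod.val_lt (f i)
      simp only at hc
      apply h (k - (f i).val) (by omega) (by omega) j
      rw [hf, Nat.cast_sub h1.le]; simp
    · intro i' hi'
      by_contra hc
      simp only at hi' hc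
      apply h ((f i').val - (f i).val) (by omega) (by omega) i'
      rw [Nat.cast_sub hi'.le]; simp
  · rintro ⟨h1, h2⟩ x hx1 hx2 i' hi'
    simp only at h1 h2
    have hv : (f i').val = (f i).val + x := by
      rw [hi', ZMod.val_add_of_lt, ZMod.val_natCast_of_lt (by omega)]
      rw [ZMod.val_natCast_of_lt (by omega)]; omega
    have := h2 i' (by omega)
    omega

lemma CBad_shift (f : ι → ZMod k) (c : ZMod k) (i : ι) :
    CBad w J (fun a => f a + c) i ↔ CBad w J f i := by
  have hblk : blk (fun a => f a + c) i = blk f i := by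
    ext a; simp [mem_blk]
  unfold CBad
  rw [hblk]
  apply and_congr Iff.rfl
  have : ∀ (x : ℕ) i', (f i' + c ≠ f i + c + x) ↔ f i' ≠ f i + x := by
    intro x i'
    rw [show f i + c + x = f i + x + c by ring]
    simp
  simp only [this]

lemma CSet_card : (CSet w J k).card = k * (LSet w J j k).card := by
  classical
  have h1 : (LSet w J j k).card = ((CSet w J k).filter (fun f => f j = 0)).card := by
    symm
    apply Finset.card_nbij' (fun f a => (f a).val) (fun F a => (F a : ZMod k))
    · intro f hf
      simp only [CSet, Finset.coe_filter, Finset.mem_filter, Finset.mem_univ, true_and,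
        Set.mem_ofPred_eq] at hf
      rw [Finset.mem_coe, mem_LSet]
      refine ⟨fun i => ZMod.val_lt _, by simp [hf.2], fun i => ?_⟩
      rw [← CBad_iff_LBad w J j k f hf.2]
      exact hf.1 i
    · intro F hF
      rw [Finset.mem_coe, mem_LSet] at hF
      simp only [CSet, Finset.coe_filter, Finset.mem_filter, Finset.mem_univ, true_and,
        Set.mem_ofPred_eq]
      have h0 : ((F j : ℕ) : ZMod k) = 0 := by simp [hF.2.1]
      refine ⟨fun i => ?_, h0⟩
      rw [CBad_iff_LBad w J j k _ h0]
      have : (fun a => ((F a : ℕ) : ZMod k).val) = F := by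
        funext a; exact ZMod.val_natCast_of_lt (hF.1 a)
      rw [this]
      exact hF.2.2 i
    · intro f hf
      funext a; simp
    · intro F hF
      rw [Finset.mem_coe, mem_LSet] at hF
      funext a; exact ZMod.val_natCast_of_lt (hF.1 a)
  have h2 : ∀ c : ZMod k, ((CSet w J k).filter (fun f => f j = c)).card =
      ((CSet w J k).filter (fun f => f j = 0)).card := by
    intro c
    apply Finset.card_nbij' (fun f a => f a + (-c)) (fun f a => f a + c)
    · intro f hf
      simp only [CSet, Finset.coe_filter, Finset.mem_filter, Finset.mem_univ, true_and,
        Set.mem_ofPred_eq] at hf ⊢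
      exact ⟨fun i => by rw [CBad_shift]; exact hf.1 i, by rw [hf.2]; ring⟩
    · intro f hf
      simp only [CSet, Finset.coe_filter, Finset.mem_filter, Finset.mem_univ, true_and,
        Set.mem_ofPred_eq] at hf ⊢
      exact ⟨fun i => by rw [CBad_shift]; exact hf.1 i, by rw [hf.2]; ring⟩
    · intro f hf; funext a; simp
    · intro f hf; funext a; simp
  rw [Finset.card_eq_sum_card_fiberwise (f := fun f => f j) (t := univ) (fun _ _ => by simp)]
  simp only [h2, h1, Finset.sum_const, Finset.card_univ, ZMod.card, smul_eq_mul]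

end

lemma LSet_base {ι : Type*} [Fintype ι] [DecidableEq ι] (w : ι → ℕ) (J : Finset ι) (j j' : ι) (k : ℕ) :
    (LSet w J j k).card = (LSet w J j' k).card := by
  rcases Nat.eq_zero_or_pos k with rfl | hk
  · have : ∀ j, LSet w J j 0 = ∅ := by
      intro j
      ext F
      rw [mem_LSet]
      simp only [Nat.not_lt_zero, Finset.notMem_empty, iff_false]
      exact fun h => h.1 j
    rw [this, this]
  · have : NeZero k := ⟨hk.ne'⟩
    have h1 := CSet_card w J j k
    rw [CSet_card w J j' k] at h1
    exact (Nat.eq_of_mul_eq_mul_left hk h1).symm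

/-- the term of the alternating sum -/
def term {ι : Type*} [Fintype ι] (w : ι → ℕ) (k : ℕ) (S : Finset ι) : ℤ :=
  (-1) ^ S.card * (if ∑ a ∈ S, w a < k then
    ((k : ℤ) - ((∑ a ∈ S, w a : ℕ) : ℤ)) ^ (Fintype.card ι - 1) else 0)

lemma LSet_empty {ι : Type*} [Fintype ι] [DecidableEq ι] (w : ι → ℕ) (j : ι) (k : ℕ) :
    ((LSet w ∅ j k).card : ℤ) = term w k ∅ := by
  have h : LSet w ∅ j k = if 0 < k then
      Fintype.piFinset (fun i => if i = j then {0} else range k) else ∅ := by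
    ext F
    rw [mem_LSet]
    have hb : ∀ i, ¬ LBad w ∅ k F i := by
      rintro i ⟨h, -⟩
      have := h ((mem_blk F i i).2 rfl)
      simp at this
    simp only [hb, not_false_eq_true, implies_true, and_true]
    split_ifs with hk
    · rw [Fintype.mem_piFinset]
      constructor
      · rintro ⟨h1, h2⟩ i
        split_ifs with hi
        · simp [hi, h2]
        · simp [h1]
      · intro h
        have hj : F j = 0 := by have := h j; simpa using this
        refine ⟨fun i => ?_, hj⟩
        have := h i
        split_ifs at this with hi
        · rw [hi, hj]; exact hk
        · simpa using this
    · simp only [Finset.notMem_empty, iff_false]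
      rintro ⟨h1, -⟩
      have := h1 j
      omega
  rw [h]
  unfold term
  split_ifs with h1 h2 h2
  · rw [Fintype.card_piFinset, ← Finset.mul_prod_erase univ _ (Finset.mem_univ j)]
    rw [Finset.prod_congr rfl (g := fun _ => k)]
    · simp [Finset.card_erase_of_mem]
    · intro i hi
      simp [Finset.ne_of_mem_erase hi]
  · simp at h2; omega
  · simp at h2; omega
  · simp

lemma LSet_formula {ι : Type*} [Fintype ι] [DecidableEq ι] (w : ι → ℕ) (hw : ∀ i, 0 < w i)
    (hcard : ∀ j : ι, ∃ i, i ≠ j) (J : Finset ι) :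
    ∀ (j : ι) (k : ℕ), ((LSet w J j k).card : ℤ) = ∑ S ∈ J.powerset, term w k S := by
  induction J using Finset.induction_on with
  | empty => intro j k; rw [LSet_empty]; simp
  | insert a J ha ih =>
    intro j k
    rw [LSet_base w _ j a, Finset.sum_powerset_insert ha, ← ih a k]
    have h := LSet_rec w hw J a ha k (hcard a)
    have h2 : ∑ S ∈ J.powerset, term w k (insert a S) = - ((LSet w J a (k - w a)).card : ℤ) := by
      rw [ih a (k - w a), ← Finset.sum_neg_distrib]
      apply Finset.sum_congr rfl
      intro S hS
      have haS : a ∉ S := fun h => ha (Finset.mem_powerset.1 hS h)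
      unfold term
      rw [Finset.sum_insert haS, Finset.card_insert_of_notMem haS]
      by_cases hlt : w a + ∑ x ∈ S, w x < k
      · rw [if_pos hlt, if_pos (by omega), Nat.cast_sub (by omega)]
        push_cast
        ring
      · rw [if_neg hlt, if_neg (by omega)]; simp
    rw [h2, h]
    push_cast
    ring

/-- Core count. -/
lemma CSet_formula {ι : Type*} [Fintype ι] [DecidableEq ι] [Nonempty ι] (w : ι → ℕ)
    (hw : ∀ i, 0 < w i) (k : ℕ) [NeZero k] (hk : k < ∑ i, w i) :
    ((CSet w univ k).card : ℤ) = k * ∑ S : Finset ι, term w k S := by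
  obtain ⟨j⟩ := ‹Nonempty ι›
  rw [CSet_card w univ j k]
  push_cast
  congr 1
  by_cases hcard : ∀ j : ι, ∃ i, i ≠ j
  · rw [LSet_formula w hw hcard]; simp
  · push Not at hcard
    obtain ⟨a, ha⟩ := hcard
    obtain rfl : j = a := ha j
    have hu : (univ : Finset ι) = {j} := by
      ext i; simp [ha i]
    have hL : LSet w univ j k = LSet w ∅ j k := by
      ext F
      rw [mem_LSet, mem_LSet]
      apply and_congr Iff.rfl
      apply and_congr Iff.rfl
      apply forall_congr'
      intro i
      apply not_congr
      have hb : blk F i = univ := by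
        ext a; simp [mem_blk, ha a, ha i]
      unfold LBad
      rw [hb]
      constructor
      · rintro ⟨-, h, -⟩; omega
      · rintro ⟨h, -⟩
        have := h (Finset.mem_univ j)
        simp at this
    rw [hL, LSet_empty]
    have : (univ : Finset (Finset ι)) = insert univ {∅} := by
      ext S
      simp only [Finset.mem_univ, Finset.mem_insert, Finset.mem_singleton, true_iff]
      rw [or_comm, hu]
      exact Finset.subset_singleton_iff.1 (by rw [← hu]; exact Finset.subset_univ _)
    rw [this, Finset.sum_insert (by rw [hu]; simp)]
    have ht : term w k univ = 0 := by
      unfold term; rw [if_neg (by omega)]; simp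
    rw [ht]; simp

end HypS

namespace HypS
section
variable {ι : Type*} [Fintype ι] [DecidableEq ι] (s : ι → ℕ)

/-- gcd of all the sizes -/
noncomputable def gg : ℕ := ((univ : Finset ι).gcd (fun i => (s i : ℤ))).natAbs

lemma gg_dvd (i : ι) : gg s ∣ s i := by
  have h : (univ : Finset ι).gcd (fun i => (s i : ℤ)) ∣ (s i : ℤ) := Finset.gcd_dvd (mem_univ i)
  rw [← Int.natAbs_dvd_natAbs] at h
  simpa [gg] using h

lemma gg_bezout : ∃ b : ι → ℤ, ((gg s : ℕ) : ℤ) = ∑ i, b i * (s i : ℤ) := by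
  obtain ⟨b, hb⟩ := Finset.gcd_eq_sum_mul (univ : Finset ι) (fun i => (s i : ℤ))
  rcases Int.natAbs_eq ((univ : Finset ι).gcd (fun i => (s i : ℤ))) with h | h
  · exact ⟨b, by unfold gg; rw [← h, hb]; exact Finset.sum_congr rfl (fun i _ => mul_comm _ _)⟩
  · refine ⟨fun i => - b i, ?_⟩
    unfold gg
    simp only [neg_mul, Finset.sum_neg_distrib, mul_comm (b _)]
    rw [← hb]; linarith

lemma gg_smul_iff (k : ℕ) (τ : ZMod k) : (∀ i, (s i : ZMod k) * τ = 0) ↔ gg s • τ = 0 := by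
  constructor
  · intro h
    obtain ⟨b, hb⟩ := gg_bezout s
    have h2 : ((gg s : ℕ) : ZMod k) = ∑ i, (b i : ZMod k) * (s i : ZMod k) := by
      have := congrArg (fun z : ℤ => (z : ZMod k)) hb
      simpa using this
    rw [nsmul_eq_mul, h2, Finset.sum_mul]
    apply Finset.sum_eq_zero
    intro i _
    rw [mul_assoc, h, mul_zero]
  · intro h i
    obtain ⟨c, hc⟩ := gg_dvd s i
    rw [nsmul_eq_mul] at h
    rw [hc]; push_cast
    rw [mul_right_comm, h, zero_mul]

lemma card_tau (k : ℕ) [NeZero k] :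
    ((univ : Finset (ZMod k)).filter (fun τ => ∀ i, (s i : ZMod k) * τ = 0)).card = k.gcd (gg s) := by
  have h := IsAddCyclic.card_nsmulAddMonoidHom_ker (ZMod k) (gg s)
  rw [Nat.card_zmod] at h
  rw [← h]
  simp only [gg_smul_iff]
  rw [← Fintype.card_subtype, ← Nat.card_eq_fintype_card]
  rfl

/-- linear form -/
def lin (a : ℕ) : (ι → ZMod a) →+ ZMod a where
  toFun v := ∑ i, (s i : ZMod a) * v i
  map_zero' := by simp
  map_add' := by intro x y; simp [mul_add, Finset.sum_add_distrib]

lemma lin_range (a : ℕ) : (lin s a).range = (nsmulAddMonoidHom (gg s) : ZMod a →+ ZMod a).range := by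
  ext x
  simp only [AddMonoidHom.mem_range]
  constructor
  · rintro ⟨v, rfl⟩
    choose c hc using gg_dvd s
    refine ⟨∑ i, (c i : ZMod a) * v i, ?_⟩
    simp only [nsmulAddMonoidHom_apply, lin, AddMonoidHom.coe_mk, ZeroHom.coe_mk, nsmul_eq_mul]
    rw [Finset.mul_sum]
    apply Finset.sum_congr rfl
    intro i _
    conv_rhs => rw [hc i]
    push_cast; ring
  · rintro ⟨y, rfl⟩
    obtain ⟨b, hb⟩ := gg_bezout s
    have h2 : ((gg s : ℕ) : ZMod a) = ∑ i, (b i : ZMod a) * (s i : ZMod a) := by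
      have := congrArg (fun z : ℤ => (z : ZMod a)) hb
      simpa using this
    refine ⟨fun i => b i * y, ?_⟩
    simp only [nsmulAddMonoidHom_apply, lin, AddMonoidHom.coe_mk, ZeroHom.coe_mk, nsmul_eq_mul]
    rw [h2, Finset.sum_mul]
    apply Finset.sum_congr rfl
    intro i _
    ring

lemma lin_ker [Nonempty ι] (a : ℕ) [NeZero a] :
    Nat.card (lin s a).ker = a.gcd (gg s) * a ^ (Fintype.card ι - 1) := by
  have h1 := AddSubgroup.card_mul_index (lin s a).ker
  rw [AddSubgroup.index_ker, lin_range] at h1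
  have h2 := IsAddCyclic.card_nsmulAddMonoidHom_range (ZMod a) (gg s)
  rw [Nat.card_zmod] at h2
  rw [h2] at h1
  have h3 : Nat.card (ι → ZMod a) = a ^ (Fintype.card ι - 1) * a := by
    rw [Nat.card_fun, Nat.card_zmod, Nat.card_eq_fintype_card, ← pow_succ]
    congr 1
    have := Fintype.card_pos (α := ι)
    omega
  rw [h3] at h1
  have ha : 0 < a := Nat.pos_of_ne_zero (NeZero.ne a)
  have hd := Nat.gcd_dvd_left a (gg s)
  have hg : 0 < a / a.gcd (gg s) := Nat.div_pos (Nat.le_of_dvd ha hd) (Nat.gcd_pos_of_pos_left _ ha)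
  apply Nat.eq_of_mul_eq_mul_right hg
  rw [h1]
  calc a ^ (Fintype.card ι - 1) * a = a ^ (Fintype.card ι - 1) * (a.gcd (gg s) * (a / a.gcd (gg s))) := by
        rw [Nat.mul_div_cancel' hd]
    _ = _ := by ring

lemma count_v [Nonempty ι] (a : ℕ) [NeZero a] (S : Finset ι) :
    ((Fintype.piFinset (fun _ : ι => range a)).filter
      (fun v => a ∣ ∑ i ∈ S, s i + ∑ i, s i * v i)).card = a.gcd (gg s) * a ^ (Fintype.card ι - 1) := by
  rw [← lin_ker]
  have hker : Nat.card (lin s a).ker = (univ.filter (fun v : ι → ZMod a => lin s a v = 0)).card := by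
    rw [← Fintype.card_subtype, ← Nat.card_eq_fintype_card]
    rfl
  rw [hker]
  have hS : ∀ v : ι → ZMod a, lin s a (fun i => v i + if i ∈ S then 1 else 0) =
      ∑ i ∈ S, (s i : ZMod a) + ∑ i, (s i : ZMod a) * v i := by
    intro v
    simp [lin, mul_add, Finset.sum_add_distrib, add_comm]
  apply Finset.card_nbij' (fun v i => ((v i : ℕ) : ZMod a) + if i ∈ S then 1 else 0)
    (fun u i => (u i - if i ∈ S then 1 else 0).val)
  · intro v hv
    simp only [Finset.coe_filter, Fintype.mem_piFinset, Finset.mem_range, Set.mem_ofPred_eq,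
      Finset.mem_univ, true_and] at hv ⊢
    rw [hS]
    have := (ZMod.natCast_eq_zero_iff _ _).2 hv.2
    push_cast at this
    exact this
  · intro u hu
    simp only [Finset.coe_filter, Fintype.mem_piFinset, Finset.mem_range, Set.mem_ofPred_eq,
      Finset.mem_univ, true_and] at hu ⊢
    refine ⟨fun i => ZMod.val_lt _, ?_⟩
    rw [← ZMod.natCast_eq_zero_iff]
    have := hS (fun i => u i - if i ∈ S then 1 else 0)
    simp only [sub_add_cancel] at this
    rw [show (fun i => u i) = u from rfl, hu] at this
    push_cast
    refine Eq.trans ?_ this.symm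
    simp
  · intro v hv
    simp only [Finset.coe_filter, Fintype.mem_piFinset, Finset.mem_range, Set.mem_ofPred_eq] at hv
    funext i
    simp only [add_sub_cancel_right]
    exact ZMod.val_natCast_of_lt (hv.1 i)
  · intro u hu
    funext i
    simp

open PowerSeries in
lemma exists_P (hs : ∀ i, 0 < s i) : ∃ P : ℤ⟦X⟧, P * ∏ i, (1 - X ^ s i) = 1 := by
  refine ⟨invOfUnit (∏ i, (1 - X ^ s i)) 1, ?_⟩
  rw [mul_comm]
  apply mul_invOfUnit
  rw [map_prod]
  simp only [map_sub, map_one, map_pow, constantCoeff_X, Units.val_one]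
  apply Finset.prod_eq_one
  intro i _
  simp [(hs i).ne']

open PowerSeries in
lemma prod_geom (P : ℤ⟦X⟧) (hP : P * ∏ i, (1 - X ^ s i) = 1) (a : ℕ) :
    P * ∏ i, (1 - X ^ (a * s i)) =
      ∑ v ∈ Fintype.piFinset (fun _ : ι => range a), (X : ℤ⟦X⟧) ^ (∑ i, s i * v i) := by
  have h1 : ∀ i, (1 - (X : ℤ⟦X⟧) ^ (a * s i)) = (∑ v ∈ range a, X ^ (s i * v)) * (1 - X ^ s i) := by
    intro i
    have := geom_sum_mul_neg ((X : ℤ⟦X⟧) ^ s i) a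
    simp only [← pow_mul] at this
    rw [this, mul_comm a]
  simp only [h1]
  rw [Finset.prod_mul_distrib, mul_left_comm, hP, mul_one, Finset.prod_univ_sum]
  apply Finset.sum_congr rfl
  intro v _
  rw [Finset.prod_pow_eq_pow_sum]

open PowerSeries in
lemma prod_expand (a : ℕ) : ∏ i, (1 - (X : ℤ⟦X⟧) ^ (a * s i)) =
    ∑ S : Finset ι, (-1) ^ S.card * X ^ (a * ∑ i ∈ S, s i) := by
  simp only [sub_eq_add_neg]
  rw [Finset.prod_one_add, Finset.powerset_univ]
  apply Finset.sum_congr rfl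
  intro S _
  rw [Finset.prod_neg, Finset.prod_pow_eq_pow_sum, Finset.mul_sum]

/-- Section operator. -/
noncomputable def sec (a : ℕ) (φ : PowerSeries ℤ) : PowerSeries ℤ :=
  PowerSeries.mk fun d => PowerSeries.coeff (a * d) φ

open PowerSeries in
lemma sec_mul (a : ℕ) (ha : 0 < a) (φ : ℤ⟦X⟧) (m : ℕ) :
    sec a (φ * (1 - X ^ (a * m))) = sec a φ * (1 - X ^ m) := by
  ext d
  simp only [sec, mul_sub, mul_one, coeff_mk, map_sub, coeff_mul_X_pow']
  by_cases h : m ≤ d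
  · have h2 : a * m ≤ a * d := Nat.mul_le_mul_left a h
    rw [if_pos h, if_pos h2, Nat.mul_sub]
  · have h2 : ¬ a * m ≤ a * d := by
      intro h2; exact h (Nat.le_of_mul_le_mul_left h2 ha)
    rw [if_neg h, if_neg h2]

open PowerSeries in
lemma sec_prod (a : ℕ) (ha : 0 < a) (φ : ℤ⟦X⟧) (T : Finset ι) :
    sec a (φ * ∏ i ∈ T, (1 - X ^ (a * s i))) = sec a φ * ∏ i ∈ T, (1 - X ^ s i) := by
  induction T using Finset.induction_on with
  | empty => simp
  | insert j T hj ih =>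
    rw [Finset.prod_insert hj, Finset.prod_insert hj]
    rw [mul_comm (1 - X ^ (a * s j)), ← mul_assoc, sec_mul a ha, ih]
    ring

/-- polynomial for a subset -/
noncomputable def polS (a m : ℕ) : Polynomial ℤ :=
  ∑ v ∈ (Fintype.piFinset (fun _ : ι => range a)).filter (fun v => a ∣ m + ∑ i, s i * v i),
    Polynomial.X ^ ((m + ∑ i, s i * v i) / a)

open PowerSeries in
lemma sec_polS (P : ℤ⟦X⟧) (hP : P * ∏ i, (1 - X ^ s i) = 1) (a m : ℕ) (ha : 0 < a) :
    sec a (X ^ m * P) * ∏ i, (1 - X ^ s i) = ((polS s a m : Polynomial ℤ) : ℤ⟦X⟧) := by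
  rw [← sec_prod s a ha, mul_assoc, prod_geom s P hP, Finset.mul_sum]
  ext d
  simp only [sec, coeff_mk, polS, Polynomial.coeff_coe, Polynomial.finsetSum_coeff, ← pow_add,
    map_sum, coeff_X_pow, Polynomial.coeff_X_pow]
  rw [Finset.sum_filter]
  apply Finset.sum_congr rfl
  intro v _
  by_cases h : a ∣ m + ∑ i, s i * v i
  · rw [if_pos h]
    obtain ⟨c, hc⟩ := h
    rw [hc, Nat.mul_div_cancel_left _ ha]
    simp [ha.ne']
  · rw [if_neg h, if_neg]
    intro h2
    exact h ⟨d, h2.symm⟩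

/-- the total polynomial -/
noncomputable def polT (k : ℕ) : Polynomial ℤ :=
  ∑ S : Finset ι, (-1) ^ S.card *
    (if ∑ i ∈ S, s i < k then polS s (k - ∑ i ∈ S, s i) (∑ i ∈ S, s i) else 0)

open PowerSeries in
lemma ehrhart (hs : ∀ i, 0 < s i) (k : ℕ) (hk : 0 < k) :
    (PowerSeries.mk fun d => ((((Fintype.piFinset (fun _ : ι => range (d + 1))).filter
      (fun v => ∑ i, s i * v i = k * d)).card : ℕ) : ℤ)) * ∏ i, (1 - X ^ s i) =
      ((polT s k : Polynomial ℤ) : ℤ⟦X⟧) := by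
  obtain ⟨P, hP⟩ := exists_P s hs
  have h1 : (PowerSeries.mk fun d => ((((Fintype.piFinset (fun _ : ι => range (d + 1))).filter
      (fun v => ∑ i, s i * v i = k * d)).card : ℕ) : ℤ)) =
      ∑ S : Finset ι, (-1) ^ S.card *
        (if ∑ i ∈ S, s i < k then sec (k - ∑ i ∈ S, s i) (X ^ (∑ i ∈ S, s i) * P) else 0) := by
    ext d
    have h2 : ((((Fintype.piFinset (fun _ : ι => range (d + 1))).filter
      (fun v => ∑ i, s i * v i = k * d)).card : ℕ) : ℤ) =
        coeff (k * d) (P * ∏ i, (1 - X ^ ((d + 1) * s i))) := by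
      rw [prod_geom s P hP, map_sum]
      simp only [coeff_X_pow]
      rw [Finset.card_filter]
      push_cast
      apply Finset.sum_congr rfl
      intro v _
      simp [eq_comm]
    rw [coeff_mk, h2, prod_expand, Finset.mul_sum, map_sum, map_sum]
    apply Finset.sum_congr rfl
    intro S _
    have hc : ((-1 : ℤ⟦X⟧)) ^ S.card = C ((-1 : ℤ) ^ S.card) := by simp
    rw [hc, mul_left_comm, coeff_C_mul, coeff_C_mul]
    congr 1
    generalize ∑ i ∈ S, s i = m
    rw [coeff_mul_X_pow']
    by_cases hm : m < k
    · obtain ⟨a, rfl⟩ := Nat.exists_eq_add_of_lt hm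
      rw [if_pos hm]
      simp only [sec, coeff_mk, coeff_X_pow_mul']
      have e : m + a + 1 - m = a + 1 := by omega
      rw [e]
      have e2 : (m + a + 1) * d = m * d + (a + 1) * d := by ring
      have e3 : (d + 1) * m = m * d + m := by ring
      rw [e2, e3]
      by_cases h : m ≤ (a + 1) * d
      · rw [if_pos h, if_pos (by omega)]
        congr 2
        omega
      · rw [if_neg h, if_neg (by omega)]
    · rw [if_neg hm, if_neg]
      · simp
      · push Not at hm ⊢
        have := Nat.mul_le_mul_left d hm
        have e1 : k * d = d * k := by ring
        have e2 : (d + 1) * m = d * m + m := by ring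
        omega
  rw [h1, Finset.sum_mul, polT]
  have hcoe : ∀ (f : Finset ι → Polynomial ℤ), ((∑ S : Finset ι, f S : Polynomial ℤ) : ℤ⟦X⟧) =
      ∑ S : Finset ι, ((f S : Polynomial ℤ) : ℤ⟦X⟧) := by
    intro f
    exact map_sum (Polynomial.coeToPowerSeries.ringHom (R := ℤ)) f univ
  rw [hcoe]
  apply Finset.sum_congr rfl
  intro S _
  rw [mul_assoc]
  push_cast
  congr 1
  split_ifs with h
  · rw [sec_polS s P hP _ _ (by omega)]
  · simp

lemma polT_eval [Nonempty ι] (k : ℕ) :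
    (polT s k).eval 1 = (k.gcd (gg s) : ℤ) * ∑ S : Finset ι, term s k S := by
  rw [polT, Polynomial.eval_finsetSum, Finset.mul_sum]
  apply Finset.sum_congr rfl
  intro S _
  rw [Polynomial.eval_mul, term]
  split_ifs with h
  · have : NeZero (k - ∑ i ∈ S, s i) := ⟨by omega⟩
    have h1 : (polS s (k - ∑ i ∈ S, s i) (∑ i ∈ S, s i)).eval 1 =
        (((k - ∑ i ∈ S, s i).gcd (gg s) * (k - ∑ i ∈ S, s i) ^ (Fintype.card ι - 1) : ℕ) : ℤ) := by
      rw [← count_v s _ S, polS, Polynomial.eval_finsetSum]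
      simp
    have h2 : (k - ∑ i ∈ S, s i).gcd (gg s) = k.gcd (gg s) := by
      have hd : gg s ∣ ∑ i ∈ S, s i := Finset.dvd_sum (fun i _ => gg_dvd s i)
      obtain ⟨c, hc⟩ := hd
      rw [hc] at h ⊢
      rw [Nat.gcd_comm, Nat.gcd_comm k, Nat.gcd_sub_mul_left_right]
      omega
    rw [h1, h2]
    push_cast [Nat.cast_sub h.le]
    simp
    ring
  · simp

end
end HypS

namespace HypS

/-- size of the fibre -/
def sz {n : ℕ} {ι : Type*} [DecidableEq ι] (p : Fin n → ι) (i : ι) : ℕ :=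
  (univ.filter (fun x => p x = i)).card

/-- twisted functions -/
def Tw {n k : ℕ} (σ : Equiv.Perm (Fin n)) (τ : ZMod k) (f : Fin n → ZMod k) : Prop :=
  ∀ x, f (σ⁻¹ x) = f x + τ

section
variable {n k : ℕ} (σ : Equiv.Perm (Fin n)) {ι : Type*} [Fintype ι] [DecidableEq ι]
  (p : Fin n → ι) (hp : ∀ x y, p x = p y ↔ σ.SameCycle x y)
  (rep : ι → Fin n) (hrep : ∀ i, p (rep i) = i)

include hrep in
lemma sz_pos (i : ι) : 0 < sz p i :=
  Finset.card_pos.2 ⟨rep i, by simp [hrep]⟩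

lemma sum_sz : ∑ i, sz p i = n := by
  have := Finset.card_eq_sum_card_fiberwise (f := p) (s := univ) (t := univ) (fun _ _ => by simp)
  simpa [sz] using this.symm

lemma sum_comp_p (v : ι → ℕ) : ∑ a, v (p a) = ∑ i, sz p i * v i := by
  rw [← Finset.sum_fiberwise_of_maps_to (s := univ) (t := univ) (g := p) (fun _ _ => by simp)]
  apply Finset.sum_congr rfl
  intro i _
  rw [Finset.sum_congr rfl (g := fun _ => v i)]
  · simp [sz]
  · intro x hx; simp at hx; rw [hx]

include hp in
lemma p_sigma (x : Fin n) : p (σ x) = p x := by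
  rw [hp]; exact ⟨-1, by simp⟩

include hp in
lemma const_of_inv {α : Type*} (f : Fin n → α) (hf : ∀ i, f (σ i) = f i) (x y : Fin n)
    (h : p x = p y) : f x = f y := by
  have h1 : ∀ (m : ℕ) x, f ((σ ^ m) x) = f x := by
    intro m
    induction m with
    | zero => simp
    | succ m ih => intro x; rw [pow_succ, Equiv.Perm.mul_apply, ih, hf]
  rw [hp] at h
  obtain ⟨m, -, -, hm⟩ := h.exists_pow_eq
  rw [← hm, h1]

include hp hrep in
lemma fixedPtCount_eq (d : ℕ) : fixedPtCount k σ d =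
    ((Fintype.piFinset (fun _ : ι => range (d + 1))).filter
      (fun v => ∑ i, sz p i * v i = k * d)).card := by
  unfold fixedPtCount
  apply Finset.card_nbij' (fun x i => (x (rep i) : ℕ)) (fun v a => Fin.ofNat (d + 1) (v (p a)))
  · intro x hx
    simp only [Finset.coe_filter, Fintype.mem_piFinset, Finset.mem_range, Set.mem_ofPred_eq,
      Finset.mem_univ, true_and] at hx ⊢
    refine ⟨fun i => (x (rep i)).2, ?_⟩
    rw [← sum_comp_p p (fun i => (x (rep i) : ℕ)), ← hx.1]
    apply Finset.sum_congr rfl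
    intro a _
    rw [const_of_inv σ p hp x hx.2 (rep (p a)) a (hrep _)]
  · intro v hv
    simp only [Finset.coe_filter, Fintype.mem_piFinset, Finset.mem_range, Set.mem_ofPred_eq,
      Finset.mem_univ, true_and] at hv ⊢
    constructor
    · rw [← hv.2, ← sum_comp_p p v]
      apply Finset.sum_congr rfl
      intro a _
      simp [Nat.mod_eq_of_lt (hv.1 (p a))]
    · intro i; rw [p_sigma σ p hp]
  · intro x hx
    simp only [Finset.coe_filter, Set.mem_ofPred_eq, Finset.mem_univ, true_and] at hx
    funext a
    simp only
    rw [const_of_inv σ p hp x hx.2 (rep (p a)) a (hrep _)]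
    simp
  · intro v hv
    simp only [Finset.coe_filter, Fintype.mem_piFinset, Finset.mem_range, Set.mem_ofPred_eq] at hv
    funext i
    simp [Nat.mod_eq_of_lt (hv.1 i), hrep]

include hp hrep in
lemma zpow_dvd (i : ι) (m : ℤ) : (σ ^ m) (rep i) = rep i ↔ (sz p i : ℤ) ∣ m := by
  classical
  have h := MulAction.zpow_smul_eq_iff_minimalPeriod_dvd (a := σ) (b := rep i) (n := m)
  rw [MulAction.minimalPeriod_eq_card, Equiv.Perm.smul_def] at h
  rw [h]
  have : Fintype.card (MulAction.orbit (Subgroup.zpowers σ) (rep i)) = sz p i := by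
    rw [sz, ← Fintype.card_subtype]
    apply Fintype.card_congr
    apply Equiv.subtypeEquivRight
    intro x
    rw [MulAction.mem_orbit_iff]
    constructor
    · rintro ⟨⟨g, ⟨m, rfl⟩⟩, rfl⟩
      conv_rhs => rw [← hrep i]
      rw [hp]
      exact Equiv.Perm.SameCycle.symm ⟨m, rfl⟩
    · intro hx
      rw [← hrep i, eq_comm, hp] at hx
      obtain ⟨m, hm⟩ := hx
      exact ⟨⟨σ ^ m, m, rfl⟩, hm⟩
  rw [this]

lemma Tw_sigma {τ : ZMod k} {f : Fin n → ZMod k} (hf : Tw σ τ f) (x : Fin n) : f (σ x) = f x - τ := by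
  have := hf (σ x)
  simp at this
  rw [this]; ring

lemma Tw_zpow {τ : ZMod k} {f : Fin n → ZMod k} (hf : Tw σ τ f) (m : ℤ) :
    ∀ x, f ((σ ^ m) x) = f x - m * τ := by
  induction m using Int.induction_on with
  | zero => simp
  | succ m ih =>
    intro x
    rw [zpow_add_one, Equiv.Perm.mul_apply, ih, Tw_sigma σ hf]; push_cast; ring
  | pred m ih =>
    intro x
    rw [zpow_sub_one, Equiv.Perm.mul_apply, ih, hf]; push_cast; ring

include hp hrep in
lemma Tw_mul {τ : ZMod k} {f : Fin n → ZMod k} (hf : Tw σ τ f) (i : ι) : (sz p i : ZMod k) * τ = 0 := by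
  have h1 := (zpow_dvd σ p hp rep hrep i (sz p i)).2 dvd_rfl
  have h2 := Tw_zpow σ hf (sz p i) (rep i)
  rw [h1] at h2
  push_cast at h2
  linear_combination h2

include hp hrep in
lemma exists_Tw {τ : ZMod k} (hτ : ∀ i, (sz p i : ZMod k) * τ = 0) (h : ι → ZMod k) :
    ∃ f : Fin n → ZMod k, Tw σ τ f ∧ ∀ i, f (rep i) = h i := by
  have h1 : ∀ x, ∃ m : ℤ, (σ ^ m) (rep (p x)) = x := by
    intro x
    exact (hp _ _).1 (hrep (p x))
  choose m hm using h1
  have key : ∀ i (a b : ℤ), (σ ^ a) (rep i) = (σ ^ b) (rep i) → (a : ZMod k) * τ = b * τ := by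
    intro i a b hab
    have h2 : (σ ^ (a - b)) (rep i) = rep i := by
      rw [sub_eq_neg_add, zpow_add, Equiv.Perm.mul_apply, hab, ← Equiv.Perm.mul_apply, ← zpow_add]
      simp
    rw [zpow_dvd σ p hp rep hrep] at h2
    obtain ⟨c, hc⟩ := h2
    have h3 : (a : ZMod k) - b = sz p i * c := by
      have := congrArg (fun z : ℤ => (z : ZMod k)) hc
      simpa using this
    have h4 := hτ i
    linear_combination τ * h3 + c * h4
  refine ⟨fun x => h (p x) - m x * τ, ?_, ?_⟩
  · intro x
    have hpx : p (σ⁻¹ x) = p x := by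
      have := p_sigma σ p hp (σ⁻¹ x)
      simp at this
      exact this.symm
    simp only [hpx]
    have h2 := key (p x) (m (σ⁻¹ x)) (m x - 1) (by
      have := hm (σ⁻¹ x)
      rw [hpx] at this
      rw [this, sub_eq_neg_add, zpow_add, Equiv.Perm.mul_apply, hm]; simp)
    push_cast at h2
    linear_combination -h2
  · intro i
    have h2 := key i (m (rep i)) 0 (by
      have := hm (rep i)
      rw [hrep] at this
      rw [this]; simp)
    simp only [hrep]
    simp at h2
    rw [h2]; simp

include hp hrep in
lemma Tw_ext {τ : ZMod k} {f g : Fin n → ZMod k} (hf : Tw σ τ f) (hg : Tw σ τ g)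
    (h : ∀ i, f (rep i) = g (rep i)) : f = g := by
  funext x
  obtain ⟨m, hm⟩ := (hp _ _).1 (hrep (p x))
  rw [← hm, Tw_zpow σ hf, Tw_zpow σ hg, h]

lemma cast_eq_iff [NeZero k] (τ : ZMod k) (hd : k / addOrderOf τ ∣ k) (x y : ZMod k) :
    ZMod.castHom hd (ZMod (k / addOrderOf τ)) x = ZMod.castHom hd (ZMod (k / addOrderOf τ)) y ↔
      ∃ m : ℤ, x = y + m * τ := by
  have hk : 0 < k := Nat.pos_of_ne_zero (NeZero.ne k)
  have he : addOrderOf τ ∣ k := by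
    apply addOrderOf_dvd_of_nsmul_eq_zero
    simp
  have hepos : 0 < addOrderOf τ := Nat.pos_of_dvd_of_pos he hk
  set e := addOrderOf τ with hedef
  obtain ⟨q, hq⟩ := he
  have hke : k / e = q := by rw [hq, Nat.mul_div_cancel_left _ hepos]
  have hsub : AddSubgroup.zmultiples τ = (nsmulAddMonoidHom e : ZMod k →+ ZMod k).ker := by
    apply AddSubgroup.eq_of_le_of_card_ge
    · rw [AddSubgroup.zmultiples_le]
      rw [AddMonoidHom.mem_ker, nsmulAddMonoidHom_apply]
      exact addOrderOf_nsmul_eq_zero τ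
    · rw [IsAddCyclic.card_nsmulAddMonoidHom_ker, Nat.card_zmultiples, Nat.card_zmod, ← hedef]
      exact Nat.gcd_le_right _ hepos
  have h1 : (∃ m : ℤ, x = y + m * τ) ↔ e • (x - y) = 0 := by
    rw [← nsmulAddMonoidHom_apply, ← AddMonoidHom.mem_ker, ← hsub, AddSubgroup.mem_zmultiples_iff]
    constructor
    · rintro ⟨m, hm⟩; exact ⟨m, by rw [hm, zsmul_eq_mul]; ring⟩
    · rintro ⟨m, hm⟩; exact ⟨m, by rw [← zsmul_eq_mul, hm]; ring⟩
  rw [h1, ← sub_eq_zero, ← map_sub]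
  obtain ⟨z, hz⟩ := ZMod.intCast_surjective (x - y)
  rw [← hz, map_intCast, nsmul_eq_mul]
  have : ((e : ZMod k) * (z : ZMod k)) = ((((e : ℤ) * z) : ℤ) : ZMod k) := by push_cast; rfl
  rw [this, ZMod.intCast_zmod_eq_zero_iff_dvd, ZMod.intCast_zmod_eq_zero_iff_dvd, hke, hq]
  push_cast
  rw [mul_dvd_mul_iff_left (by exact_mod_cast hepos.ne')]

lemma fib_count [NeZero k] {τ : ZMod k} {f : Fin n → ZMod k} (hf : Tw σ τ f) (i : ι)
    (hps : ∀ x, p (σ x) = p x) (c : ZMod k) (m : ℤ) :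
    (univ.filter (fun x => p x = i ∧ f x = c + m * τ)).card =
    (univ.filter (fun x => p x = i ∧ f x = c)).card := by
  have hpm : ∀ (m : ℤ) x, p ((σ ^ m) x) = p x := by
    intro m
    induction m using Int.induction_on with
    | zero => simp
    | succ m ih => intro x; rw [zpow_add_one, Equiv.Perm.mul_apply, ih, hps]
    | pred m ih =>
      intro x
      rw [zpow_sub_one, Equiv.Perm.mul_apply, ih]
      have := hps (σ⁻¹ x)
      simp at this
      exact this.symm
  apply Finset.card_nbij' (fun x => (σ ^ m) x) (fun x => (σ ^ (-m)) x)
  · intro x hx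
    simp only [Finset.coe_filter, Set.mem_ofPred_eq, Finset.mem_univ, true_and] at hx ⊢
    rw [hpm, Tw_zpow σ hf, hx.2]
    exact ⟨hx.1, by ring⟩
  · intro x hx
    simp only [Finset.coe_filter, Set.mem_ofPred_eq, Finset.mem_univ, true_and] at hx ⊢
    rw [hpm, Tw_zpow σ hf, hx.2]
    exact ⟨hx.1, by push_cast; ring⟩
  · intro x _; simp
  · intro x _; simp

include hp hrep in
/-- The number of points of a fibre with given value. -/
lemma fib_card [NeZero k] {τ : ZMod k} {f : Fin n → ZMod k} (hf : Tw σ τ f)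
    (hd : k / addOrderOf τ ∣ k) (i : ι) (c : ZMod k) :
    (univ.filter (fun x => p x = i ∧ f x = c)).card =
      if ZMod.castHom hd (ZMod (k / addOrderOf τ)) (f (rep i)) =
        ZMod.castHom hd (ZMod (k / addOrderOf τ)) c then sz p i / addOrderOf τ else 0 := by
  have hk : 0 < k := Nat.pos_of_ne_zero (NeZero.ne k)
  have he : addOrderOf τ ∣ k := by
    apply addOrderOf_dvd_of_nsmul_eq_zero
    simp
  have hepos : 0 < addOrderOf τ := Nat.pos_of_dvd_of_pos he hk
  have hval : ∀ x, p x = i → ∃ m : ℤ, f x = f (rep i) + m * τ := by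
    intro x hx
    obtain ⟨m, hm⟩ := (hp (rep i) x).1 (by rw [hrep, hx])
    exact ⟨-m, by rw [← hm, Tw_zpow σ hf]; push_cast; ring⟩
  split_ifs with h
  · classical
    rw [cast_eq_iff] at h
    obtain ⟨m0, hm0⟩ := h
    have hps := p_sigma σ p hp
    have h1 : sz p i = ∑ c', (univ.filter (fun x => p x = i ∧ f x = c')).card := by
      rw [sz, Finset.card_eq_sum_card_fiberwise (f := f) (t := univ) (fun _ _ => by simp)]
      simp only [Finset.filter_filter]
    have h2 : ∀ c', (univ.filter (fun x => p x = i ∧ f x = c')).card =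
        if (∃ m : ℤ, c' = c + m * τ) then (univ.filter (fun x => p x = i ∧ f x = c)).card else 0 := by
      intro c'
      split_ifs with hc
      · obtain ⟨m, rfl⟩ := hc
        exact fib_count σ p hf i hps c m
      · rw [Finset.card_eq_zero, Finset.filter_eq_empty_iff]
        rintro x - ⟨hx, hxc⟩
        obtain ⟨m, hm⟩ := hval x hx
        apply hc
        exact ⟨m + m0, by rw [← hxc, hm, hm0]; push_cast; ring⟩
    have h3 : (univ.filter (fun c' => ∃ m : ℤ, c' = c + m * τ)).card = addOrderOf τ := by
      rw [← Nat.card_zmultiples, Nat.card_eq_fintype_card, Fintype.card_subtype]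
      apply Finset.card_nbij' (fun z => z - c) (fun z => z + c)
      · intro z hz
        simp only [Finset.coe_filter, Set.mem_ofPred_eq, Finset.mem_univ, true_and] at hz ⊢
        obtain ⟨m, rfl⟩ := hz
        exact ⟨m, by simp⟩
      · intro z hz
        simp only [Finset.coe_filter, Set.mem_ofPred_eq, Finset.mem_univ, true_and] at hz ⊢
        obtain ⟨m, rfl⟩ := hz
        exact ⟨m, by simp [add_comm]⟩
      · intro z _; simp
      · intro z _; simp
    rw [Finset.sum_congr rfl (fun c' _ => h2 c'), ← Finset.sum_filter, Finset.sum_const, h3,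
      smul_eq_mul] at h1
    rw [h1, Nat.mul_div_cancel_left _ hepos]
  · rw [Finset.card_eq_zero, Finset.filter_eq_empty_iff]
    rintro x - ⟨hx, hc⟩
    obtain ⟨m, hm⟩ := hval x hx
    apply h
    symm
    rw [cast_eq_iff]
    exact ⟨m, by rw [← hc, hm]⟩

end
end HypS

namespace HypS
section
variable {n k : ℕ}

lemma Hyp_iff [NeZero k] (f : Fin n → ZMod k) :
    Hypersimplicial f ↔ ∀ j, ¬ CBad (fun _ => 1) univ f j := by
  have hk : 0 < k := Nat.pos_of_ne_zero (NeZero.ne k)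
  have key : ∀ j, gapLen f (f j) < (univ.filter fun i => f i = f j).card ↔
      ¬ CBad (fun _ => 1) univ f j := by
    intro j
    have hb : ∑ a ∈ blk f j, 1 = (univ.filter fun i => f i = f j).card := by
      rw [Finset.sum_const, smul_eq_mul, mul_one]
      congr 1
      ext a; simp [mem_blk]
    unfold CBad
    rw [hb]
    generalize (univ.filter fun i => f i = f j).card = W
    have hne : {ℓ : ℕ | 1 ≤ ℓ ∧ ℓ ≤ k ∧ ∃ i, f i = f j + (ℓ : ZMod k)}.Nonempty :=
      ⟨k, hk, le_rfl, j, by simp⟩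
    constructor
    · rintro h ⟨-, h2⟩
      obtain ⟨h3, h4, i, hi⟩ := Nat.sInf_mem hne
      exact h2 _ h3 h i hi
    · intro h
      by_contra hc
      apply h
      refine ⟨Finset.subset_univ _, fun x hx1 hx2 i hi => hc ?_⟩
      by_cases hxk : x ≤ k
      · exact lt_of_le_of_lt (Nat.sInf_le ⟨hx1, hxk, i, hi⟩) hx2
      · exact lt_of_le_of_lt (Nat.sInf_le (m := k) ⟨hk, le_rfl, j, by simp⟩) (by omega)
  constructor
  · intro h j
    exact (key j).1 (h (f j) ⟨j, rfl⟩)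
  · rintro h c ⟨j, rfl⟩
    exact (key j).2 (h j)

variable (σ : Equiv.Perm (Fin n)) {ι : Type*} [Fintype ι] [DecidableEq ι]
  (p : Fin n → ι) (hp : ∀ x y, p x = p y ↔ σ.SameCycle x y)
  (rep : ι → Fin n) (hrep : ∀ i, p (rep i) = i)

include hp hrep in
lemma CBad_transfer [NeZero k] {τ : ZMod k} {f : Fin n → ZMod k} (hf : Tw σ τ f)
    (hd : k / addOrderOf τ ∣ k) :
    (∀ j, ¬ CBad (fun _ => 1) univ f j) ↔
      ∀ i, ¬ CBad (fun i => sz p i / addOrderOf τ) univ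
        (fun i => ZMod.castHom hd (ZMod (k / addOrderOf τ)) (f (rep i))) i := by
  have hk : 0 < k := Nat.pos_of_ne_zero (NeZero.ne k)
  have he : addOrderOf τ ∣ k := by
    apply addOrderOf_dvd_of_nsmul_eq_zero
    simp
  have hepos : 0 < addOrderOf τ := Nat.pos_of_dvd_of_pos he hk
  have hes : ∀ i, 0 < sz p i / addOrderOf τ := by
    intro i
    apply Nat.div_pos _ hepos
    apply Nat.le_of_dvd (sz_pos p rep hrep i)
    apply addOrderOf_dvd_of_nsmul_eq_zero
    rw [nsmul_eq_mul]
    exact Tw_mul σ p hp rep hrep hf i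
  set φ := ZMod.castHom hd (ZMod (k / addOrderOf τ)) with hφ
  have hpx : ∀ x, φ (f (rep (p x))) = φ (f x) := by
    intro x
    have h1 := fib_card σ p hp rep hrep hf hd (p x) (f x)
    by_contra hc
    rw [if_neg hc, Finset.card_eq_zero, Finset.filter_eq_empty_iff] at h1
    exact h1 (Finset.mem_univ x) ⟨rfl, rfl⟩
  have hocc : ∀ c, (∃ a, f a = c) ↔ ∃ i, φ (f (rep i)) = φ c := by
    intro c
    constructor
    · rintro ⟨a, rfl⟩
      exact ⟨p a, hpx a⟩
    · rintro ⟨i, hi⟩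
      have h1 := fib_card σ p hp rep hrep hf hd i c
      rw [if_pos hi] at h1
      have h2 := hes i
      rw [← h1, Finset.card_pos] at h2
      obtain ⟨a, ha⟩ := h2
      simp at ha
      exact ⟨a, ha.2⟩
  have hcount : ∀ x, ∑ a ∈ blk f x, 1 =
      ∑ i ∈ blk (fun i => φ (f (rep i))) (p x), sz p i / addOrderOf τ := by
    intro x
    rw [Finset.sum_const, smul_eq_mul, mul_one]
    rw [Finset.card_eq_sum_card_fiberwise (f := p) (t := univ) (fun _ _ => by simp)]
    have : ∀ i, ((blk f x).filter (fun a => p a = i)).card =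
        if φ (f (rep i)) = φ (f x) then sz p i / addOrderOf τ else 0 := by
      intro i
      rw [← fib_card σ p hp rep hrep hf hd i (f x)]
      congr 1
      ext a
      simp [mem_blk, and_comm]
    rw [Finset.sum_congr rfl (fun i _ => this i), ← Finset.sum_filter]
    apply Finset.sum_congr _ (fun _ _ => rfl)
    ext i
    simp [mem_blk, hpx]
  have key : ∀ x, CBad (fun _ => 1) univ f x ↔
      CBad (fun i => sz p i / addOrderOf τ) univ (fun i => φ (f (rep i))) (p x) := by
    intro x
    unfold CBad
    rw [hcount]
    simp only [Finset.subset_univ, true_and]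
    apply forall_congr'; intro y
    apply forall_congr'; intro _
    apply forall_congr'; intro _
    have h := hocc (f x + y)
    rw [← not_iff_not] at h
    push Not at h
    rw [h]
    simp [hpx]
  constructor
  · intro h i
    have := h (rep i)
    rw [key, hrep] at this
    exact this
  · intro h x
    rw [key]
    exact h (p x)

/-- counting lifts -/
lemma card_lift {κ α β : Type*} [Fintype κ] [DecidableEq κ] [Fintype α] [Fintype β] [DecidableEq β]
    (φ : α → β) (e : ℕ) (hφ : ∀ b, (univ.filter (fun a => φ a = b)).card = e) (A : Finset (κ → β)) :
    (univ.filter (fun h : κ → α => (fun i => φ (h i)) ∈ A)).card = e ^ Fintype.card κ * A.card := by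
  rw [Finset.card_eq_sum_card_fiberwise (f := fun h i => φ (h i)) (t := A)]
  · rw [Finset.sum_congr rfl (g := fun _ => e ^ Fintype.card κ)]
    · simp [mul_comm]
    · intro g hg
      have : ((univ.filter (fun h : κ → α => (fun i => φ (h i)) ∈ A)).filter
          (fun h => (fun i => φ (h i)) = g)) =
          Fintype.piFinset (fun i => univ.filter (fun a => φ a = g i)) := by
        ext h
        simp only [Finset.mem_filter, Finset.mem_univ, true_and, Fintype.mem_piFinset]
        constructor
        · rintro ⟨-, rfl⟩ i; rfl
        · intro hh
          have h2 : (fun i => φ (h i)) = g := funext hh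
          exact ⟨by rw [h2]; exact hg, h2⟩
      rw [this, Fintype.card_piFinset]
      simp [hφ]
  · intro h hh
    simpa using hh

lemma card_cast_fib [NeZero k] (q : ℕ) (hd : q ∣ k) (b : ZMod q) :
    (univ.filter (fun a => ZMod.castHom hd (ZMod q) a = b)).card = k / q := by
  have hk : 0 < k := Nat.pos_of_ne_zero (NeZero.ne k)
  have hq : 0 < q := Nat.pos_of_dvd_of_pos hd hk
  have : NeZero q := ⟨hq.ne'⟩
  have h1 : ∀ b : ZMod q, (univ.filter (fun a => ZMod.castHom hd (ZMod q) a = b)).card =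
      (univ.filter (fun a => ZMod.castHom hd (ZMod q) a = 0)).card := by
    intro b
    obtain ⟨c, rfl⟩ := ZMod.castHom_surjective hd b
    apply Finset.card_nbij' (fun a => a - c) (fun a => a + c)
    · intro a ha
      simp only [Finset.coe_filter, Set.mem_ofPred_eq, Finset.mem_univ, true_and] at ha ⊢
      rw [map_sub, ha, sub_self]
    · intro a ha
      simp only [Finset.coe_filter, Set.mem_ofPred_eq, Finset.mem_univ, true_and] at ha ⊢
      rw [map_add, ha, zero_add]
    · intro a _; simp
    · intro a _; simp
  have h2 := Finset.card_eq_sum_card_fiberwise (f := ZMod.castHom hd (ZMod q)) (s := univ)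
    (t := univ) (fun _ _ => by simp)
  rw [Finset.sum_congr rfl (fun b _ => h1 b)] at h2
  simp only [Finset.card_univ, ZMod.card, Finset.sum_const, smul_eq_mul] at h2
  rw [h1]
  exact (Nat.div_eq_of_eq_mul_right hq h2).symm

include hp hrep in
open Classical in
lemma card_Tw [Nonempty ι] [NeZero k] (hkn : k < n) (τ : ZMod k)
    (hτ : ∀ i, (sz p i : ZMod k) * τ = 0) :
    ((univ.filter (fun f : Fin n → ZMod k => Tw σ τ f ∧ Hypersimplicial f)).card : ℤ) =
      k * ∑ S : Finset ι, term (sz p) k S := by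
  have hk : 0 < k := Nat.pos_of_ne_zero (NeZero.ne k)
  have he : addOrderOf τ ∣ k := by
    apply addOrderOf_dvd_of_nsmul_eq_zero
    simp
  have hepos : 0 < addOrderOf τ := Nat.pos_of_dvd_of_pos he hk
  have hd : k / addOrderOf τ ∣ k := Nat.div_dvd_of_dvd he
  have hq : 0 < k / addOrderOf τ := Nat.pos_of_dvd_of_pos hd hk
  have : NeZero (k / addOrderOf τ) := ⟨hq.ne'⟩
  have hes : ∀ i, addOrderOf τ ∣ sz p i := by
    intro i
    apply addOrderOf_dvd_of_nsmul_eq_zero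
    rw [nsmul_eq_mul]
    exact hτ i
  have h1 : (univ.filter (fun f : Fin n → ZMod k => Tw σ τ f ∧ Hypersimplicial f)).card =
      (univ.filter (fun h : ι → ZMod k => (fun i => ZMod.castHom hd (ZMod (k / addOrderOf τ)) (h i)) ∈
        CSet (fun i => sz p i / addOrderOf τ) univ (k / addOrderOf τ))).card := by
    apply Finset.card_nbij (fun f i => f (rep i))
    · intro f hf
      simp only [Finset.coe_filter, Set.mem_ofPred_eq, Finset.mem_univ, true_and, CSet,
        Finset.mem_filter] at hf ⊢
      rw [Hyp_iff, CBad_transfer σ p hp rep hrep hf.1 hd] at hf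
      exact hf.2
    · intro f hf g hg hfg
      simp only [Finset.coe_filter, Set.mem_ofPred_eq, Finset.mem_univ, true_and] at hf hg
      exact Tw_ext σ p hp rep hrep hf.1 hg.1 (fun i => congrFun hfg i)
    · intro h hh
      obtain ⟨f, hf, hfh⟩ := exists_Tw σ p hp rep hrep hτ h
      refine ⟨f, ?_, funext hfh⟩
      simp only [Finset.coe_filter, Set.mem_ofPred_eq, Finset.mem_univ, true_and, CSet,
        Finset.mem_filter] at hh ⊢
      refine ⟨hf, ?_⟩
      rw [Hyp_iff, CBad_transfer σ p hp rep hrep hf hd]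
      simp only [hfh]
      exact hh
  rw [h1, card_lift _ _ (card_cast_fib _ hd), Nat.div_div_self he hk.ne']
  push_cast
  rw [CSet_formula]
  · generalize hee : addOrderOf τ = e at *
    obtain ⟨q, rfl⟩ := he
    choose w hw using hes
    have hdiv : e * q / e = q := Nat.mul_div_cancel_left _ hepos
    have hwi : (fun i => sz p i / e) = w := by
      funext i; rw [hw, Nat.mul_div_cancel_left _ hepos]
    rw [hdiv, hwi, Finset.mul_sum, Finset.mul_sum, Finset.mul_sum]
    apply Finset.sum_congr rfl
    intro S _
    unfold term
    have hsum : ∑ a ∈ S, sz p a = e * ∑ a ∈ S, w a := by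
      rw [Finset.mul_sum]; exact Finset.sum_congr rfl (fun i _ => hw i)
    rw [hsum]
    have hc : Fintype.card ι = (Fintype.card ι - 1) + 1 := by
      have := Fintype.card_pos (α := ι); omega
    by_cases hlt : ∑ a ∈ S, w a < q
    · rw [if_pos hlt, if_pos (Nat.mul_lt_mul_of_pos_left hlt hepos)]
      have e1 : ((e * q : ℕ) : ℤ) - ((e * ∑ a ∈ S, w a : ℕ) : ℤ) =
        e * ((q : ℤ) - ((∑ a ∈ S, w a : ℕ) : ℤ)) := by push_cast; ring
      rw [e1, mul_pow]
      have e3 : ((e : ℤ)) ^ Fintype.card ι = (e : ℤ) ^ (Fintype.card ι - 1) * e := by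
        conv_lhs => rw [hc]
        rw [pow_succ]
      rw [e3]
      push_cast
      ring
    · rw [if_neg hlt, if_neg (by
        intro h; exact hlt (Nat.lt_of_mul_lt_mul_left h))]
      simp
  · intro i
    exact Nat.div_pos (Nat.le_of_dvd (sz_pos p rep hrep i) (hes i)) hepos
  · have h2 : ∑ i, sz p i / addOrderOf τ = n / addOrderOf τ := by
      exact (Nat.sum_div (fun i _ => hes i)).symm.trans (by rw [sum_sz])
    rw [h2]
    apply Nat.div_lt_div_of_lt_of_dvd _ hkn
    have hdn : addOrderOf τ ∣ ∑ i, sz p i := Finset.dvd_sum (fun i _ => hes i)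
    rwa [sum_sz] at hdn

open Classical in
lemma hypDosp_mul [NeZero k] (hn : 0 < n) : hypDospCount n k σ * k =
    (univ.filter (fun f : Fin n → ZMod k => (∃ τ, Tw σ τ f) ∧ Hypersimplicial f)).card := by
  set A := univ.filter (fun f : Fin n → ZMod k => (∃ τ, Tw σ τ f) ∧ Hypersimplicial f) with hA
  have h1 : hypDospCount n k σ = (A.image (Quotient.mk (dospSetoid n k))).card := by
    rw [← Set.ncard_coe_finset]
    unfold hypDospCount
    congr 1
    ext D
    have hmem : ∀ f, f ∈ A ↔ (∃ τ, Tw σ τ f) ∧ Hypersimplicial f := by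
      intro f; simp [hA]
    simp only [Set.mem_ofPred_eq, Finset.coe_image, Set.mem_image, Finset.mem_coe, hmem]
    constructor
    · rintro ⟨f, h1, h2, h3⟩; exact ⟨f, ⟨h2, h3⟩, h1⟩
    · rintro ⟨f, ⟨h2, h3⟩, h1⟩; exact ⟨f, h1, h2, h3⟩
  rw [h1, Finset.card_eq_sum_card_image (Quotient.mk (dospSetoid n k)) A]
  rw [Finset.sum_congr rfl (g := fun _ => k)]
  · simp
  · intro D hD
    rw [Finset.mem_image] at hD
    obtain ⟨f, hf, rfl⟩ := hD
    have : A.filter (fun g => Quotient.mk (dospSetoid n k) g = Quotient.mk (dospSetoid n k) f) =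
        univ.image (fun (c : ZMod k) (i : Fin n) => f i + c) := by
      ext g
      simp only [Finset.mem_filter, Finset.mem_image, Finset.mem_univ, true_and]
      rw [Quotient.eq]
      constructor
      · rintro ⟨-, c, hc⟩
        exact ⟨c, (funext hc).symm⟩
      · rintro ⟨c, rfl⟩
        refine ⟨?_, c, fun i => rfl⟩
        simp only [hA, Finset.mem_filter, Finset.mem_univ, true_and] at hf ⊢
        obtain ⟨⟨τ, hτ⟩, hh⟩ := hf
        refine ⟨⟨τ, fun x => ?_⟩, ?_⟩
        · show f (σ⁻¹ x) + c = f x + c + τ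
          rw [hτ x]; ring
        · rw [Hyp_iff] at hh ⊢
          intro j
          rw [CBad_shift]
          exact hh j
    rw [this, Finset.card_image_of_injective, Finset.card_univ, ZMod.card]
    intro c d hcd
    have := congrFun hcd ⟨0, hn⟩
    simpa using this

include hp hrep in
lemma hypDosp_formula [Nonempty ι] [NeZero k] (hkn : k < n) :
    (hypDospCount n k σ : ℤ) = (k.gcd (gg (sz p)) : ℤ) * ∑ S : Finset ι, term (sz p) k S := by
  classical
  have hk : 0 < k := Nat.pos_of_ne_zero (NeZero.ne k)
  have h1 := hypDosp_mul (k := k) σ (by omega)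
  have hn : 0 < n := by omega
  have h2 : (univ.filter (fun f : Fin n → ZMod k => (∃ τ, Tw σ τ f) ∧ Hypersimplicial f)) =
      (univ.filter (fun τ : ZMod k => ∀ i, (sz p i : ZMod k) * τ = 0)).biUnion
        (fun τ => univ.filter (fun f : Fin n → ZMod k => Tw σ τ f ∧ Hypersimplicial f)) := by
    ext f
    simp only [Finset.mem_filter, Finset.mem_univ, true_and, Finset.mem_biUnion]
    constructor
    · rintro ⟨⟨τ, h⟩, hh⟩
      exact ⟨τ, Tw_mul σ p hp rep hrep h, h, hh⟩
    · rintro ⟨τ, -, h, hh⟩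
      exact ⟨⟨τ, h⟩, hh⟩
  rw [h2, Finset.card_biUnion] at h1
  · have h3 := congrArg (fun z : ℕ => (z : ℤ)) h1
    push_cast at h3
    rw [Finset.sum_congr rfl (g := fun _ => (k : ℤ) * ∑ S : Finset ι, term (sz p) k S)] at h3
    · rw [Finset.sum_const, card_tau, nsmul_eq_mul] at h3
      have hk' : (k : ℤ) ≠ 0 := by exact_mod_cast hk.ne'
      apply mul_right_cancel₀ hk'
      rw [h3]; ring
    · intro τ hτ
      simp only [Finset.mem_filter, Finset.mem_univ, true_and] at hτ
      rw [← card_Tw σ p hp rep hrep hkn τ hτ]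
  · intro τ _ τ' _ hne
    rw [Function.onFun, Finset.disjoint_left]
    intro f hf hf'
    simp only [Finset.mem_filter, Finset.mem_univ, true_and] at hf hf'
    apply hne
    have a := hf.1 ⟨0, hn⟩
    have b := hf'.1 ⟨0, hn⟩
    rw [a] at b
    exact add_left_cancel b

end
end HypS


/-- Theorem: for 2 ≤ k < n and σ ∈ S_n, the (finite) sum Σ_{m≥0} H*_m(σ) of the
equivariant H*-coefficients of Δ_{k,n} at σ equals the number of σ-fixed
hypersimplicial (k,n)-DOSPs; that is, H*(Δ_{k,n}; S_n)[1] is the permutation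
character of the S_n-action on hypersimplicial (k,n)-DOSPs. -/
theorem Hstar_eval_one_eq_card_fixed_hypersimplicial_dosps {n k : ℕ}
    (hk : 2 ≤ k) (hkn : k < n) (σ : Equiv.Perm (Fin n)) (H : ℕ → ℤ)
    (hH : (PowerSeries.mk fun d => (fixedPtCount k σ d : ℤ)) *
        ∏ C ∈ cycleSets σ, (1 - PowerSeries.X ^ C.card) = PowerSeries.mk fun m => H m) :
    (∃ N : ℕ, ∀ m, N ≤ m → H m = 0) ∧
    ∀ N : ℕ, (∀ m, N ≤ m → H m = 0) →
      ∑ m ∈ Finset.range N, H m = (hypDospCount n k σ : ℤ) := by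
  classical
  have hn : 0 < n := by omega
  have hk0 : 0 < k := by omega
  have : NeZero k := ⟨hk0.ne'⟩
  let p : Fin n → {C // C ∈ cycleSets σ} := fun x =>
    ⟨univ.filter fun y => σ.SameCycle x y, Finset.mem_image.2 ⟨x, Finset.mem_univ x, rfl⟩⟩
  have hp : ∀ x y, p x = p y ↔ σ.SameCycle x y := by
    intro x y
    rw [Subtype.ext_iff]
    constructor
    · intro h
      have h2 : y ∈ (p y).1 := by simp [p, Equiv.Perm.SameCycle.refl]
      rw [← h] at h2
      simpa [p] using h2
    · intro h
      ext z
      simp only [p, Finset.mem_filter, Finset.mem_univ, true_and]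
      exact ⟨fun h2 => h.symm.trans h2, fun h2 => h.trans h2⟩
  have hsurj : ∀ C : {C // C ∈ cycleSets σ}, ∃ x, p x = C := by
    rintro ⟨C, hC⟩
    obtain ⟨x, -, hx⟩ := Finset.mem_image.1 hC
    exact ⟨x, Subtype.ext hx⟩
  choose rep hrep using hsurj
  have : Nonempty {C // C ∈ cycleSets σ} := ⟨p ⟨0, hn⟩⟩
  have hsz : ∀ C : {C // C ∈ cycleSets σ}, HypS.sz p C = C.1.card := by
    intro C
    unfold HypS.sz
    congr 1
    ext x
    simp only [Finset.mem_filter, Finset.mem_univ, true_and]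
    conv_lhs => rw [← hrep C, eq_comm, hp]
    conv_rhs => rw [← hrep C]
    simp [p]
  have hprod : ∏ C ∈ cycleSets σ, (1 - (PowerSeries.X : PowerSeries ℤ) ^ C.card) =
      ∏ C : {C // C ∈ cycleSets σ}, (1 - (PowerSeries.X : PowerSeries ℤ) ^ HypS.sz p C) := by
    rw [← Finset.prod_coe_sort]
    apply Finset.prod_congr rfl
    intro C _
    rw [hsz]
  have hE := HypS.ehrhart (HypS.sz p) (HypS.sz_pos p rep hrep) k hk0
  rw [hprod] at hH
  simp only [HypS.fixedPtCount_eq σ p hp rep hrep] at hH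
  rw [hH] at hE
  have hcoef : ∀ m, H m = (HypS.polT (HypS.sz p) k).coeff m := by
    intro m
    have := congrArg (PowerSeries.coeff m) hE
    simpa using this
  constructor
  · refine ⟨(HypS.polT (HypS.sz p) k).natDegree + 1, fun m hm => ?_⟩
    rw [hcoef]
    exact Polynomial.coeff_eq_zero_of_natDegree_lt (by omega)
  · intro N hN
    rw [HypS.hypDosp_formula σ p hp rep hrep hkn, ← HypS.polT_eval]
    rcases Nat.eq_zero_or_pos N with rfl | hNpos
    · have : HypS.polT (HypS.sz p) k = 0 := by
        ext m; rw [← hcoef, hN m (Nat.zero_le _)]; simp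
      rw [this]; simp
    · have hdeg : (HypS.polT (HypS.sz p) k).natDegree < N := by
        by_cases h0 : HypS.polT (HypS.sz p) k = 0
        · rw [h0]; simpa using hNpos
        · rw [Polynomial.natDegree_lt_iff_degree_lt h0, Polynomial.degree_lt_iff_coeff_zero]
          intro m hm
          rw [← hcoef]
          exact hN m hm
      rw [Polynomial.eval_eq_sum_range' hdeg]
      simp [hcoef]
end

section
/- Fix integers 0 < k < n and a permutation σ ∈ S_n with cycle lengths s_1,…,s_r, and let g = gcd(k, s_1,…,s_r). Then the number of σ-fixed (k,n)-DOSPs is exactly g·k^{r−1}. -/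
open Finset

/-- the cycle set of a point -/
def cycSet {n : ℕ} (σ : Equiv.Perm (Fin n)) (x : Fin n) : Finset (Fin n) :=
  Finset.univ.filter fun y => σ.SameCycle x y

theorem cycSet_mem {n : ℕ} (σ : Equiv.Perm (Fin n)) (x : Fin n) : cycSet σ x ∈ cycleSets σ :=
  Finset.mem_image.2 ⟨x, Finset.mem_univ _, rfl⟩

theorem cycSet_eq {n : ℕ} {σ : Equiv.Perm (Fin n)} {x y : Fin n} (h : σ.SameCycle x y) :
    cycSet σ x = cycSet σ y := by
  ext z
  simp only [cycSet, Finset.mem_filter, Finset.mem_univ, true_and]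
  exact ⟨fun h' => h.symm.trans h', fun h' => h.trans h'⟩

theorem cycSet_rep {n : ℕ} (σ : Equiv.Perm (Fin n)) (C : cycleSets σ) :
    ∃ x, cycSet σ x = C.1 := by
  obtain ⟨x, -, hx⟩ := Finset.mem_image.1 C.2
  exact ⟨x, hx⟩

theorem card_cycSet_dvd {n : ℕ} (σ : Equiv.Perm (Fin n)) (x : Fin n) (m : ℤ) :
    (σ ^ m) x = x ↔ ((cycSet σ x).card : ℤ) ∣ m := by
  classical
  have h1 := MulAction.zpow_smul_eq_iff_minimalPeriod_dvd (a := σ) (b := x) (n := m)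
  rw [MulAction.minimalPeriod_eq_card] at h1
  have h2 : Fintype.card (MulAction.orbit (Subgroup.zpowers σ) x) = (cycSet σ x).card := by
    rw [← Set.toFinset_card]
    congr 1
    ext y
    simp only [Set.mem_toFinset, cycSet, Finset.mem_filter, Finset.mem_univ, true_and]
    rw [MulAction.mem_orbit_iff]
    constructor
    · rintro ⟨⟨_, j, rfl⟩, hy⟩
      exact ⟨j, hy⟩
    · rintro ⟨j, hy⟩
      exact ⟨⟨_, j, rfl⟩, hy⟩
  rw [h2] at h1
  exact h1

theorem shift_zpow {n k : ℕ} {σ : Equiv.Perm (Fin n)} {f : Fin n → ZMod k} {τ : ZMod k}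
    (h : ∀ i, f (σ⁻¹ i) = f i + τ) (m : ℤ) (x : Fin n) : f ((σ ^ m) x) = f x - m • τ := by
  have h1 : ∀ y, f (σ y) = f y - τ := by
    intro y
    have := h (σ y)
    rw [show σ⁻¹ (σ y) = y from σ.symm_apply_apply y] at this
    rw [this]; ring
  induction m using Int.induction_on with
  | zero => simp
  | succ j ih =>
    rw [add_comm, zpow_add, zpow_one, Equiv.Perm.mul_apply, h1, ih, add_zsmul, one_zsmul]; ring
  | pred j ih =>
    rw [sub_eq_add_neg, add_comm, zpow_add, zpow_neg_one, Equiv.Perm.mul_apply, h, ih, add_zsmul,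
      neg_one_zsmul]; ring

/-- functions fixed up to constant -/
def fixedFun {n : ℕ} (k : ℕ) (σ : Equiv.Perm (Fin n)) : Set (Fin n → ZMod k) :=
  {f | ∃ τ : ZMod k, ∀ i, f (σ⁻¹ i) = f i + τ}

/-- admissible shifts -/
def shifts {n : ℕ} (k : ℕ) (σ : Equiv.Perm (Fin n)) : Set (ZMod k) :=
  {τ | ∀ C ∈ cycleSets σ, C.card • τ = 0}

theorem card_fixedFun {n k : ℕ} (hn : 0 < n) (σ : Equiv.Perm (Fin n)) :
    Nat.card (fixedFun k σ) = Nat.card (shifts k σ × (cycleSets σ → ZMod k)) := by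
  classical
  choose rep hrep using cycSet_rep σ
  have hsame : ∀ x, σ.SameCycle (rep ⟨cycSet σ x, cycSet_mem σ x⟩) x := by
    intro x
    have h := hrep ⟨cycSet σ x, cycSet_mem σ x⟩
    have hx : x ∈ cycSet σ x := by simp [cycSet, Equiv.Perm.SameCycle.refl]
    simp only at h
    rw [← h] at hx
    exact (Finset.mem_filter.1 hx).2
  symm
  choose e he using hsame
  -- shifts from functions
  have hsh : ∀ (f : Fin n → ZMod k) (τ : ZMod k), (∀ i, f (σ⁻¹ i) = f i + τ) → τ ∈ shifts k σ := by
    intro f τ h C hC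
    have h1 := shift_zpow h (C.card : ℤ) (rep ⟨C, hC⟩)
    rw [(card_cycSet_dvd σ _ _).2 (by rw [hrep])] at h1
    rw [natCast_zsmul] at h1
    exact (sub_eq_self.1 h1.symm)
  let F : shifts k σ × (cycleSets σ → ZMod k) → (Fin n → ZMod k) := fun p x =>
    p.2 ⟨cycSet σ x, cycSet_mem σ x⟩ - e x • p.1.1
  -- well-definedness
  have hwd : ∀ (p : shifts k σ × (cycleSets σ → ZMod k)) (x : Fin n) (C : cycleSets σ) (m : ℤ),
      (σ ^ m) (rep C) = x → F p x = p.2 C - m • p.1.1 := by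
    intro p x C m hx
    have hC : (⟨cycSet σ x, cycSet_mem σ x⟩ : cycleSets σ) = C := by
      apply Subtype.ext
      rw [← hrep C]
      exact (cycSet_eq ⟨m, hx⟩).symm
    have hd : (σ ^ (e x - m)) (rep C) = rep C := by
      have h1 := he x
      rw [hC] at h1
      rw [sub_eq_add_neg, add_comm, zpow_add, Equiv.Perm.mul_apply, h1, ← hx, ← Equiv.Perm.mul_apply,
        ← zpow_add]
      simp
    rw [card_cycSet_dvd, hrep] at hd
    obtain ⟨q, hq⟩ := hd
    have h0 : (e x - m) • p.1.1 = 0 := by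
      rw [hq, mul_comm, mul_zsmul, natCast_zsmul, p.1.2 C.1 C.2, zsmul_zero]
    rw [sub_zsmul, ← sub_eq_add_neg, sub_eq_zero] at h0
    simp only [F, hC, h0]
  have hF : ∀ p i, F p (σ⁻¹ i) = F p i + p.1.1 := by
    intro p i
    rw [hwd p (σ⁻¹ i) ⟨cycSet σ i, cycSet_mem σ i⟩ (-1 + e i)
      (by rw [zpow_add, Equiv.Perm.mul_apply, he, zpow_neg_one])]
    simp only [F, add_zsmul, neg_one_zsmul]
    ring
  refine Nat.card_congr (Equiv.ofBijective (fun p => ⟨F p, p.1.1, hF p⟩) ⟨?_, ?_⟩)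
  · intro p q hpq
    have hpq : F p = F q := congrArg Subtype.val hpq
    have h1 : p.1 = q.1 := by
      apply Subtype.ext
      have a := hF p ⟨0, hn⟩
      rw [hpq, hF q] at a
      exact (add_left_cancel a).symm
    refine Prod.ext h1 (funext fun C => ?_)
    have a := hwd p (rep C) C 0 (by simp)
    have b := hwd q (rep C) C 0 (by simp)
    rw [hpq, b] at a
    simpa using a.symm
  · rintro ⟨f, τ, hf⟩
    refine ⟨⟨⟨τ, hsh f τ hf⟩, fun C => f (rep C)⟩, Subtype.ext (funext fun x => ?_)⟩
    have h1 := shift_zpow hf (e x) (rep ⟨cycSet σ x, cycSet_mem σ x⟩)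
    rw [he] at h1
    exact h1.symm

theorem card_fixedFun' {n k : ℕ} (hn : 0 < n) (σ : Equiv.Perm (Fin n)) :
    Nat.card (fixedFun k σ) = Nat.card ({D : Quotient (dospSetoid n k) |
        ∃ f : Fin n → ZMod k, Quotient.mk (dospSetoid n k) f = D ∧
          ∃ τ : ZMod k, ∀ i, f (σ⁻¹ i) = f i + τ} × ZMod k) := by
  refine Nat.card_congr (Equiv.ofBijective
    (fun f => ⟨⟨Quotient.mk _ f.1, f.1, rfl, f.2⟩, f.1 ⟨0, hn⟩⟩) ⟨?_, ?_⟩)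
  · rintro ⟨f, hf⟩ ⟨g, hg⟩ h
    simp only [Prod.mk.injEq, Subtype.mk.injEq] at h
    obtain ⟨h1, h2⟩ := h
    obtain ⟨c, hc⟩ := Quotient.exact h1
    have hc0 : c = 0 := by
      have := hc ⟨0, hn⟩
      rw [h2] at this
      simpa using this
    apply Subtype.ext
    funext i
    simpa [hc0] using hc i
  · rintro ⟨⟨D, f, rfl, τ, hf⟩, c⟩
    refine ⟨⟨fun i => f i + (c - f ⟨0, hn⟩), τ, fun i => by simp only [hf]; ring⟩, ?_⟩
    refine Prod.ext (Subtype.ext (Quotient.sound ⟨c - f ⟨0, hn⟩, fun i => rfl⟩)) ?_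
    simp

/-- Lemma: for 0 < k < n and σ ∈ S_n with cycle lengths s_1,…,s_r and
g = gcd(k, s_1,…,s_r), the number of σ-fixed (k,n)-DOSPs is exactly g·k^{r−1}. -/
theorem card_fixed_dosps {n k r : ℕ} (hk : 0 < k) (hkn : k < n)
    (σ : Equiv.Perm (Fin n)) (s : Fin r → ℕ)
    (hs : Multiset.map s Finset.univ.val = Multiset.map Finset.card (cycleSets σ).val) :
    Set.ncard {D : Quotient (dospSetoid n k) |
        ∃ f : Fin n → ZMod k, Quotient.mk (dospSetoid n k) f = D ∧
          ∃ τ : ZMod k, ∀ i, f (σ⁻¹ i) = f i + τ} =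
      Nat.gcd k (Finset.univ.gcd s) * k ^ (r - 1) := by
  classical
  have : NeZero k := ⟨hk.ne'⟩
  have hn : 0 < n := hk.trans hkn
  have hr : r = (cycleSets σ).card := by
    have := congrArg Multiset.card hs
    simpa using this
  have hr0 : 0 < r := by
    rw [hr]
    exact Finset.card_pos.2 ⟨_, cycSet_mem σ ⟨0, hn⟩⟩
  have hT : Nat.card (shifts k σ) = Nat.gcd k (Finset.univ.gcd s) := by
    have h := IsAddCyclic.card_nsmulAddMonoidHom_ker (G := ZMod k) (Finset.univ.gcd s)
    rw [Nat.card_zmod] at h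
    rw [← h]
    refine Nat.card_congr (Equiv.subtypeEquivRight fun τ => ?_)
    rw [AddMonoidHom.mem_ker, nsmulAddMonoidHom_apply, ← addOrderOf_dvd_iff_nsmul_eq_zero,
      Finset.dvd_gcd_iff]
    have hmem : ∀ a, (∃ i, s i = a) ↔ ∃ C ∈ cycleSets σ, C.card = a := by
      intro a
      have : a ∈ Multiset.map s Finset.univ.val ↔
        a ∈ Multiset.map Finset.card (cycleSets σ).val := by rw [hs]
      simpa using this
    constructor
    · intro h i _
      obtain ⟨C, hC, hCi⟩ := (hmem (s i)).1 ⟨i, rfl⟩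
      rw [← hCi]
      exact addOrderOf_dvd_iff_nsmul_eq_zero.2 (h C hC)
    · intro h C hC
      obtain ⟨i, hi⟩ := (hmem C.card).2 ⟨C, hC, rfl⟩
      rw [← hi]
      exact addOrderOf_dvd_iff_nsmul_eq_zero.1 (h i (Finset.mem_univ _))
  have h1 := (card_fixedFun' (k := k) hn σ).symm.trans (card_fixedFun hn σ)
  rw [Nat.card_prod, Nat.card_prod, Nat.card_zmod, hT, Nat.card_fun, Nat.card_zmod,
    Nat.card_eq_fintype_card (α := cycleSets σ), Fintype.card_coe, ← hr] at h1
  rw [← Nat.card_coe_set_eq]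
  refine Nat.eq_of_mul_eq_mul_right hk (h1.trans ?_)
  rw [mul_assoc, ← pow_succ, Nat.sub_add_cancel hr0]
end
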